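/- Let H satisfy the Hurst hypotheses with 1/2 < H(x) < 1 and Leb(D) = 0, and let μ be a centered Gaussian measure on the real Hilbert space L²(0,1) with covariance kernel G(x,y) = ∫₀^{min(x,y)} K(x,z,H(x)) · K(y,z,H(y)) dz, where K(x,y,H) := c_*(H) · y^{1/2−H} · ∫_y^x (z−y)^{H−3/2} z^{H−1/2} dz for 0 < y < x ≤ 1 and K(x,y,H) := 0 for y ≥ x. Then lim_{ε→0⁺} ε^{1/H_min} · ((log(1/ε))^σ / φ(log(1/ε)))^{(2H_min+1)/(2H_min)} · log μ({f : ‖f‖_{L²(0,1)} ≤ ε}) = − H_min · ( (Γ(2H_min+1)·sin(πH_min))^{1/(2H_min+1)} · Γ(σ+1) · (H_min·(H_min+1/2))^σ / ((2H_min+1)·sin(π/(2H_min+1))) )^{(2H_min+1)/(2H_min)}. -/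

import Mathlib

open MeasureTheory Set Filter Metric
open scoped ENNReal NNReal Real

noncomputable section

/-- `c_*(H) = (H(2H−1)Γ(3/2−H)/(Γ(2−2H)Γ(H−1/2)))^{1/2}`. -/
def cstar (H : ℝ) : ℝ :=
  Real.sqrt (H * (2 * H - 1) * Real.Gamma (3/2 - H) /
    (Real.Gamma (2 - 2*H) * Real.Gamma (H - 1/2)))

/-- The kernel `K(x, y, H)` of the multifractal Brownian motion. -/
def Kker (x y Hv : ℝ) : ℝ :=
  if 0 < y ∧ y < x then
    cstar Hv * y ^ ((1:ℝ)/2 - Hv) * ∫ z in Ioo y x, (z - y) ^ (Hv - 3/2) * z ^ (Hv - 1/2)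
  else 0

/-- Covariance kernel of the multifractal Brownian motion with functional Hurst
parameter `H`. -/
def GmfBM (H : ℝ → ℝ) (x y : ℝ) : ℝ :=
  ∫ z in Ioo (0:ℝ) (min x y), Kker x z (H x) * Kker y z (H y)

/-- Hölder continuity of exponent `r` on a set. -/
def HolderOn (f : ℝ → ℝ) (r : ℝ) (s : Set ℝ) : Prop :=
  ∃ C : ℝ, ∀ x ∈ s, ∀ y ∈ s, |f x - f y| ≤ C * |x - y| ^ r
section
set_option linter.all false
open Real
local notation:max "ca" x:max => (x : ℝ)
local notation "li" => (by linarith)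
local notation "po" => (by positivity)
local notation "fp" => (by fun_prop)
local notation "uI" => Ioo (0:ℝ) 1
local notation:max "dv" j:max n:max => ((j:ℝ)/n)
local notation:max "em" e:max => (-(1/2-e))
local notation "ll" => mul_le_mul_of_nonneg_left
local notation "lr" => mul_le_mul_of_nonneg_right
local notation "im" => integral_const_mul
local notation "mo" => measurableSet_Ioo
local notation "mi" => measurableSet_Ioi
local notation "sf" => setIntegral_congr_fun
local notation "rl" => rpow_le_rpow_of_exponent_le
local notation "gp" => Gamma_pos_of_pos
local notation "io" => intervalIntegral.integral_of_le
local notation "oo" => integral_Ioc_eq_integral_Ioo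
local notation "na" => norm_eq_abs
local notation "rg" => Finset.range
local notation "gR" => ProbabilityTheory.gaussianReal
local notation "ms" => Finset.mul_sum
local notation "sc" => Finset.sum_congr
local notation "rp" => rpow_le_rpow_of_nonpos
local notation "nl" => (by nlinarith)
local notation "nn" => (by norm_num)
section
lemma c0p {n : ℕ} (h : 1 ≤ n) : ca 0 < n := by exact_mod_cast h
lemma la_chain : ∀ (n : ℕ) (M : Matrix (Fin n) (Fin n) ℝ) (_ : M.PosDef),
    ∃ s : Fin n → ℝ, M.det = ∏ i, s i ∧ ∀ i, 0 < s i ∧ s i ≤ M i i ∧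
      ∃ v : Fin n → ℝ, v i = 1 ∧ (∀ j, i < j → v j = 0) ∧ v ⬝ᵥ (M.mulVec v) = s i := by
  intro n
  induction n with
  | zero => intro M _; exact ⟨fun _ => 1, by simp, fun i => i.elim0⟩
  | succ n ih =>
    intro M hM
    set e : Fin n ⊕ Fin 1 ≃ Fin (n+1) := finSumFinEquiv
    have eL : ∀ i : Fin n, e (Sum.inl i) = Fin.castSucc i := fun i => rfl
    have eR : ∀ i : Fin 1, e (Sum.inr i) = Fin.last n := by
      intro i; fin_cases i; rfl
    set A : Matrix (Fin n) (Fin n) ℝ := M.submatrix Fin.castSucc Fin.castSucc with hA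
    have hApd := hM.submatrix (Fin.castSucc_injective n)
    set b : Fin n → ℝ := fun i => M (Fin.castSucc i) (Fin.last n) with hb
    have hsym : ∀ i j, M i j = M j i := fun i j => by
      have := congrFun (congrFun hM.1 j) i; simpa using this
    obtain ⟨s, hs, hs2⟩ := ih A hApd
    set c := M (Fin.last n) (Fin.last n) with hc
    have hAu := (Matrix.isUnit_iff_isUnit_det A).1 hApd.isUnit
    set y : Fin n → ℝ := A⁻¹.mulVec b with hy
    have hAy : A.mulVec y = b := by
      rw [hy, Matrix.mulVec_mulVec, Matrix.mul_nonsing_inv A hAu, Matrix.one_mulVec]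
    have hAinv := hApd.inv
    have hdet : M.det = A.det * (c - b ⬝ᵥ y) := by
      have h1 : M.submatrix e e = Matrix.fromBlocks A (Matrix.of fun i _ => b i)
          (Matrix.of fun _ j => b j) (Matrix.of fun _ _ => c) := by
        ext i j
        rcases i with i | i <;> rcases j with j | j <;>
          simp [eL, eR, hA, hb, hc, hsym (Fin.last n)]
      rw [← Matrix.det_submatrix_equiv_self e M, h1]
      have := Matrix.invertibleOfIsUnitDet A hAu
      rw [Matrix.det_fromBlocks₁₁]
      congr 1
      rw [Matrix.det_fin_one, Matrix.sub_apply, Matrix.mul_assoc, Matrix.mul_apply]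
      simp [dotProduct, hy, Matrix.mulVec, Matrix.mul_apply, Matrix.invOf_eq_nonsing_inv]
    have hbAb : 0 ≤ b ⬝ᵥ y := by
      have := hAinv.posSemidef.dotProduct_mulVec_nonneg b; simpa [hy] using this
    set v : Fin (n+1) → ℝ := Fin.snoc (fun i => - y i) 1 with hv
    have hvq : ∀ w : Fin n → ℝ, ∀ t : ℝ, (Fin.snoc w t : Fin (n+1) → ℝ) ⬝ᵥ M.mulVec (Fin.snoc w t : Fin (n+1) → ℝ) = w ⬝ᵥ A.mulVec w + 2 * t * (b ⬝ᵥ w) + t^2 * c := by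
      intro w t
      simp only [dotProduct, Matrix.mulVec, Fin.sum_univ_castSucc, Fin.snoc_castSucc, Fin.snoc_last, hA, Matrix.submatrix_apply, hb, hsym (Fin.last n) (Fin.castSucc _), mul_add, Finset.sum_add_distrib, ms, ← hc]
      have : ∑ x, w x * (M x.castSucc (Fin.last n) * t) = ∑ x, t * (M x.castSucc (Fin.last n) * w x) :=
        sc rfl fun x _ => by ring
      rw [this]
      have : ∑ x, 2 * t * (M x.castSucc (Fin.last n) * w x) = 2 * ∑ x, t * (M x.castSucc (Fin.last n) * w x) := by
        rw [ms]; exact sc rfl fun x _ => by ring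
      rw [this]; ring
    have hvval : v ⬝ᵥ M.mulVec v = c - b ⬝ᵥ y := by
      rw [hv, hvq]
      have e1 : (fun i => - y i) = -y := rfl
      rw [e1, Matrix.mulVec_neg, hAy, neg_dotProduct_neg, dotProduct_neg, dotProduct_comm y b]; ring
    have hpos : 0 < c - b ⬝ᵥ y := by
      rw [← hvval]
      have hv0 : v ≠ 0 := fun h => by
        have := congrFun h (Fin.last n); simp [hv] at this
      simpa using hM.dotProduct_mulVec_pos hv0
    refine ⟨Fin.snoc s (c - b ⬝ᵥ y), ?_, ?_⟩
    · rw [Fin.prod_univ_castSucc]; simp [hdet, hs]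
    · intro i
      refine Fin.lastCases ?_ (fun i => ?_) i
      · refine ⟨by simpa using hpos, by simp only [Fin.snoc_last]; linarith, v, by simp [hv], fun j hj => absurd hj (not_lt.2 (Fin.le_last j)), by simpa using hvval⟩
      · obtain ⟨h1, h2, w, hw1, hw2, hw3⟩ := hs2 i
        refine ⟨by simpa using h1, by simpa [hA] using h2, Fin.snoc w 0, by simpa using hw1, ?_, ?_⟩
        · intro j
          refine Fin.lastCases ?_ (fun j => ?_) j
          · simp
          · intro h; simpa using hw2 j (by simpa using h)
        · rw [hvq]; simpa using hw3
variable {ι : Type*} [Fintype ι] [DecidableEq ι]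
lemma la_hadamard (M : Matrix ι ι ℝ) (hM : M.PosDef) : M.det ≤ ∏ i, M i i := by
  set e := (Fintype.equivFin ι).symm
  obtain ⟨s, h1, h2⟩ := la_chain _ (M.submatrix e e) (hM.submatrix e.injective)
  rw [← Matrix.det_submatrix_equiv_self e M, h1, ← Equiv.prod_comp e]
  exact Finset.prod_le_prod (fun i _ => (h2 i).1.le) fun i _ => (h2 i).2.1
lemma la_one_le (S : Matrix ι ι ℝ) (hS : S.PosSemidef) : 1 ≤ (1 + S).det := by
  set e := (Fintype.equivFin ι).symm
  have hM := Matrix.PosDef.one.add_posSemidef hS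
  obtain ⟨s, h1, h2⟩ := la_chain _ ((1+S).submatrix e e) (hM.submatrix e.injective)
  rw [← Matrix.det_submatrix_equiv_self e, h1]
  refine le_trans (by simp) (Finset.prod_le_prod (f := fun _ => ca 1) (fun i _ => zero_le_one) fun i _ => ?_)
  obtain ⟨_, _, v, hv, _, hq⟩ := h2 i
  have hS' := hS.submatrix e
  have e1 : (1+S).submatrix e e = 1 + S.submatrix e e := by
    ext i j; simp [Matrix.one_apply]
  rw [← hq, e1, Matrix.add_mulVec, Matrix.one_mulVec, dotProduct_add]
  have a := hS'.dotProduct_mulVec_nonneg v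
  have b : 1 ≤ v ⬝ᵥ v := by
    have := Finset.single_le_sum (f := fun i => v i * v i) (fun i _ => mul_self_nonneg (v i)) (Finset.mem_univ i)
    simpa [hv, dotProduct] using this
  simp only [star_trivial] at a
  linarith
lemma la_fac (S : Matrix ι ι ℝ) (hS : S.PosSemidef) : ∃ W : Matrix ι ι ℝ, S = W.transpose * W := by
  open scoped MatrixOrder Matrix.Norms.L2Operator in
  obtain ⟨W, hW⟩ := CStarAlgebra.nonneg_iff_eq_star_mul_self.mp hS.nonneg
  exact ⟨W, by simpa [Matrix.star_eq_conjTranspose] using hW⟩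
lemma la_split (A W : Matrix ι ι ℝ) (hA : A.PosSemidef) :
    (1 + A + W.transpose * W).det = (1 + A).det * (1 + W * (1 + A)⁻¹ * W.transpose).det := by
  have hM := Matrix.PosDef.one.add_posSemidef hA
  have hu := (Matrix.isUnit_iff_isUnit_det _).1 hM.isUnit
  have : 1 + A + W.transpose * W = (1 + A) * (1 + ((1+A)⁻¹ * W.transpose) * W) := by
    rw [mul_add, mul_one, Matrix.mul_assoc, ← Matrix.mul_assoc (1+A), Matrix.mul_nonsing_inv _ hu, Matrix.one_mul]
  rw [this, Matrix.det_mul, Matrix.det_one_add_mul_comm, Matrix.mul_assoc]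
lemma la_mono (A B : Matrix ι ι ℝ) (hA : A.PosSemidef) (hB : B.PosSemidef) :
    (1 + A).det ≤ (1 + A + B).det := by
  obtain ⟨W, rfl⟩ := la_fac B hB
  rw [la_split A W hA]
  have hM := Matrix.PosDef.one.add_posSemidef hA
  have h2 : (W * (1 + A)⁻¹ * W.transpose).PosSemidef := by
    simpa using hM.inv.posSemidef.mul_mul_conjTranspose_same W
  nlinarith [la_one_le _ h2, la_one_le A hA]
lemma la_submul (A B : Matrix ι ι ℝ) (hA : A.PosSemidef) (hB : B.PosSemidef) :
    (1 + A + B).det ≤ (1 + A).det * (1 + B).det := by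
  obtain ⟨W, rfl⟩ := la_fac B hB
  rw [la_split A W hA]
  have hM := Matrix.PosDef.one.add_posSemidef hA
  have hu := (Matrix.isUnit_iff_isUnit_det _).1 hM.isUnit
  have h2 : (W * (1 + A)⁻¹ * W.transpose).PosSemidef := by
    simpa using hM.inv.posSemidef.mul_mul_conjTranspose_same W
  set R := (1+A)⁻¹
  have hRA := Matrix.nonsing_inv_mul _ hu
  have hAR := Matrix.mul_nonsing_inv _ hu
  have hRs : R.transpose = R := by have := hM.inv.1; rwa [Matrix.IsHermitian, Matrix.conjTranspose_eq_transpose_of_trivial] at this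
  have hAs : A.transpose = A := by have := hA.1; rwa [Matrix.IsHermitian, Matrix.conjTranspose_eq_transpose_of_trivial] at this
  have h3 : (1 - R).PosSemidef := by
    have e1 : 1 - R = R * A * R.transpose + (R * A) * (R * A).transpose := by
      have : 1 - R = R * A := by rw [← hRA]; noncomm_ring
      rw [this, Matrix.transpose_mul, hRs, hAs]
      calc R * A = R * A * ((1 + A) * R) := by rw [hAR, mul_one]
        _ = _ := by noncomm_ring
    rw [e1]
    refine Matrix.PosSemidef.add ?_ ?_
    · simpa using hA.mul_mul_conjTranspose_same R
    · simpa using Matrix.posSemidef_self_mul_conjTranspose (R * A)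
  have h4 : (W * (1 - R) * W.transpose).PosSemidef := by
    simpa using h3.mul_mul_conjTranspose_same W
  refine ll ?_ (zero_le_one.trans (la_one_le A hA))
  have := la_mono _ _ h2 h4
  have e2 : 1 + W * R * W.transpose + W * (1 - R) * W.transpose = 1 + W * W.transpose := by noncomm_ring
  rwa [e2, Matrix.det_one_add_mul_comm W] at this
section gram
variable {E : Type*} [NormedAddCommGroup E] [InnerProductSpace ℝ E]
lemma gram_quad (g : ι → E) (v : ι → ℝ) :
    v ⬝ᵥ (Matrix.gram ℝ g).mulVec v = ‖∑ i, v i • g i‖ ^ 2 := by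
  rw [← real_inner_self_eq_norm_sq]
  simp only [dotProduct, Matrix.mulVec, Matrix.gram_apply, sum_inner, inner_sum, real_inner_smul_left, real_inner_smul_right, ms]
  exact sc rfl fun i _ => sc rfl fun j _ => by rw [real_inner_comm]; ring
lemma psd_of {M : Matrix ι ι ℝ} (hs : M.transpose = M) (h : ∀ v, 0 ≤ v ⬝ᵥ M.mulVec v) : M.PosSemidef :=
  Matrix.PosSemidef.of_dotProduct_mulVec_nonneg
    (by rwa [Matrix.IsHermitian, Matrix.conjTranspose_eq_transpose_of_trivial]) (by simpa using h)
lemma gram_tr (g : ι → E) : (Matrix.gram ℝ g).transpose = Matrix.gram ℝ g := by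
  ext i j; simp [Matrix.gram_apply, real_inner_comm]
lemma gram_psd (g : ι → E) (c : ℝ) (hc : 0 ≤ c) : (c • Matrix.gram ℝ g).PosSemidef :=
  psd_of (by rw [Matrix.transpose_smul, gram_tr]) fun v => by
    rw [Matrix.smul_mulVec, dotProduct_smul, gram_quad]; positivity
lemma la_had_gram (g : ι → E) (c : ℝ) (hc : 0 ≤ c) :
    (1 + c • Matrix.gram ℝ g).det ≤ ∏ i, (1 + c * ‖g i‖ ^ 2) := by
  refine (la_hadamard _ (Matrix.PosDef.one.add_posSemidef (gram_psd g c hc))).trans (le_of_eq ?_)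
  simp [Matrix.gram_apply]
lemma la_upper (g1 g2 g3 : ι → E) (γ δ : ℝ) (hγ : 0 < γ) (hδ : 0 < δ) (hδ1 : δ ≤ 1) :
    (1 + γ • Matrix.gram ℝ (fun i => g1 i + g2 i + g3 i)).det ≤
      (∏ i, (1 + (1+δ) * γ * ‖g1 i‖ ^ 2)) * (1 + (γ * (4/δ)) • Matrix.gram ℝ g2).det *
        exp (γ * (4/δ) * ∑ i, ‖g3 i‖ ^ 2) := by
  have p1 := gram_psd g1 ((1+δ)*γ) po
  have p2 := gram_psd g2 (γ*(4/δ)) po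
  have p3 := gram_psd g3 (γ*(4/δ)) po
  have p0 := gram_psd (fun i => g1 i + g2 i + g3 i) γ hγ.le
  set A0 := γ • Matrix.gram ℝ (fun i => g1 i + g2 i + g3 i) with hA0
  set A1 := ((1+δ)*γ) • Matrix.gram ℝ g1 with hA1
  set A2 := (γ*(4/δ)) • Matrix.gram ℝ g2 with hA2
  set A3 := (γ*(4/δ)) • Matrix.gram ℝ g3 with hA3
  have key : (A1 + A2 + A3 - A0).PosSemidef := by
    refine psd_of (by simp only [hA0, hA1, hA2, hA3, Matrix.transpose_sub, Matrix.transpose_add, Matrix.transpose_smul, gram_tr]) fun v => ?_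
    simp only [hA0, hA1, hA2, hA3, Matrix.sub_mulVec, Matrix.add_mulVec, Matrix.smul_mulVec, dotProduct_sub, dotProduct_add, dotProduct_smul, gram_quad, smul_add, Finset.sum_add_distrib, smul_eq_mul]
    set x := ∑ i, v i • g1 i
    set y := ∑ i, v i • g2 i
    set z := ∑ i, v i • g3 i
    have h1 : ‖x + y + z‖ ≤ ‖x‖ + ‖y‖ + ‖z‖ := norm_add₃_le
    have h2 : ‖x + y + z‖^2 ≤ (‖x‖ + ‖y‖ + ‖z‖)^2 := by gcongr
    have h3 : (‖x‖ + ‖y‖ + ‖z‖)^2 ≤ (1+δ) * ‖x‖^2 + (4/δ) * ‖y‖^2 + (4/δ)*‖z‖^2 := by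
      have e : (1+δ) * ‖x‖^2 + (4/δ) * ‖y‖^2 + (4/δ)*‖z‖^2 - (‖x‖ + ‖y‖ + ‖z‖)^2 =
        ((δ * ‖x‖ - (‖y‖+‖z‖))^2 + (2*(‖y‖^2+‖z‖^2) - (‖y‖+‖z‖)^2) + 2*(1 - δ)*(‖y‖^2+‖z‖^2) + δ * (2*(‖y‖^2+‖z‖^2) - (‖y‖+‖z‖)^2)) / δ := by
        field_simp; ring
      have : 0 ≤ 2*(‖y‖^2+‖z‖^2) - (‖y‖+‖z‖)^2 := by nlinarith [sq_nonneg (‖y‖-‖z‖)]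
      have : 0 ≤ (1+δ) * ‖x‖^2 + (4/δ) * ‖y‖^2 + (4/δ)*‖z‖^2 - (‖x‖ + ‖y‖ + ‖z‖)^2 := by
        rw [e]
        positivity
      linarith
    nlinarith
  have q12 := p1.add p2
  have m1 : (1 + A0).det ≤ (1 + (A1 + A2) + A3).det := by
    have := la_mono _ _ p0 key
    have e : 1 + A0 + (A1 + A2 + A3 - A0) = 1 + (A1 + A2) + A3 := by abel
    rwa [e] at this
  have m2 := la_submul _ _ q12 p3
  have m3 := la_submul _ _ p1 p2
  have h1 := la_had_gram g1 ((1+δ)*γ) po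
  have h3 := la_had_gram g3 (γ*(4/δ)) po
  have h4 : ∏ i, (1 + γ*(4/δ) * ‖g3 i‖ ^ 2) ≤ exp (γ * (4/δ) * ∑ i, ‖g3 i‖ ^ 2) := by
    rw [ms, exp_sum]
    refine Finset.prod_le_prod (fun i _ => po) fun i _ => ?_
    linarith [add_one_le_exp (γ*(4/δ) * ‖g3 i‖ ^ 2)]
  have n1 := la_one_le _ p1
  have n2 := la_one_le _ p2
  have n3 := la_one_le _ p3
  rw [← add_assoc] at m1 m2
  calc (1 + A0).det ≤ (1+A1+A2).det * (1+A3).det := m1.trans m2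
    _ ≤ ((1+A1).det * (1+A2).det) * (1+A3).det := by gcongr
    _ ≤ _ := by gcongr; exact h3.trans h4
lemma la_rank {J : Type*} [Fintype J] [DecidableEq J] (P : ι → J → ℝ) (a : J → E) (c S Q : ℝ) (hc : 0 ≤ c)
    (hS : ∑ m, ‖a m‖ ^ 2 ≤ S) (hQ : ∀ m, ∑ i, P i m ^ 2 ≤ Q) :
    (1 + c • Matrix.gram ℝ (fun i => ∑ m, P i m • a m)).det ≤ (1 + c * S * Q) ^ (Fintype.card J) := by
  have hS0 := le_trans po hS
  set V : Matrix ι J ℝ := Matrix.of P with hV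
  have p0 := gram_psd (fun i => ∑ m, P i m • a m) c hc
  have key : ((c*S) • (V * V.transpose) - c • Matrix.gram ℝ (fun i => ∑ m, P i m • a m)).PosSemidef := by
    refine psd_of (by simp [gram_tr, Matrix.transpose_smul]) fun v => ?_
    simp only [Matrix.sub_mulVec, Matrix.smul_mulVec, dotProduct_sub, dotProduct_smul, gram_quad, smul_eq_mul]
    have e1 : v ⬝ᵥ (V * V.transpose).mulVec v = ∑ m, (∑ i, v i * P i m)^2 := by
      rw [← Matrix.mulVec_mulVec, Matrix.dotProduct_mulVec, Matrix.mulVec_transpose, dotProduct]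
      exact sc rfl fun m _ => by simp [Matrix.vecMul, dotProduct, hV, sq]
    have e2 : ∑ i, v i • ∑ m, P i m • a m = ∑ m, (∑ i, v i * P i m) • a m := by
      simp only [Finset.smul_sum, Finset.sum_smul, smul_smul]; exact Finset.sum_comm
    rw [e1, e2]
    have h1 : ‖∑ m, (∑ i, v i * P i m) • a m‖ ≤ ∑ m, |∑ i, v i * P i m| * ‖a m‖ :=
      (norm_sum_le _ _).trans (le_of_eq (sc rfl fun m _ => by rw [norm_smul, na]))
    have h2 := Finset.sum_mul_sq_le_sq_mul_sq Finset.univ (fun m => |∑ i, v i * P i m|) (fun m => ‖a m‖)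
    simp only [sq_abs] at h2
    have h3 : ‖∑ m, (∑ i, v i * P i m) • a m‖^2 ≤ (∑ m, |∑ i, v i * P i m| * ‖a m‖)^2 := by gcongr
    have h4 : (∑ m, (∑ i, v i * P i m)^2) * ∑ m, ‖a m‖^2 ≤ (∑ m, (∑ i, v i * P i m)^2) * S := by gcongr
    nlinarith
  have m1 := la_mono _ _ p0 key
  have e : 1 + c • Matrix.gram ℝ (fun i => ∑ m, P i m • a m) + ((c*S) • (V * V.transpose) - c • Matrix.gram ℝ (fun i => ∑ m, P i m • a m)) = 1 + ((c*S) • V) * V.transpose := by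
    rw [Matrix.smul_mul]; abel
  rw [e, Matrix.det_one_add_mul_comm] at m1
  refine m1.trans ?_
  have hp : (V.transpose * ((c*S) • V)).PosSemidef := by
    rw [Matrix.mul_smul]
    exact (by simpa using Matrix.posSemidef_conjTranspose_mul_self V : (V.transpose * V).PosSemidef).smul po
  have m2 := la_hadamard _ (Matrix.PosDef.one.add_posSemidef hp)
  refine m2.trans ?_
  rw [← Finset.card_univ, ← Finset.prod_const]
  refine Finset.prod_le_prod (fun m _ => ?_) fun m _ => ?_
  all_goals simp only [Matrix.add_apply, Matrix.one_apply_eq, Matrix.mul_smul, Matrix.smul_apply, Matrix.mul_apply, Matrix.transpose_apply, hV, Matrix.of_apply, smul_eq_mul]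
  · have : 0 ≤ ∑ x, P x m * P x m := Finset.sum_nonneg fun i _ => mul_self_nonneg _
    positivity
  · have := hQ m; simp only [sq] at this; gcongr
lemma la_lower {n : ℕ} (g u : Fin n → E) (γ ε : ℝ) (hγ : 0 < γ) (hε : 0 ≤ ε) (hu : ∀ i, u i ≠ 0)
    (hω : ∀ i, γ / ‖u i‖ ^ 2 * ε ≤ 1) (hε2 : 2 * ε < 1)
    (h : ∀ i, ∀ v : Fin n → ℝ, v i = 1 → (∀ j, i < j → v j = 0) →
      |inner ℝ (∑ k, v k • g k) (u i) - 1| ≤ ε * sqrt (∑ k, v k ^ 2)) :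
    ∏ i, ((1 + γ / ‖u i‖ ^ 2) * (1 - 2 * ε)) ≤ (1 + γ • Matrix.gram ℝ g).det := by
  obtain ⟨s, h1, h2⟩ := la_chain _ _ (Matrix.PosDef.one.add_posSemidef (gram_psd g γ hγ.le))
  rw [h1]
  refine Finset.prod_le_prod (fun i _ => mul_nonneg po li) fun i _ => ?_
  obtain ⟨_, _, v, hv, hv0, hq⟩ := h2 i
  rw [← hq, Matrix.add_mulVec, Matrix.one_mulVec, dotProduct_add, Matrix.smul_mulVec, dotProduct_smul, gram_quad]
  have hi := h i v hv hv0
  set t := sqrt (∑ k, v k ^ 2) with ht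
  have ht2 : v ⬝ᵥ v = t ^ 2 := by
    rw [ht, sq_sqrt po]; simp [dotProduct, sq]
  have ht1 : 1 ≤ t := by
    rw [ht]; refine one_le_sqrt.2 ?_
    have := Finset.single_le_sum (f := fun i => v i ^ 2) (fun i _ => sq_nonneg (v i)) (Finset.mem_univ i)
    simpa [hv] using this
  have hun := norm_pos_iff.2 (hu i)
  have hcs := abs_real_inner_le_norm (∑ k, v k • g k) (u i)
  set I := inner ℝ (∑ k, v k • g k) (u i)
  set X := ‖∑ k, v k • g k‖
  have hX : (1 - 2 * ε * t) / ‖u i‖^2 ≤ X^2 := by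
    rw [div_le_iff₀ po, ← mul_pow]
    have : I^2 ≤ (X * ‖u i‖)^2 := by rw [← sq_abs]; gcongr
    have h5 := abs_le.1 hi
    nlinarith
  have h6 : γ * X^2 ≥ γ / ‖u i‖^2 * (1 - 2*ε*t) := by
    have := ll hX hγ.le
    calc _ = γ * ((1 - 2 * ε * t) / ‖u i‖^2) := by ring
      _ ≤ _ := this
  rw [ht2, smul_eq_mul]
  have h7 := hω i
  set ω := γ / ‖u i‖^2
  nlinarith
end gram
end
section
lemma la_diag {ι : Type*} [Fintype ι] [DecidableEq ι] (S : Matrix ι ι ℝ) (hS : S.transpose = S) :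
    ∃ (U : Matrix ι ι ℝ) (l : ι → ℝ), U.transpose * U = 1 ∧ U * U.transpose = 1 ∧
      U.transpose * S * U = Matrix.diagonal l := by
  have hH : S.IsHermitian := by rwa [Matrix.IsHermitian, Matrix.conjTranspose_eq_transpose_of_trivial]
  have hu := hH.eigenvectorUnitary.2
  set U : Matrix ι ι ℝ := hH.eigenvectorUnitary.1
  have h1 : U.transpose * U = 1 := by
    have := (Unitary.mem_iff.1 hu).1
    rwa [Matrix.star_eq_conjTranspose, Matrix.conjTranspose_eq_transpose_of_trivial] at this
  have h2 : U * U.transpose = 1 := by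
    have := (Unitary.mem_iff.1 hu).2
    rwa [Matrix.star_eq_conjTranspose, Matrix.conjTranspose_eq_transpose_of_trivial] at this
  refine ⟨U, hH.eigenvalues, h1, h2, ?_⟩
  have h3 := hH.spectral_theorem
  rw [Unitary.conjStarAlgAut_apply] at h3
  have h4 : S = U * Matrix.diagonal hH.eigenvalues * U.transpose := by
    conv_lhs => rw [h3]
    rw [← Matrix.conjTranspose_eq_transpose_of_trivial]; rfl
  generalize hH.eigenvalues = l at h4
  rw [h4]
  calc _ = (U.transpose * U) * Matrix.diagonal l * (U.transpose * U) := by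
        simp only [Matrix.mul_assoc]
    _ = _ := by rw [h1, Matrix.one_mul, Matrix.mul_one]
lemma gauss_1d (v : ℝ≥0) (γ : ℝ) (hγ : 0 ≤ γ) :
    ∫ x, exp (-(γ/2) * x^2) ∂(gR 0 v) = (sqrt (1 + γ * v))⁻¹ := by
  by_cases hv : v = 0
  · simp [hv]
  have hv' : ca 0 < v := lt_of_le_of_ne v.2 (fun h => hv (by ext; exact h.symm))
  rw [ProbabilityTheory.integral_gaussianReal_eq_integral_smul hv]
  simp only [ProbabilityTheory.gaussianPDFReal, smul_eq_mul, mul_assoc, ← exp_add, sub_zero]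
  rw [im]
  have : ∀ x : ℝ, -x^2/(2*v) + -(γ/2) * x^2 = -((1+γ*v)/(2*v)) * x^2 := fun x => by field_simp; ring
  simp_rw [this]
  have e : π / ((1+γ*v)/(2*v)) = (2*(π*v)) * (1+γ*v)⁻¹ := by field_simp
  rw [integral_gaussian, e, sqrt_mul (x := 2 * (π * v)) po, sqrt_inv, ← mul_assoc, inv_mul_cancel₀ po, one_mul]
section
variable {E : Type*} [NormedAddCommGroup E] [InnerProductSpace ℝ E] [CompleteSpace E]
  [MeasurableSpace E] [BorelSpace E]
  (μ : Measure E) [IsProbabilityMeasure μ]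
lemma gauss_det (hG : ∀ L : E →L[ℝ] ℝ, ∃ v : ℝ≥0, μ.map L = gR 0 v)
    {ι : Type*} [Fintype ι] [DecidableEq ι] (e : ι → E) (S : Matrix ι ι ℝ)
    (hS : ∀ i k, ∫ f, (inner ℝ (e i) f) * (inner ℝ (e k) f) ∂μ = S i k) (γ : ℝ) (hγ : 0 ≤ γ) :
    ∫ f, exp (-(γ/2) * ∑ i, (inner ℝ (e i) f)^2) ∂μ = (sqrt ((1 + γ • S).det))⁻¹ := by
  have hgau : ProbabilityTheory.IsGaussian μ :=
    ProbabilityTheory.isGaussian_of_map_eq_gaussianReal fun L => by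
      obtain ⟨v, hv⟩ := hG L; exact ⟨0, v, hv⟩
  have hst : S.transpose = S := by
    ext i k; rw [Matrix.transpose_apply, ← hS, ← hS]; simp_rw [mul_comm]
  obtain ⟨U, l, h1, h2, h3⟩ := la_diag S hst
  set g : ι → E := fun i => ∑ k, U k i • e k with hg
  have hgi : ∀ i f, inner ℝ (g i) f = ∑ k, U k i * inner ℝ (e k) f := fun i f => by
    simp [hg, sum_inner, real_inner_smul_left]
  have hmean : ∀ w : E, ∫ f, inner ℝ w f ∂μ = 0 := fun w => by
    obtain ⟨v, hv⟩ := hG (innerSL ℝ w)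
    have := ProbabilityTheory.integral_id_gaussianReal (μ := 0) (v := v)
    rw [← hv, integral_map fp fp] at this
    simpa using this
  have hL2 : ∀ w : E, MemLp (fun f => inner ℝ w f) 2 μ := fun w => by
    obtain ⟨v, hv⟩ := hG (innerSL ℝ w)
    have := ProbabilityTheory.memLp_id_gaussianReal (μ := 0) (v := v) 2
    rw [← hv] at this
    exact (memLp_map_measure_iff (f := innerSL ℝ w) fp fp).1 this
  have hint : ∀ w w' : E, Integrable (fun f => inner ℝ w f * inner ℝ w' f) μ := fun w w' =>
    MemLp.integrable_mul (hL2 w) (hL2 w')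
  have hcov : ∀ i j, ∫ f, inner ℝ (g i) f * inner ℝ (g j) f ∂μ = Matrix.diagonal l i j := by
    intro i j
    simp_rw [hgi, Finset.sum_mul_sum]
    rw [integral_finsetSum]
    · rw [← h3, Matrix.mul_assoc, Matrix.mul_apply]
      refine sc rfl fun k _ => ?_
      rw [integral_finsetSum, Matrix.mul_apply, ms]
      · refine sc rfl fun m _ => ?_
        rw [← hS, Matrix.transpose_apply, ← mul_assoc, mul_right_comm, ← im]
        congr 1; ext f; ring
      · intro m _
        have := (hint (e k) (e m)).const_mul (U k i * U m j)
        refine this.congr (Eventually.of_forall fun f => ?_); simp only; ring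
    · intro k _
      refine integrable_finsetSum _ fun m _ => ?_
      have := (hint (e k) (e m)).const_mul (U k i * U m j)
      refine this.congr (Eventually.of_forall fun f => ?_); simp only; ring
  have hind : ProbabilityTheory.iIndepFun (fun i f => inner ℝ (g i) f) μ := by
    refine ProbabilityTheory.HasGaussianLaw.iIndepFun_of_covariance_eq_zero ⟨?_⟩ ?_
    · exact ProbabilityTheory.isGaussian_map_of_measurable (L := ContinuousLinearMap.pi fun i => innerSL ℝ (g i)) fp
    · intro i j hij
      rw [ProbabilityTheory.covariance]
      simp only [hmean, sub_zero]
      rw [hcov, Matrix.diagonal_apply_ne _ hij]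
  have hsum : ∀ f, ∑ i, (inner ℝ (e i) f)^2 = ∑ i, (inner ℝ (g i) f)^2 := by
    intro f
    set y : ι → ℝ := fun k => inner ℝ (e k) f with hy
    have e1 : ∀ i, inner ℝ (g i) f = (U.transpose.mulVec y) i := fun i => by
      rw [hgi]; simp [Matrix.mulVec, dotProduct, hy]
    have e2 : ∑ i, (inner ℝ (g i) f)^2 = U.transpose.mulVec y ⬝ᵥ U.transpose.mulVec y := by
      simp only [e1, dotProduct, sq]
    rw [e2, Matrix.dotProduct_mulVec, Matrix.vecMul_transpose, Matrix.mulVec_mulVec, h2, Matrix.one_mulVec]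
    simp [dotProduct, hy, sq]
  simp_rw [hsum, ms, exp_sum]
  rw [hind.integral_fun_prod_comp (f := fun i x => exp (-(γ/2) * x^2)) (fun i => fp) (fun i => fp)]
  have h1d : ∀ i, 0 ≤ l i ∧ ∫ f, exp (-(γ/2) * (inner ℝ (g i) f)^2) ∂μ = (sqrt (1 + γ * l i))⁻¹ := by
    intro i
    obtain ⟨v, hv⟩ := hG (innerSL ℝ (g i))
    have hvl : ca v = l i := by
      have h5 := ProbabilityTheory.variance_id_gaussianReal (μ := 0) (v := v)
      rw [ProbabilityTheory.variance_eq_integral fp] at h5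
      simp only [id, ProbabilityTheory.integral_id_gaussianReal, sub_zero] at h5
      rw [← h5, ← hv, integral_map fp fp]
      have := hcov i i
      rw [Matrix.diagonal_apply_eq] at this
      rw [← this]; simp [sq]
    refine ⟨hvl ▸ v.2, ?_⟩
    rw [← hvl, ← gauss_1d v γ hγ, ← hv, integral_map fp fp]
    rfl
  simp_rw [fun i => (h1d i).2]
  rw [Finset.prod_inv_distrib, ← sqrt_prod _ (fun i _ => by have := (h1d i).1; positivity)]
  congr 2
  have : (1 + γ • S).det = (U.transpose * (1 + γ • S) * U).det := by
    rw [Matrix.det_mul_comm, ← Matrix.mul_assoc, h2, Matrix.one_mul]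
  rw [this, Matrix.mul_add, Matrix.add_mul, Matrix.mul_one, h1, Matrix.mul_smul, Matrix.smul_mul, h3]
  have : (1 : Matrix ι ι ℝ) + γ • Matrix.diagonal l = Matrix.diagonal (fun i => 1 + γ * l i) := by
    ext i j; by_cases hij : i = j
    · subst hij; simp
    · simp [hij]
  rw [this, Matrix.det_diagonal]
def Flog (γ : ℝ) : ℝ := -2 * log (∫ f, exp (-(γ/2) * ‖f‖^2) ∂μ)
lemma exp_int (γ : ℝ) (hγ : 0 ≤ γ) (N : E → ℝ) (hN : ∀ f, 0 ≤ N f) (hm : Measurable N) :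
    Integrable (fun f => exp (-(γ/2) * N f)) μ := by
  refine Integrable.of_bound fp 1 (Eventually.of_forall fun f => ?_)
  rw [na, abs_of_pos (exp_pos _), exp_le_one_iff]
  have := hN f; nlinarith
lemma F_lower (hG : ∀ L : E →L[ℝ] ℝ, ∃ v : ℝ≥0, μ.map L = gR 0 v)
    {ι : Type*} [Fintype ι] [DecidableEq ι] (e : ι → E) (he : Orthonormal ℝ e) (S : Matrix ι ι ℝ)
    (hS : ∀ i k, ∫ f, (inner ℝ (e i) f) * (inner ℝ (e k) f) ∂μ = S i k) (γ : ℝ) (hγ : 0 ≤ γ)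
    (hdet : 1 ≤ (1 + γ • S).det) :
    log ((1 + γ • S).det) ≤ Flog μ γ := by
  have h := gauss_det μ hG e S hS γ hγ
  have h2 : ∫ f, exp (-(γ/2) * ‖f‖^2) ∂μ ≤ (sqrt ((1 + γ • S).det))⁻¹ := by
    rw [← h]
    refine integral_mono (exp_int μ γ hγ _ (fun f => po) fp) (exp_int μ γ hγ _ (fun f => po) fp) fun f => ?_
    simp only [exp_le_exp]
    have := he.sum_inner_products_le (x := f) (s := Finset.univ)
    simp only [na, sq_abs] at this
    nlinarith
  have h3 : 0 < ∫ f, exp (-(γ/2) * ‖f‖^2) ∂μ :=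
    integral_exp_pos (exp_int μ γ hγ _ (fun f => po) fp)
  have h4 := log_le_log h3 h2
  rw [log_inv, log_sqrt li] at h4
  rw [Flog]; linarith
lemma F_upper (hG : ∀ L : E →L[ℝ] ℝ, ∃ v : ℝ≥0, μ.map L = gR 0 v)
    {ι : Type*} [Countable ι] [DecidableEq ι] (b : HilbertBasis ι ℝ E) (S : ι → ι → ℝ)
    (hS : ∀ i k, ∫ f, (inner ℝ (b i) f) * (inner ℝ (b k) f) ∂μ = S i k) (γ : ℝ) (hγ : 0 ≤ γ) (B : ℝ)
    (hB : ∀ s : Finset ι, 1 ≤ (1 + γ • (Matrix.of fun i j : s => S i j)).det ∧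
      (1 + γ • (Matrix.of fun i j : s => S i j)).det ≤ exp B) : Flog μ γ ≤ B := by
  have ht : Tendsto (fun s : Finset ι => ∫ f, exp (-(γ/2) * ∑ i ∈ s, (inner ℝ (b i) f)^2) ∂μ) atTop
      (nhds (∫ f, exp (-(γ/2) * ‖f‖^2) ∂μ)) := by
    refine tendsto_integral_filter_of_dominated_convergence (fun _ => 1) (Eventually.of_forall fun s => fp) (Eventually.of_forall fun s => Eventually.of_forall fun f => ?_) (integrable_const _) (Eventually.of_forall fun f => ?_)
    · rw [na, abs_of_pos (exp_pos _), exp_le_one_iff]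
      have : 0 ≤ ∑ i ∈ s, (inner ℝ (b i) f)^2 := po
      nlinarith
    · have h1 := b.hasSum_inner_mul_inner f f
      rw [real_inner_self_eq_norm_sq] at h1
      have h2 : HasSum (fun i => (inner ℝ (b i) f)^2) (‖f‖^2) := by
        have e1 : (fun i => (inner ℝ (b i) f)^2) = fun i => inner ℝ f (b i) * inner ℝ (b i) f := by
          ext i; rw [real_inner_comm f, sq]
        rw [e1]; exact h1
      exact (continuous_exp.tendsto _).comp (h2.const_mul _ |> fun h => by simpa [HasSum, ms] using h)
  have hb : exp (-B/2) ≤ ∫ f, exp (-(γ/2) * ‖f‖^2) ∂μ := by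
    refine ge_of_tendsto' ht fun s => ?_
    have := gauss_det μ hG (fun i : s => b i) (Matrix.of fun i j : s => S i j) (fun i k => hS i k) γ hγ
    have e1 : ∀ f : E, ∑ i ∈ s, (inner ℝ (b i) f)^2 = ∑ i : s, (inner ℝ (b i) f)^2 := fun f =>
      (Finset.sum_coe_sort s (fun i => (inner ℝ (b i) f)^2)).symm
    simp_rw [e1]; rw [this]
    obtain ⟨h1, h2⟩ := hB s
    rw [show -B/2 = -(B/2) by ring, exp_neg, exp_half]
    gcongr
  have h4 := log_le_log (exp_pos _) hb
  rw [log_exp] at h4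
  rw [Flog]; linarith
end
end
section
section taub
variable {Ω ι : Type*} [MeasurableSpace Ω] (μ : Measure Ω) [IsProbabilityMeasure μ] (l : Filter ι)
lemma taub_pt (Y : Ω → ℝ) (hYm : Measurable Y) (n t r κ k : ℝ) (hi : 0 < n) (ht : 0 < t) (hκ : 0 < κ) (hk : 0 < k)
    (hint : ∀ t, 0 ≤ t → Integrable (fun ω => exp (-(t * n * Y ω))) μ) (hκt : κ < t) :
    ∫ ω, exp (-(t * n * Y ω)) ∂μ ≤ exp (-(n * (t * r))) * (μ {ω | Y ω ≤ 1}).toReal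
        + (exp (-(n * κ)) * (∫ ω, exp (-((t-κ) * n * Y ω)) ∂μ) + exp (n * (k * r)) * ∫ ω, exp (-((t+k) * n * Y ω)) ∂μ) := by
  have i0 := hint t ht.le
  have i1 := hint (t-κ) li
  have i2 := hint (t+k) li
  have hpt : ∀ ω, exp (-(t * n * Y ω)) ≤ exp (-(n * (t * r))) * indicator {ω | Y ω ≤ 1} 1 ω
        + (exp (-(n * κ)) * exp (-((t-κ) * n * Y ω)) + exp (n * (k * r)) * exp (-((t+k) * n * Y ω))) := by
    intro ω
    rw [← exp_add, ← exp_add]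
    have hpos1 := exp_pos (-(n * κ) + -((t-κ) * n * Y ω))
    have hpos2 := exp_pos (n * (k * r) + -((t+k) * n * Y ω))
    have hpos3 := exp_pos (-(n * (t * r)))
    by_cases c1 : Y ω ≤ 1
    · rw [indicator_of_mem (by exact c1)]
      simp only [Pi.one_apply, mul_one]
      by_cases c2 : Y ω < r
      · have : exp (-(t * n * Y ω)) ≤ exp (n * (k * r) + -((t+k) * n * Y ω)) := by
          rw [exp_le_exp]
          have := mul_pos (mul_pos hi hk) (sub_pos.2 c2); linarith
        linarith
      · have : exp (-(t * n * Y ω)) ≤ exp (-(n * (t * r))) := by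
          rw [exp_le_exp]
          have := mul_nonneg (mul_pos hi ht).le (sub_nonneg.2 (not_lt.1 c2)); linarith
        linarith
    · have : exp (-(t * n * Y ω)) ≤ exp (-(n * κ) + -((t-κ) * n * Y ω)) := by
        rw [exp_le_exp]
        have := mul_pos (mul_pos hi hκ) (sub_pos.2 (not_le.1 c1)); linarith
      rw [indicator_of_notMem (by exact c1)]
      linarith
  have hms : MeasurableSet {ω | Y ω ≤ 1} := measurableSet_le hYm measurable_const
  have hind : Integrable (indicator {ω | Y ω ≤ 1} (1 : Ω → ℝ)) μ := (integrable_const ca 1).indicator hms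
  have hI := integral_mono i0 ((hind.const_mul _).add ((i1.const_mul _).add (i2.const_mul _))) hpt
  refine hI.trans (le_of_eq ?_)
  rw [integral_add' (hind.const_mul _) ((i1.const_mul _).add (i2.const_mul _)), integral_add' (i1.const_mul _) (i2.const_mul _), im, im, im, integral_indicator_one hms]
  rfl
lemma taub_num (n P Zt Z1 Z2 ψt ψ1 ψ2 t r κ k θ ν : ℝ) (hi : 0 < n) (hθ : 0 < θ) (hθν : θ < ν/2)
    (hθ1 : 3*θ < ψt - (-κ + ψ1)) (hθ2 : 3 * θ < ψt - (k*r + ψ2))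
    (z0 : exp (n * (ψt - θ)) ≤ Zt) (z1 : Z1 ≤ exp (n * (ψ1 + θ))) (z2 : Z2 ≤ exp (n * (ψ2 + θ)))
    (hbig : 2/θ ≤ n) (hI' : Zt ≤ exp (-(n * (t * r))) * P + (exp (-(n * κ)) * Z1 + exp (n * (k * r)) * Z2)) :
    exp (n * (t * r + ψt - ν)) ≤ P := by
  have b1 : exp (-(n * κ)) * Z1 ≤ exp (n * (ψt - θ)) * exp (-(n * θ)) := by
    refine (ll z1 (exp_pos _).le).trans ?_
    rw [← exp_add, ← exp_add, exp_le_exp]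
    have := mul_pos hi (sub_pos.2 hθ1); linarith
  have b2 : exp (n * (k*r)) * Z2 ≤ exp (n * (ψt - θ)) * exp (-(n * θ)) := by
    refine (ll z2 (exp_pos _).le).trans ?_
    rw [← exp_add, ← exp_add, exp_le_exp]
    have := mul_pos hi (sub_pos.2 hθ2); linarith
  have hNθ : 2 ≤ n * θ := by rw [div_le_iff₀ hθ] at hbig; exact hbig
  have b3 : exp (-(n * θ)) ≤ 1/3 := by
    rw [exp_neg, one_div]; gcongr
    linarith [add_one_le_exp (n * θ)]
  have b4 : exp (n * (ψt - θ)) * (1/3) ≤ exp (-(n * (t * r))) * P := by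
    have := ll b3 (exp_pos (n * (ψt - θ))).le
    linarith
  have b5 : exp (n * (t*r)) * (exp (n * (ψt - θ)) * (1/3)) ≤ P := by
    have := ll b4 (exp_pos (n * (t*r))).le
    rwa [← mul_assoc (exp _) (exp _) P, ← exp_add _ (-(n * (t*r))), add_neg_cancel, exp_zero, one_mul] at this
  refine le_trans ?_ b5
  have b6 : exp (-(n * θ)) * (exp (n * (t*r)) * exp (n * (ψt - θ))) ≤ (1/3) * (exp (n * (t*r)) * exp (n * (ψt - θ))) := by gcongr
  refine le_trans ?_ (b6.trans (le_of_eq (by ring)))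
  rw [← exp_add, ← exp_add, exp_le_exp]
  have := mul_pos hi (sub_pos.2 hθν); linarith
set_option maxHeartbeats 1000000 in
lemma taub (Y : ι → Ω → ℝ) (hY : ∀ i ω, 0 ≤ Y i ω) (hYm : ∀ i, Measurable (Y i)) (N : ι → ℝ)
    (hN : Tendsto N l atTop) (B a : ℝ) (hB : 0 < B) (ha : 0 < a) (ha1 : a < 1)
    (h : ∀ t : ℝ, 0 < t → Tendsto (fun i => log (∫ ω, exp (-(t * N i * Y i ω)) ∂μ) / N i) l
      (nhds (-(B * t ^ a)))) :
    Tendsto (fun i => log (μ {ω | Y i ω ≤ 1}).toReal / N i) l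
      (nhds ((a*B)^(1/(1-a)) - B * ((a*B)^(1/(1-a)))^a)) := by
  set ψ : ℝ → ℝ := fun t => -(B * t ^ a) with hψ
  set Z : ι → ℝ → ℝ := fun i t => ∫ ω, exp (-(t * N i * Y i ω)) ∂μ with hZ
  set P : ι → ℝ := fun i => (μ {ω | Y i ω ≤ 1}).toReal
  have hNp := hN.eventually_gt_atTop 0
  have hint : ∀ i t, 0 ≤ t → 0 < N i → Integrable (fun ω => exp (-(t * N i * Y i ω))) μ := by
    intro i t ht hNi
    refine Integrable.of_bound fp 1 (Eventually.of_forall fun f => ?_)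
    rw [na, abs_of_pos (exp_pos _), exp_le_one_iff]
    have := hY i f; have : 0 ≤ t * N i * Y i f := po
    linarith
  have hZp : ∀ i t, 0 ≤ t → 0 < N i → 0 < Z i t := fun i t ht hNi => integral_exp_pos (hint i t ht hNi)
  have hZlo : ∀ t, 0 < t → ∀ ν > 0, ∀ᶠ i in l, exp (N i * (ψ t - ν)) ≤ Z i t := by
    intro t ht ν hν
    filter_upwards [hNp, (h t ht).eventually_const_lt (show ψ t - ν < -(B * t^a) by simp only [hψ]; linarith)] with i hi h2
    rw [lt_div_iff₀ hi] at h2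
    rw [← exp_log (hZp i t ht.le hi), exp_le_exp]; simp only [hZ]; linarith
  have hZhi : ∀ t, 0 < t → ∀ ν > 0, ∀ᶠ i in l, Z i t ≤ exp (N i * (ψ t + ν)) := by
    intro t ht ν hν
    filter_upwards [hNp, (h t ht).eventually_lt_const (show -(B * t^a) < ψ t + ν by simp only [hψ]; linarith)] with i hi h2
    rw [div_lt_iff₀ hi] at h2
    rw [← exp_log (hZp i t ht.le hi), exp_le_exp]; simp only [hZ]; linarith
  have lower : ∀ t r, 0 < t → 0 < r → r < 1 → r < B * a * t^(a-1) → B * a * t^(a-1) < 1 → ∀ ν > 0,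
      ∀ᶠ i in l, exp (N i * (t * r + ψ t - ν)) ≤ P i := by
    intro t r ht hr hr1 hm1 hm2 ν hν
    have hd : HasDerivAt ψ (-(B * (a * t^(a-1)))) t :=
      ((hasDerivAt_rpow_const (Or.inl ht.ne')).const_mul B).neg
    have hsl := hasDerivAt_iff_tendsto_slope.1 hd
    obtain ⟨κ, hκ, hκt, hκ2⟩ : ∃ κ > 0, κ < t ∧ -κ + ψ (t - κ) < ψ t := by
      have h1 : ∀ᶠ y in nhdsWithin t (Iio t), -1 < slope ψ t y :=
        (hsl.mono_left (nhdsWithin_mono _ fun x hx => ne_of_lt hx)).eventually_const_lt nl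
      obtain ⟨y, ⟨hy1, hy2⟩, hy3⟩ := ((h1.and self_mem_nhdsWithin).and (nhdsWithin_le_nhds (eventually_gt_nhds ht))).exists
      rw [slope_def_field, lt_div_iff_of_neg (sub_neg.2 hy2)] at hy1
      refine ⟨t - y, li, li, ?_⟩
      rw [sub_sub_cancel]; linarith
    obtain ⟨k, hk, hk2⟩ : ∃ k > 0, k * r + ψ (t + k) < ψ t := by
      have h1 : ∀ᶠ y in nhdsWithin t (Ioi t), slope ψ t y < -r :=
        (hsl.mono_left (nhdsWithin_mono _ fun x hx => ne_of_gt hx)).eventually_lt_const nl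
      obtain ⟨y, hy1, hy2⟩ := (h1.and self_mem_nhdsWithin).exists
      have hy2 := hy2
      rw [slope_def_field, div_lt_iff₀ li] at hy1
      refine ⟨y - t, li, ?_⟩
      rw [add_sub_cancel]; linarith
    obtain ⟨θ, hθ, hθν, hθ1, hθ2⟩ : ∃ θ > 0, θ < ν/2 ∧ 3*θ < ψ t - (-κ + ψ (t-κ)) ∧ 3 * θ < ψ t - (k*r + ψ (t+k)) := by
      refine ⟨min (ν/4) (min ((ψ t - (-κ + ψ (t-κ)))/4) ((ψ t - (k*r + ψ (t+k)))/4)), by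
        refine lt_min li (lt_min li li), ?_, ?_, ?_⟩
      · exact (min_le_left _ _).trans_lt li
      · have := (min_le_right (ν/4) (min ((ψ t - (-κ + ψ (t-κ)))/4) ((ψ t - (k*r + ψ (t+k)))/4))).trans (min_le_left _ _)
        linarith
      · have := (min_le_right (ν/4) (min ((ψ t - (-κ + ψ (t-κ)))/4) ((ψ t - (k*r + ψ (t+k)))/4))).trans (min_le_right _ _)
        linarith
    filter_upwards [hNp, hZlo t ht θ hθ, hZhi (t-κ) li θ hθ, hZhi (t+k) li θ hθ,
      hN.eventually_ge_atTop (2/θ)] with i hi z0 z1 z2 hbig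
    exact taub_num _ _ _ _ _ _ _ _ t r κ k θ ν hi hθ hθν hθ1 hθ2 z0 z1 z2 hbig (taub_pt μ (Y i) (hYm i) (N i) t r κ k hi ht hκ hk (fun t ht => hint i t ht hi) hκt)
  set T := (a*B)^(1/(1-a)) with hT
  have hTp : 0 < T := po
  refine tendsto_order.2 ⟨fun c hc => ?_, fun c hc => ?_⟩
  · -- choose m
    set τ : ℝ → ℝ := fun m => (a*B/m)^(1/(1-a)) with hτ
    have hcont : Tendsto (fun m : ℝ => τ m * m^2 + ψ (τ m)) (nhdsWithin 1 (Iio 1)) (nhds (T - B * T^a)) := by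
      have hc : ContinuousAt (fun m : ℝ => τ m * m^2 + ψ (τ m)) 1 := by
        have h1 : ContinuousAt τ 1 := by
          refine ContinuousAt.rpow_const (continuousAt_const.div continuousAt_id one_ne_zero) (Or.inr (by have : 0 < 1 - a := li
                                                                                                          positivity))
        exact (h1.mul (continuousAt_id.pow 2)).add ((continuousAt_const.mul (h1.rpow_const (Or.inr ha.le))).neg)
      have := hc.tendsto
      simp only [hτ, hψ, div_one, one_pow, mul_one, ← hT] at this
      simp only [hτ, hψ]
      rw [sub_eq_add_neg]
      exact this.mono_left nhdsWithin_le_nhds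
    obtain ⟨m, ⟨hm1, hm2⟩, hm3⟩ := (((hcont.eventually_const_lt hc).and self_mem_nhdsWithin).and
      (nhdsWithin_le_nhds (eventually_gt_nhds (zero_lt_one' ℝ)))).exists
    have hm2 := hm2
    have ht : 0 < τ m := by simp only [hτ]; positivity
    have hder : B * a * (τ m)^(a-1) = m := by
      simp only [hτ]
      rw [← rpow_mul po, show 1/(1-a)*(a-1) = -1 by have : 1 - a ≠ 0 := li
                                                    field_simp; ring, rpow_neg_one]
      field_simp
    filter_upwards [hNp, lower (τ m) (m^2) ht po nl (by rw [hder]; nlinarith) (by rw [hder]; exact hm2)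
      ((τ m * m^2 + ψ (τ m) - c)/2) li] with i hi h2
    rw [lt_div_iff₀ hi]
    have := log_le_log (exp_pos _) h2
    rw [log_exp] at this
    refine lt_of_lt_of_le ?_ this
    nlinarith
  · have hlow := lower (T * 2) (B*a*(T*2)^(a-1)/2) po po
    have hTd : B * a * T^(a-1) = 1 := by
      rw [hT, ← rpow_mul po, show 1/(1-a)*(a-1) = -1 by have : 1 - a ≠ 0 := li
                                                        field_simp; ring, rpow_neg_one]
      field_simp
    have hT2 : B * a * (T*2)^(a-1) < 1 := by
      rw [mul_rpow hTp.le nn, ← mul_assoc, hTd, one_mul]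
      exact rpow_lt_one_of_one_lt_of_neg nn li
    have hpos : 0 < B * a * (T*2)^(a-1) := po
    filter_upwards [hNp, hZhi T hTp ((c - (T - B * T^a))/2) li, hlow li li hT2 1 one_pos] with i hi h2 h3
    have hPp := (exp_pos _).trans_le h3
    have hch : P i ≤ exp (N i * T) * Z i T := by
      have hms : MeasurableSet {ω | Y i ω ≤ 1} := measurableSet_le (hYm i) measurable_const
      have : P i = ∫ ω, indicator {ω | Y i ω ≤ 1} 1 ω ∂μ := (integral_indicator_one hms).symm
      rw [this, hZ, ← im]
      refine integral_mono ((integrable_const ca 1).indicator hms) ((hint i T hTp.le hi).const_mul _) fun ω => ?_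
      simp only [← exp_add]
      by_cases c1 : Y i ω ≤ 1
      · rw [indicator_of_mem (by exact c1), Pi.one_apply, one_le_exp_iff]
        have := mul_nonneg (mul_pos hi hTp).le (sub_nonneg.2 c1); nlinarith
      · rw [indicator_of_notMem (by exact c1)]; positivity
    rw [div_lt_iff₀ hi]
    have h5 : P i ≤ exp (N i * T + N i * (ψ T + (c - (T - B * T^a))/2)) := by
      rw [exp_add]; exact hch.trans (ll h2 (exp_pos _).le)
    have := log_le_log hPp h5
    rw [log_exp] at this
    refine lt_of_le_of_lt this ?_
    simp only [hψ]
    nlinarith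
end taub
end
section
structure WRV (w : ℝ → ℝ) (σ L0 : ℝ) : Prop where
  h1 : 1 ≤ L0
  hs : 0 < σ
  pos : ∀ L, L0 ≤ L → 0 < w L
  anti : AntitoneOn w (Ici L0)
  rv : ∀ c : ℝ, 0 < c → Tendsto (fun L => w (c * L) / w L) atTop (nhds (c ^ (-σ)))
lemma WRV.ratio {w : ℝ → ℝ} {σ L0 : ℝ} (W : WRV w σ L0) {ι : Type*} {l : Filter ι} {L L' : ι → ℝ} {c : ℝ}
    (hc : 0 < c) (hL : Tendsto L l atTop) (hL' : Tendsto (fun i => L' i / L i) l (nhds c)) :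
    Tendsto (fun i => w (L' i) / w (L i)) l (nhds (c ^ (-σ))) := by
  have hcont : ContinuousAt (fun x : ℝ => x ^ (-σ)) c := continuousAt_rpow_const _ _ (Or.inl hc.ne')
  have key : ∀ b, 0 < b → ∀ᶠ i in l, L0 ≤ b * L i := fun b hb =>
    (hL.const_mul_atTop hb).eventually_ge_atTop L0
  have hLp := hL.eventually_gt_atTop 0
  refine tendsto_order.2 ⟨fun a ha => ?_, fun a ha => ?_⟩
  · obtain ⟨c2, h1, h2⟩ := (((hcont.tendsto.mono_left nhdsWithin_le_nhds).eventually_const_lt ha).and (self_mem_nhdsWithin (s := Ioi c))).exists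
    have h2 := h2
    have hc2 := hc.trans h2
    filter_upwards [((W.rv c2 hc2).comp hL).eventually_const_lt h1, hL'.eventually_lt_const h2,
      hL'.eventually_const_lt (half_lt_self hc), key (c/2) po, hLp, hL.eventually_ge_atTop L0] with i a1 a2 a3 a4 a5 a6
    rw [div_lt_iff₀ a5] at a2
    rw [lt_div_iff₀ a5] at a3
    refine a1.trans_le ?_
    have := W.anti (show L' i ∈ Ici L0 by simp only [mem_Ici]; linarith) (show c2 * L i ∈ Ici L0 by simp only [mem_Ici]; linarith) a2.le
    exact div_le_div_of_nonneg_right this (W.pos _ a6).le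
  · obtain ⟨c2, ⟨h1, h2⟩, h3⟩ := ((((hcont.tendsto.mono_left nhdsWithin_le_nhds).eventually_lt_const ha).and (self_mem_nhdsWithin (s := Iio c))).and
      (nhdsWithin_le_nhds (eventually_gt_nhds hc))).exists
    have h2 := h2
    filter_upwards [((W.rv c2 h3).comp hL).eventually_lt_const h1, hL'.eventually_const_lt h2,
      key c2 h3, hLp, hL.eventually_ge_atTop L0] with i a1 a2 a4 a5 a6
    rw [lt_div_iff₀ a5] at a2
    refine lt_of_le_of_lt ?_ a1
    have := W.anti (show c2 * L i ∈ Ici L0 by simp only [mem_Ici]; linarith) (show L' i ∈ Ici L0 by simp only [mem_Ici]; linarith) a2.le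
    exact div_le_div_of_nonneg_right this (W.pos _ a6).le
lemma WRV.potter {w : ℝ → ℝ} {σ L0 : ℝ} (W : WRV w σ L0) : ∃ L1 ≥ L0, ∀ x y, L1 ≤ x → x ≤ y →
    w x ≤ (2 * y / x) ^ (σ + 1) * w y := by
  have h2 : ca 2^(-(σ+1)) < 2 ^ (-σ) := rpow_lt_rpow_of_exponent_lt nn li
  obtain ⟨L1, hL1⟩ := eventually_atTop.1 ((W.rv 2 nn).eventually_const_lt h2)
  refine ⟨max L0 L1, le_max_left _ _, ?_⟩
  have hone := W.h1
  have step : ∀ x, max L0 L1 ≤ x → w x ≤ 2^(σ+1) * w (2 * x) := by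
    intro x hx
    have a := hL1 x ((le_max_right _ _).trans hx)
    rw [lt_div_iff₀ (W.pos x ((le_max_left _ _).trans hx)), rpow_neg nn, inv_mul_lt_iff₀ po] at a
    exact a.le
  have iter : ∀ (k : ℕ) x, max L0 L1 ≤ x → w x ≤ (2^k : ℝ)^(σ+1) * w (2^k * x) := by
    intro k
    induction k with
    | zero => intro x hx; simp
    | succ k ih =>
      intro x hx
      have hx0 : 0 ≤ x := by have := (le_max_left L0 L1).trans hx; linarith
      refine (step x hx).trans ?_
      rw [pow_succ, mul_rpow po po, mul_comm ((2^k:ℝ)^(σ+1)), mul_assoc]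
      have := ih (2*x) li
      rw [← mul_assoc] at this
      exact ll this po
  intro x y hx hxy
  have hx0 : 0 < x := by have := (le_max_left L0 L1).trans hx; linarith
  obtain ⟨n, hn1, hn2⟩ := exists_nat_pow_near (x := y/x) (y := 2) ((one_le_div hx0).2 hxy) nn
  rw [div_lt_iff₀ hx0] at hn2
  have hxL := (le_max_left L0 L1).trans hx
  refine (iter (n+1) x hx).trans ?_
  have hy0 := hx0.trans_le hxy
  refine mul_le_mul (rpow_le_rpow po ?_ (by linarith [W.hs])) ?_ (W.pos _ ?_).le po
  · rw [pow_succ, mul_div_assoc, mul_comm]; linarith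
  · exact W.anti (show y ∈ Ici L0 from hxL.trans hxy) (show _ ∈ Ici L0 from (hxL.trans hxy).trans hn2.le) hn2.le
  · exact (hxL.trans hxy).trans hn2.le
lemma WRV.log_div {w : ℝ → ℝ} {σ L0 : ℝ} (W : WRV w σ L0) : Tendsto (fun L => log (w L) / L) atTop (nhds 0) := by
  obtain ⟨L1, hL1, hp⟩ := W.potter
  have hone := W.h1
  have hw1 := W.pos L1 hL1
  have hL1p : 0 < L1 := li
  have lim1 : Tendsto (fun L : ℝ => log (w L1) / L) atTop (nhds 0) := tendsto_const_nhds.div_atTop tendsto_id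
  have lim2 : Tendsto (fun L : ℝ => (log (w L1) - (σ+1) * log (2/L1)) / L - (σ+1) * (log L / L)) atTop (nhds 0) := by
    have a1 : Tendsto (fun L : ℝ => log L / L) atTop (nhds 0) := by
      have := isLittleO_log_id_atTop.tendsto_div_nhds_zero
      simpa using this
    have a2 : Tendsto (fun L : ℝ => (log (w L1) - (σ+1) * log (2/L1)) / L) atTop (nhds 0) := tendsto_const_nhds.div_atTop tendsto_id
    simpa using a2.sub (a1.const_mul (σ+1))
  refine tendsto_of_tendsto_of_tendsto_of_le_of_le' lim2 lim1 ?_ ?_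
  · filter_upwards [eventually_ge_atTop L1] with L hL
    have hLp : 0 < L := li
    have hwL := W.pos L (hL1.trans hL)
    have := log_le_log hw1 (hp L1 L le_rfl hL)
    rw [log_mul po hwL.ne', log_rpow po, show 2 * L / L1 = 2/L1 * L by ring, log_mul po hLp.ne'] at this
    rw [← mul_div_assoc, ← sub_div]
    gcongr
    linarith
  · filter_upwards [eventually_ge_atTop L1] with L hL
    have hLp : 0 < L := li
    have hwL := W.pos L (hL1.trans hL)
    gcongr
    exact W.anti (show L1 ∈ Ici L0 from hL1) (show L ∈ Ici L0 from hL1.trans hL) hL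
section fr
variable {E : Type*} [NormedAddCommGroup E] [MeasurableSpace E] [BorelSpace E] (μ : Measure E) [IsProbabilityMeasure μ]
lemma final_alg (h p A S σ G K : ℝ) (hh : 0 < h) (hp : p = 2*h+1) (hA : 0 < A) (hS : 0 < S) (hG : 0 < G)
    (hK : K = A^(1/p)/S * G * (p^2/2)^σ) (B : ℝ) (hB : B = K * (p/h)^(-σ) * (2^(1/p)/2)) :
    (1/p*B)^(1/(1-1/p)) - B * ((1/p*B)^(1/(1-1/p)))^(1/p) = -(h * (A^(1/p) * G * (h*(h+1/2))^σ/(p*S))^(p/(2*h))) := by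
  have hp0 : 0 < p := li
  have e1 : 1/(1-1/p) = p/(2*h) := by
    have : 1 - 1/p = 2*h/p := by field_simp; linarith
    rw [this]; field_simp
  have hKp : 0 < K := by rw [hK]; positivity
  have hBp : 0 < B := by rw [hB]; positivity
  have e2 : (p/h)^(-σ) * (p^2/2)^σ = (h*(h+1/2))^σ := by
    rw [rpow_neg po, ← inv_rpow po, ← mul_rpow po po]
    congr 1; rw [hp]; field_simp
  have e3 : A^(1/p) * G * (h*(h+1/2))^σ/(p*S) = 2^(2*h/p) * (1/p*B) := by
    rw [← e2, hB, hK]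
    have : ca 2^(2*h/p) * (2^(1/p)/2) = 1 := by
      rw [← mul_div_assoc, ← rpow_add nn, ← add_div, ← hp, div_self hp0.ne', rpow_one, div_self nn]
    calc _ = A^(1/p)/S * G * (p^2/2)^σ * (p/h)^(-σ) * (1/p) * 1 := by field_simp
      _ = A^(1/p)/S * G * (p^2/2)^σ * (p/h)^(-σ) * (1/p) * (ca 2^(2*h/p) * (2^(1/p)/2)) := by rw [this]
      _ = _ := by ring
  rw [e1, e3, mul_rpow (x := 2^(2*h/p)) po po, ← rpow_mul (x := 2) nn, ← rpow_mul po,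
    show 2*h/p*(p/(2*h)) = 1 by field_simp, rpow_one]
  have e4 : B * (1/p*B)^(p/(2*h)*(1/p)) = p * (1/p*B)^(p/(2*h)) := by
    rw [show p/(2*h) = 1 + p/(2*h)*(1/p) by rw [hp]; field_simp, rpow_add po, rpow_one,
      show (1 + p/(2*h)*(1/p))*(1/p) = p/(2*h)*(1/p) by rw [hp]; field_simp]
    rw [← mul_assoc, ← mul_assoc, mul_one_div_cancel hp0.ne', one_mul]
  rw [e4, hp]; ring
lemma final_red (h p A S σ G K L0 : ℝ) (φ : ℝ → ℝ) (hφ : ∀ u, 0 < u → 0 < φ u) (hh : 0 < h) (hp : p = 2*h+1) (hA : 0 < A) (hS : 0 < S) (hG : 0 < G)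
    (hK : K = A^(1/p)/S * G * (p^2/2)^σ) (W : WRV (fun L => L^(-σ) * φ L) σ L0)
    (hF : Tendsto (fun γ => Flog μ γ / (γ^(1/p) * ((log γ)^(-σ) * φ (log γ)))) atTop (nhds K)) :
    Tendsto (fun ε : ℝ => ε ^ (1 / h) * ((log (1/ε)) ^ σ / φ (log (1/ε))) ^ (p / (2 * h)) * log (μ {f | ‖f‖ ≤ ε}).toReal)
      (nhdsWithin 0 (Ioi 0)) (nhds (-(h * (A^(1/p) * G * (h*(h+1/2))^σ/(p*S))^(p/(2*h))))) := by
  have hp0 : 0 < p := li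
  set w : ℝ → ℝ := fun L => L^(-σ) * φ L with hw
  set B := K * (p/h)^(-σ) * (2^(1/p)/2) with hB
  have hKp : 0 < K := by rw [hK]; positivity
  have hBp : 0 < B := by rw [hB]; positivity
  rw [← final_alg h p A S σ G K hh hp hA hS hG hK B hB]
  set l := nhdsWithin ca 0 (Ioi 0)
  have hε : ∀ᶠ ε in l, ca 0 < ε := self_mem_nhdsWithin
  have hL : Tendsto (fun ε : ℝ => log (1/ε)) l atTop := by
    simp only [one_div]
    exact tendsto_log_atTop.comp tendsto_inv_nhdsGT_zero
  set N : ℝ → ℝ := fun ε => ε^(-(1/h)) * (w (log (1/ε)))^(p/(2*h)) with hN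
  have hwp := (hL.eventually_ge_atTop L0).mono fun ε h => W.pos _ h
  have hNpos : ∀ᶠ ε in l, 0 < N ε := by
    filter_upwards [hε, hwp] with ε h1 h2; simp only [hN]; positivity
  have hlogN : ∀ᶠ ε in l, log (N ε) = log (1/ε) * (1/h + p/(2*h) * (log (w (log (1/ε))) / log (1/ε))) := by
    filter_upwards [hε, hwp, hL.eventually_gt_atTop 0] with ε h1 h2 h3
    simp only [hN]
    rw [log_mul po po, log_rpow h1, log_rpow h2, mul_add]
    congr 1
    · rw [one_div ε, log_inv]; ring
    · field_simp
  have hlim : Tendsto (fun ε => 1/h + p/(2*h) * (log (w (log (1/ε))) / log (1/ε))) l (nhds (1/h)) := by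
    simpa using tendsto_const_nhds.add ((W.log_div.comp hL).const_mul (p/(2*h)))
  have hNtop : Tendsto N l atTop := by
    have h1 : Tendsto (fun ε => log (N ε)) l atTop := by
      refine Tendsto.congr' (hlogN.mono fun _ h => h.symm) (hL.atTop_mul_pos po hlim)
    refine Tendsto.congr' (hNpos.mono fun _ h => exp_log h) (tendsto_exp_atTop.comp h1)
  have T := taub μ l (fun ε f => ‖f‖^2/ε^2) (fun _ _ => po) (fun _ => fp) N hNtop B (1/p) hBp po
    (by rw [div_lt_one hp0]; linarith) ?_
  · refine Tendsto.congr' ?_ T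
    filter_upwards [hε, hL.eventually_gt_atTop 0] with ε h1 h3
    have hset : {f : E | ‖f‖^2/ε^2 ≤ 1} = {f | ‖f‖ ≤ ε} := by
      ext f; simp only [mem_setOf_eq]; rw [div_le_one po, sq_le_sq₀ (norm_nonneg _) h1.le]
    have hφ1 := hφ _ h3
    rw [hset, div_eq_mul_inv (log _), mul_comm]
    congr 1
    simp only [hN, hw]
    rw [mul_inv, rpow_neg h1.le, inv_inv, ← inv_rpow po, rpow_neg h3.le, mul_inv, inv_inv]
    simp only [div_eq_mul_inv]
  · intro t ht
    set γ : ℝ → ℝ := fun ε => 2*t*N ε/ε^2 with hγ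
    have hlogγ : ∀ᶠ ε in l, log (γ ε) / log (1/ε) = log (2*t) / log (1/ε) + ((1/h + p/(2*h) * (log (w (log (1/ε))) / log (1/ε))) + 2) := by
      filter_upwards [hε, hwp, hL.eventually_gt_atTop 0, hNpos, hlogN] with ε h1 h2 h3 h4 h5
      simp only [hγ]
      rw [log_div po po, log_mul po h4.ne', h5, log_pow,
        show log ε = - log (1/ε) by rw [one_div, log_inv]; ring]
      push_cast
      field_simp; ring
    have hlg : Tendsto (fun ε => log (γ ε) / log (1/ε)) l (nhds (p/h)) := by
      refine Tendsto.congr' (hlogγ.mono fun _ h => h.symm) ?_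
      have := (tendsto_const_nhds (x := log (2*t)).div_atTop hL).add (hlim.add_const 2)
      convert this using 2
      rw [hp]; field_simp; ring
    have hγp : ∀ᶠ ε in l, 0 < γ ε := by
      filter_upwards [hε, hNpos] with ε h1 h2; simp only [hγ]; positivity
    have hγtop : Tendsto γ l atTop := by
      have h1 : Tendsto (fun ε => log (γ ε)) l atTop := by
        refine Tendsto.congr' ?_ (hL.atTop_mul_pos po hlg)
        filter_upwards [hL.eventually_gt_atTop 0] with ε h3
        field_simp
      exact Tendsto.congr' (hγp.mono fun _ h => exp_log h) (tendsto_exp_atTop.comp h1)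
    have r1 := W.ratio (show 0 < p/h by positivity) hL hlg
    have r2 := ((hF.comp hγtop).mul r1).mul_const ((2*t)^(1/p)/2)
    have r3 := r2.neg
    refine Tendsto.congr' ?_ (r3.trans (le_of_eq ?_))
    · filter_upwards [hε, hwp, hNpos, hγp, (tendsto_log_atTop.comp hγtop).eventually_ge_atTop L0] with ε h1 h2 h3 h4 h5
      have hwg : 0 < w (log (γ ε)) := W.pos _ h5
      have eF : Flog μ (γ ε) = -2 * log (∫ f, exp (-(t * N ε * (‖f‖^2/ε^2))) ∂μ) := by
        simp only [Flog, hγ]; congr 3; ext f; congr 2; field_simp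
      have eI : log (∫ f, exp (-(t * N ε * (‖f‖^2/ε^2))) ∂μ) = - Flog μ (γ ε) / 2 := by rw [eF]; ring
      have eγ : (γ ε)^(1/p) * w (log (1/ε)) = (2*t)^(1/p) * N ε := by
        have hNN : N ε ^ (1/p) * w (log (1/ε)) * ε^(-(2/p)) = N ε := by
          conv_rhs => rw [show N ε = N ε ^ (1/p) * N ε ^ (1-1/p) by rw [← rpow_add h3]; simp]
          rw [mul_assoc]; congr 1
          simp only [hN]
          rw [mul_rpow po po, ← rpow_mul h1.le, ← rpow_mul h2.le, mul_comm]
          congr 1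
          · congr 1; rw [hp]; field_simp; ring
          · rw [show p/(2*h)*(1-1/p) = 1 by rw [hp]; field_simp; ring, rpow_one]
        conv_rhs => rw [← hNN]
        simp only [hγ]
        rw [div_rpow po po, mul_rpow po h3.le, ← rpow_natCast, ← rpow_mul h1.le,
          show -(2/p) = -(((2:ℕ):ℝ) * (1/p)) by push_cast; ring, rpow_neg h1.le]
        ring
      rw [eI]
      simp only [Function.comp]
      have hg0 : 0 < (γ ε)^(1/p) := po
      have e6 : (2*t)^(1/p) = (γ ε)^(1/p) * w (log (1/ε)) / N ε := by rw [eγ]; field_simp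
      rw [e6]
      change -(Flog μ (γ ε) / ((γ ε)^(1/p) * w (log (γ ε))) * (w (log (γ ε)) / w (log (1/ε))) * (_ / 2)) = _
      generalize w (log (γ ε)) = a1 at *
      generalize w (log (1/ε)) = a2 at *
      generalize (γ ε)^(1/p) = a3 at *
      field_simp
    · congr 1
      rw [hB, mul_rpow nn ht.le]; ring
end fr
end
section
section kar
variable {Ω : Type*} [MeasurableSpace Ω] (ν : Measure Ω) [IsProbabilityMeasure ν]
lemma int_exp_Ioi (a : ℝ) : ∫ u in Ioi a, exp (-u) = exp (-a) := by
  simpa using integral_exp_neg_Ioi a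
lemma layer (ψ : Ω → ℝ) (hψ : Measurable ψ) (h0 : ∀ x, 0 ≤ ψ x) (L : ℝ) (hL : 0 < L) :
    ∫ x, exp (-(L * ψ x)) ∂ν = ∫ u in Ioi ca 0, exp (-u) * ν.real {x | ψ x < u / L} := by
  have e1 : ∀ x, exp (-(L * ψ x)) = ∫ u in Ioi ca 0, indicator {z : Ω × ℝ | ψ z.1 < z.2 / L} (fun z => exp (-z.2)) (x, u) := by
    intro x
    rw [← int_exp_Ioi (L * ψ x)]
    have : ∀ u, indicator {z : Ω × ℝ | ψ z.1 < z.2 / L} (fun z => exp (-z.2)) (x, u) = indicator (Ioi (L * ψ x)) (fun u => exp (-u)) u := by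
      intro u
      simp only [indicator, mem_setOf_eq, mem_Ioi, lt_div_iff₀ hL, mul_comm L]
    simp only [this]
    rw [integral_indicator mi, Measure.restrict_restrict mi, inter_eq_left.2]
    intro u hu
    have := mul_nonneg hL.le (h0 x)
    exact lt_of_le_of_lt this hu
  simp only [e1]
  have hms : MeasurableSet {z : Ω × ℝ | ψ z.1 < z.2 / L} := measurableSet_lt fp fp
  rw [integral_integral_swap]
  · congr 1; ext u
    have : ∀ x, indicator {z : Ω × ℝ | ψ z.1 < z.2 / L} (fun z => exp (-z.2)) (x, u) = exp (-u) * indicator {x | ψ x < u / L} 1 x := by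
      intro x; simp only [indicator, mem_setOf_eq]; split_ifs <;> simp
    simp only [this]
    rw [im, integral_indicator_one (measurableSet_lt hψ measurable_const)]
  · refine Integrable.indicator ?_ hms
    have h2 : Integrable (fun u : ℝ => exp (-u)) (volume.restrict (Ioi 0)) := by
      simpa [IntegrableOn] using integrableOn_exp_neg_Ioi 0
    exact h2.comp_snd ν
lemma kar (ψ : Ω → ℝ) (hψ : Measurable ψ) (h0 : ∀ x, 0 ≤ ψ x) (w g D : ℝ → ℝ)
    (hlim : ∀ u, 0 < u → Tendsto (fun L => ν.real {x | ψ x < u / L} / w L) atTop (nhds (g u)))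
    (hdom : ∀ᶠ L in atTop, 0 < w L ∧ ∀ u, 0 < u → ν.real {x | ψ x < u / L} ≤ D u * w L)
    (hD : Integrable (fun u => exp (-u) * D u) (volume.restrict (Ioi 0))) :
    Tendsto (fun L => (∫ x, exp (-(L * ψ x)) ∂ν) / w L) atTop (nhds (∫ u in Ioi ca 0, exp (-u) * g u)) := by
  have T : Tendsto (fun L => ∫ u in Ioi ca 0, exp (-u) * (ν.real {x | ψ x < u / L} / w L)) atTop (nhds (∫ u in Ioi ca 0, exp (-u) * g u)) := by
    refine tendsto_integral_filter_of_dominated_convergence _ ?_ ?_ hD ?_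
    · filter_upwards [eventually_gt_atTop 0] with L hL
      have : Monotone (fun u => ν.real {x | ψ x < u / L}) := fun a b hab => measureReal_mono (fun x hx => lt_of_lt_of_le hx (div_le_div_of_nonneg_right hab hL.le))
      have := this.measurable
      exact (by fun_prop : Measurable _).aestronglyMeasurable
    · filter_upwards [hdom] with L ⟨hw, hL⟩
      filter_upwards [ae_restrict_mem mi] with u hu
      rw [na, abs_of_nonneg po]
      have := hL u hu
      rw [← div_le_iff₀ hw] at this
      gcongr
    · filter_upwards [ae_restrict_mem mi] with u hu
      exact (hlim u hu).const_mul _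
  refine Tendsto.congr' ?_ T
  filter_upwards [eventually_gt_atTop 0] with L hL
  rw [layer ν ψ hψ h0 L hL, ← integral_div]
  simp only [mul_div_assoc]
end kar
lemma Jasym (H : ℝ → ℝ) (hH : Measurable H) (Hm : ℝ) (hm0 : 0 < Hm) (hHm : ∀ x, Hm ≤ H x) (w : ℝ → ℝ) (σ L0 p : ℝ) (W : WRV w σ L0) (hp : p = 2*Hm+1)
    (hm : ∀ L, L0 ≤ L → volume.real ({x | H x - Hm < 1/L} ∩ Icc 0 1) = w L) :
    Tendsto (fun γ => (∫ x in Icc ca 0 1, γ^(1/(2*H x+1))) / (γ^(1/p) * w (log γ))) atTop (nhds (Gamma (σ+1) * (p^2/2)^σ)) := by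
  have hp0 : 0 < p := li
  set ν := volume.restrict (Icc ca 0 1) with hν
  haveI : IsProbabilityMeasure ν := ⟨by simp [hν]⟩
  set ψ : ℝ → ℝ := fun x => 1/p - 1/(2*H x+1) with hψ
  have hψm : Measurable ψ := fp
  have hψ0 : ∀ x, 0 ≤ ψ x := fun x => by
    simp only [hψ, sub_nonneg]; gcongr; rw [hp]; linarith [hHm x]
  have hone := W.h1
  have hσ := W.hs
  have hset : ∀ s, 0 < s → s * p < 1 → {x | ψ x < s} = {x | H x - Hm < s*p^2/(2*(1-s*p))} := by
    intro s hs hsp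
    ext x
    have hx : 0 < 2 * H x + 1 := by linarith [hHm x]
    have h2 : ca 0 < 2*(1-s*p) := li
    simp only [hψ, mem_setOf_eq]
    rw [lt_div_iff₀ h2, div_sub_div _ _ hp0.ne' hx.ne', div_lt_iff₀ po]
    constructor <;> intro h <;> rw [hp] at h ⊢ <;> nlinarith
  have hM : ∀ s, 0 < s → s * p < 1 → L0 ≤ 2*(1-s*p)/(s*p^2) → ν.real {x | ψ x < s} = w (2*(1-s*p)/(s*p^2)) := by
    intro s hs hsp h1
    rw [← hm _ h1, hset s hs hsp, one_div_div, measureReal_restrict_apply (measurableSet_lt fp measurable_const)]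
  obtain ⟨L1, hL1, hpot⟩ := W.potter
  have hL1p : 0 < L1 := li
  have hw1 := W.pos L1 hL1
  have hdom : ∀ L, 2 * p * L1 ≤ L → ∀ u, 0 < u → ν.real {x | ψ x < u / L} ≤ ((1 + (4*p^2*u)^(σ+1)) * (1+1/w L1)) * w L := by
    intro L hL u hu
    have hLL : L1 ≤ L := by nlinarith
    have hLp : 0 < L := li
    have hwL := W.pos L (hL1.trans hLL)
    have hA : ca 0 ≤ (4*p^2*u)^(σ+1) := po
    have hB : 0 < 1/w L1 := po
    by_cases c : p^2 * u * L1 * 2 ≤ L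
    · have hu2 : u/L * p ≤ 1/2 := by
        rw [div_mul_eq_mul_div, div_le_iff₀ hLp]
        have : u * p ≤ p^2 * u * L1 := by
          have : 1 ≤ p * L1 := by nlinarith
          have := ll this (mul_pos hu hp0).le
          linarith
        linarith
      have k1 : L/(p^2*u) ≤ 2*(1-u/L*p)/(u/L*p^2) := by
        rw [div_le_div_iff₀ po po]
        have e : L * (u/L*p^2) = p^2*u := by field_simp
        rw [e]
        have := lr (show ca 1 ≤ 2*(1-u/L*p) by linarith) (show 0 ≤ p^2*u by positivity)
        linarith
      have k0 : L1 ≤ L/(p^2*u) := by rw [le_div_iff₀ po]; nlinarith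
      rw [hM (u/L) po li (hL1.trans (k0.trans k1))]
      refine (W.anti (show _ ∈ Ici L0 from hL1.trans k0) (show _ ∈ Ici L0 from hL1.trans (k0.trans k1)) k1).trans ?_
      have q1 : w (L/(p^2*u)) ≤ (1 + (4*p^2*u)^(σ+1)) * w L := by
        by_cases c2 : p^2*u ≤ 1
        · have : L ≤ L/(p^2*u) := by rw [le_div_iff₀ po]; nlinarith
          refine (W.anti (show _ ∈ Ici L0 from hL1.trans hLL) (show _ ∈ Ici L0 from hL1.trans k0) this).trans ?_
          nlinarith
        · have := hpot (L/(p^2*u)) L k0 (by rw [div_le_iff₀ po]; nlinarith)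
          rw [show 2 * L/(L/(p^2*u)) = 2*p^2*u by field_simp] at this
          have h4 : (2*p^2*u)^(σ+1) ≤ (4*p^2*u)^(σ+1) := rpow_le_rpow po nl li
          have := lr h4 hwL.le
          linarith
      refine q1.trans ?_
      have : 0 ≤ (1 + (4*p^2*u)^(σ+1)) * w L := po
      nlinarith
    · push Not at c
      have h1 : ν.real {x | ψ x < u / L} ≤ 1 := measureReal_le_one
      refine h1.trans ?_
      have := hpot L1 L le_rfl hLL
      have h3 : (2*L/L1)^(σ+1) ≤ (4*p^2*u)^(σ+1) := by
        refine rpow_le_rpow po ?_ li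
        rw [div_le_iff₀ hL1p]; linarith
      have h4 := this.trans (lr h3 hwL.le)
      have h5 : 1 ≤ (4*p^2*u)^(σ+1) * (1/w L1) * w L := by
        rw [mul_assoc, one_div_mul_eq_div, ← mul_div_assoc, le_div_iff₀ hw1]; linarith
      have h6 : 0 ≤ (1 + (4*p^2*u)^(σ+1) + 1/w L1) * w L := po
      linarith
  have hlim : ∀ u, 0 < u → Tendsto (fun L => ν.real {x | ψ x < u / L} / w L) atTop (nhds ((p^2/2)^σ * u^σ)) := by
    intro u hu
    have l1 : Tendsto (fun L : ℝ => 2*(1-u/L*p)/(u*p^2)) atTop (nhds (2/(u*p^2))) := by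
      have : Tendsto (fun L : ℝ => u/L) atTop (nhds 0) := tendsto_const_nhds.div_atTop tendsto_id
      simpa using (((this.mul_const p).const_sub 1).const_mul 2).div_const (u*p^2)
    have l2 : Tendsto (fun L : ℝ => (2*(1-u/L*p)/(u/L*p^2)) / L) atTop (nhds (2/(u*p^2))) := by
      refine l1.congr' ?_
      filter_upwards [eventually_gt_atTop 0] with L hL
      field_simp
    have l3 := W.ratio po tendsto_id l2
    have l4 : Tendsto (fun L : ℝ => 2*(1-u/L*p)/(u/L*p^2)) atTop atTop := by
      refine (tendsto_id.atTop_mul_pos po l2).congr' ?_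
      filter_upwards [eventually_gt_atTop 0] with L hL
      simp only [id]; field_simp
    have e : (2/(u*p^2))^(-σ) = (p^2/2)^σ * u^σ := by
      rw [rpow_neg po, ← inv_rpow po, ← mul_rpow po po]
      congr 1; field_simp
    rw [← e]
    refine l3.congr' ?_
    filter_upwards [eventually_gt_atTop 0, l4.eventually_ge_atTop L0, eventually_gt_atTop (u*p)] with L h1 h2 h3
    rw [hM (u/L) po (by rw [div_mul_eq_mul_div, div_lt_one h1]; exact h3) h2]; rfl
  have hD : Integrable (fun u => exp (-u) * ((1 + (4*p^2*u)^(σ+1)) * (1+1/w L1))) (volume.restrict (Ioi 0)) := by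
    have i1 := GammaIntegral_convergent (s := 1) one_pos
    have i2 := GammaIntegral_convergent (s := σ+2) li
    have i3 := (i1.add (i2.const_mul ((4*p^2)^(σ+1)))).mul_const (1+1/w L1)
    refine i3.congr ?_
    filter_upwards [ae_restrict_mem mi] with u hu
    simp only [Pi.add_apply, sub_self, rpow_zero]
    rw [mul_rpow po (le_of_lt hu), show σ + 2 - 1 = σ + 1 by ring]; ring
  have K := kar ν ψ hψm hψ0 w _ _ hlim ((eventually_ge_atTop (2*p*L1)).mono fun L hL => ⟨W.pos L (hL1.trans nl), hdom L hL⟩) hD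
  have e1 : ∫ u in Ioi ca 0, exp (-u) * ((p^2/2)^σ * u^σ) = Gamma (σ+1) * (p^2/2)^σ := by
    rw [Gamma_eq_integral li, ← integral_mul_const]
    congr 1; ext u; rw [show σ + 1 - 1 = σ by ring]; ring
  rw [e1] at K
  refine (K.comp tendsto_log_atTop).congr' ?_
  filter_upwards [eventually_gt_atTop 0] with γ hγ
  simp only [Function.comp]
  have : ∀ x, γ^(1/(2*H x+1)) = γ^(1/p) * exp (-(log γ * ψ x)) := by
    intro x
    rw [rpow_def_of_pos hγ, rpow_def_of_pos hγ, ← exp_add]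
    congr 1; simp only [hψ]; ring
  simp only [this]
  rw [im]
  rw [mul_div_mul_left _ _ po]
end
lemma prod_int {α β : Type*} [MeasurableSpace α] [MeasurableSpace β] {μ : Measure α} {ν : Measure β} [SFinite μ] [SFinite ν]
    {F : α → β → ℝ} (hm : Measurable (Function.uncurry F)) (hi : ∀ᵐ x ∂μ, Integrable (F x) ν) {G : α → ℝ}
    (hG : Integrable G μ) (he : ∀ᵐ x ∂μ, ∫ y, |F x y| ∂ν = G x) : Integrable (Function.uncurry F) (μ.prod ν) := by
  refine (integrable_prod_iff hm.aestronglyMeasurable).2 ⟨hi, hG.congr (he.mono fun x hx => ?_)⟩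
  simp only [Function.uncurry_apply_pair, na]; exact hx.symm
lemma mellin1 (b p : ℝ) (hb : 0 < b) (hbp : b < p) : IntegrableOn (fun x : ℝ => x^(b-1) / (1+x^p)) (Ioi 0) ∧
    ∫ x in Ioi ca 0, x^(b-1) / (1+x^p) = π / (p * sin (π * b / p)) := by
  have hp := hb.trans hbp
  set F : ℝ → ℝ → ℝ := fun t x => exp (-t) * (x^(b-1) * exp (-t * x^p)) with hF
  have hm : Measurable (Function.uncurry F) := by simp only [hF]; fun_prop
  have hΓ : 0 < b/p ∧ b/p < 1 := ⟨po, by rw [div_lt_one hp]; exact hbp⟩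
  have e1 : ∀ t, 0 < t → ∫ x in Ioi ca 0, F t x = Gamma (b/p) / p * (exp (-t) * t^((1-b/p)-1)) := by
    intro t ht
    simp only [hF]
    rw [im, integral_rpow_mul_exp_neg_mul_rpow hp li ht]
    rw [show -(b-1+1)/p = 1 - b/p - 1 by ring, show (b-1+1)/p = b/p by ring]; ring
  have hi : ∀ᵐ t ∂(volume.restrict (Ioi ca 0)), Integrable (F t) (volume.restrict (Ioi 0)) := by
    filter_upwards [ae_restrict_mem mi] with t ht
    exact (integrableOn_rpow_mul_exp_neg_mul_rpow li hp ht).const_mul _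
  have P := prod_int hm hi ((GammaIntegral_convergent (s := 1 - b/p) li).const_mul (Gamma (b/p) / p)) (by
    filter_upwards [ae_restrict_mem mi] with t ht
    rw [← e1 t ht]
    refine sf mi fun x hx => abs_of_nonneg ?_
    have : 0 < x := hx
    simp only [hF]; positivity)
  have e2 : ∀ x ∈ Ioi ca 0, ∫ t in Ioi ca 0, F t x = x^(b-1) / (1+x^p) := by
    intro x hx
    have hx : 0 < x := hx
    have : ∀ t, F t x = x^(b-1) * exp (-(1+x^p) * t) := by
      intro t; simp only [hF]
      rw [mul_left_comm, ← exp_add]; congr 2; ring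
    simp only [this]
    rw [im, integral_exp_mul_Ioi (by have : 0 < x^p := po
                                     linarith)]
    rw [mul_zero, exp_zero, show -(1+x^p) = -(1+x^p) from rfl]
    have h1 : (1 + x^p) ≠ 0 := po
    field_simp
  constructor
  · exact P.integral_prod_right.congr (by
      filter_upwards [ae_restrict_mem mi] with x hx
      exact e2 x hx)
  · rw [← sf mi e2, ← integral_integral_swap P, sf mi e1, im,
      ← Gamma_eq_integral li, div_mul_eq_mul_div, Gamma_mul_Gamma_one_sub, mul_div_assoc, div_div, mul_comm p]
lemma logint (p : ℝ) (hp : 1 < p) : IntegrableOn (fun x : ℝ => log (1 + x^(-p))) (Ioi 0) ∧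
    ∫ x in Ioi ca 0, log (1 + x^(-p)) = π / sin (π / p) := by
  obtain ⟨m1, m2⟩ := mellin1 1 p one_pos hp
  set F : ℝ → ℝ → ℝ := fun v x => indicator {z : ℝ × ℝ | z.2 < z.1} (fun z => p / (z.1 * (1+z.1^p))) (v, x) with hF
  have hm : Measurable (Function.uncurry F) := by
    have : Function.uncurry F = indicator {z : ℝ × ℝ | z.2 < z.1} (fun z => p / (z.1 * (1+z.1^p))) := by ext ⟨a, b⟩; rfl
    rw [this]
    exact Measurable.indicator fp (measurableSet_lt measurable_snd measurable_fst)
  have hFe : ∀ v x, F v x = indicator (Iio v) (fun _ => p / (v * (1+v^p))) x := by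
    intro v x; simp only [hF, indicator, mem_setOf_eq, mem_Iio]
  have hint : ∀ v, 0 < v → Integrable (F v) (volume.restrict (Ioi 0)) := by
    intro v hv
    have : F v = indicator (Iio v) (fun _ => p / (v * (1+v^p))) := by ext x; exact hFe v x
    rw [this, integrable_indicator_iff measurableSet_Iio]
    refine integrableOn_const ?_
    rw [Measure.restrict_apply measurableSet_Iio, inter_comm, Ioi_inter_Iio]
    simp
  have e1 : ∀ v ∈ Ioi ca 0, ∫ x in Ioi ca 0, F v x = p * (v^(ca 1-1) / (1+v^p)) := by
    intro v hv
    have hv : 0 < v := hv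
    simp only [hFe]
    rw [integral_indicator measurableSet_Iio, integral_const, measureReal_restrict_apply MeasurableSet.univ, univ_inter, measureReal_restrict_apply measurableSet_Iio, inter_comm, Ioi_inter_Iio, volume_real_Ioo_of_le hv.le]
    simp; field_simp
  have hF0 : ∀ v ∈ Ioi ca 0, ∀ x, 0 ≤ F v x := by
    intro v hv x
    have hv : 0 < v := hv
    rw [hFe]; exact indicator_nonneg (fun _ _ => po) _
  have P := prod_int (μ := volume.restrict (Ioi 0)) hm ((ae_restrict_mem mi).mono hint) (m1.const_mul p) (by
    filter_upwards [ae_restrict_mem mi] with v hv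
    rw [← e1 v hv]
    exact integral_congr_ae (Eventually.of_forall fun x => abs_of_nonneg (hF0 v hv x)))
  have e2 : ∀ x ∈ Ioi ca 0, ∫ v in Ioi ca 0, F v x = log (1 + x^(-p)) := by
    intro x hx
    have hx := hx
    have hh : ∀ v, F v x = indicator (Ioi x) (fun v => p / (v * (1+v^p))) v := by
      intro v; simp only [hF, indicator, mem_setOf_eq, mem_Ioi]
    simp only [hh]
    rw [integral_indicator mi, Measure.restrict_restrict mi, inter_eq_left.2 (Ioi_subset_Ioi hx.le)]
    have hlim : Tendsto (fun v : ℝ => -log (1 + v^(-p))) atTop (nhds 0) := by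
      have h1 := ((tendsto_rpow_neg_atTop (show 0 < p by linarith)).const_add 1)
      have := ((continuousAt_log (by norm_num : ca 1+0 ≠ 0)).tendsto.comp h1).neg
      simpa using this
    rw [integral_Ioi_of_hasDerivAt_of_nonneg' (g := fun v => -log (1 + v^(-p))) ?_ ?_ hlim]
    · simp
    · intro v hv
      have hv : 0 < v := hx.trans_le hv
      have := (((hasDerivAt_rpow_const (x := v) (p := -p) (Or.inl hv.ne')).const_add 1).log po).neg
      refine this.congr_deriv ?_
      rw [rpow_sub hv, rpow_neg hv.le, rpow_one]
      field_simp
      ring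
    · intro v hv
      have hv : 0 < v := hx.trans hv
      positivity
  constructor
  · exact P.integral_prod_right.congr (by
      filter_upwards [ae_restrict_mem mi] with x hx
      exact e2 x hx)
  · rw [← sf mi e2, ← integral_integral_swap P, sf mi e1, im, m2]
    rw [mul_one]; field_simp
lemma gam_int (a c : ℝ) (ha1 : a < 1) (hc : 0 < c) :
    IntegrableOn (fun s : ℝ => s^(-a) * exp (-(c*s))) (Ioi 0) ∧
    ∫ s in Ioi ca 0, s^(-a) * exp (-(c*s)) = Gamma (1-a) * c^(a-1) := by
  constructor
  · have := integrableOn_rpow_mul_exp_neg_mul_rpow (s := -a) (p := 1) (b := c) li one_pos hc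
    simpa using this
  · have := integral_rpow_mul_exp_neg_mul_Ioi (a := 1-a) (r := c) li hc
    rw [show (1-a) - 1 = -a by ring] at this
    rw [this, one_div, inv_rpow hc.le, ← rpow_neg hc.le, mul_comm]; congr 2; ring
lemma lap (a : ℝ) (ha1 : a < 1) (N : ℝ) (f g : ℝ → ℝ) (hf : Measurable f) (hf1 : ∀ u, |f u| ≤ 1)
    (hg : Measurable g) (hg0 : ∀ u ∈ Ioo 0 N, 0 < g u) (hgi : IntegrableOn (fun u => g u^(a-1)) (Ioo 0 N)) :
    Gamma (1-a) * ∫ u in Ioo 0 N, g u^(a-1) * f u =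
      ∫ s in Ioi ca 0, s^(-a) * ∫ u in Ioo 0 N, exp (-(s * g u)) * f u := by
  set F : ℝ → ℝ → ℝ := fun u s => f u * (s^(-a) * exp (-(g u * s))) with hF
  have hm : Measurable (Function.uncurry F) := by simp only [hF]; fun_prop
  have e0 := ae_restrict_mem (μ := volume) (measurableSet_Ioo (a := 0) (b := N))
  have P := prod_int (μ := volume.restrict (Ioo 0 N)) (ν := volume.restrict (Ioi 0)) hm
    (G := fun u => |f u| * (Gamma (1-a) * g u^(a-1)))
    (by filter_upwards [e0] with u hu; exact (gam_int a (g u) ha1 (hg0 u hu)).1.const_mul _)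
    (by
      refine Integrable.bdd_mul (c := 1) (hgi.const_mul _) fp (Eventually.of_forall fun u => ?_)
      simpa using hf1 u)
    (by
      filter_upwards [e0] with u hu
      rw [← (gam_int a (g u) ha1 (hg0 u hu)).2, ← im]
      refine sf mi fun s hs => ?_
      have hs : 0 < s := hs
      simp only [hF]
      rw [abs_mul, abs_of_nonneg (by positivity : 0 ≤ s^(-a) * exp (-(g u * s)))])
  have := integral_integral_swap P
  rw [← im]
  have l : ∫ u in Ioo 0 N, Gamma (1-a) * (g u^(a-1) * f u) = ∫ u in Ioo 0 N, ∫ s in Ioi 0, F u s := by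
    refine sf mo fun u hu => ?_
    simp only [hF]
    rw [im, (gam_int a (g u) ha1 (hg0 u hu)).2]; ring
  rw [l, this]
  refine sf mi fun s hs => ?_
  simp only [hF]
  rw [← im]
  congr 1; ext u; rw [mul_comm (g u)]; ring
def Sf (a y : ℝ) : ℝ := ∫ u in Ioo 0 y, (y-u)^(a-1) * sin u
def rhof (a y : ℝ) : ℝ := (∫ s in Ioi ca 0, s^(-a) * (exp (-(y*s)) / (1+s^2))) / Gamma (1-a)
lemma mell2 (a : ℝ) (h0 : 0 < a) (h1 : a < 1) :
    IntegrableOn (fun s : ℝ => s^(-a) * (1 / (1+s^2))) (Ioi 0) ∧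
    ∫ s in Ioi ca 0, s^(-a) * (1 / (1+s^2)) = Gamma (1-a) * (Gamma a * sin (π*a/2)) ∧
    IntegrableOn (fun s : ℝ => s^(-a) * (s / (1+s^2))) (Ioi 0) ∧
    ∫ s in Ioi ca 0, s^(-a) * (s / (1+s^2)) = Gamma (1-a) * (Gamma a * cos (π*a/2)) := by
  have hpi := pi_pos
  obtain ⟨A1, A2⟩ := mellin1 (1-a) 2 li li
  obtain ⟨B1, B2⟩ := mellin1 (2-a) 2 li li
  have hG := Gamma_mul_Gamma_one_sub a
  have hs2 : sin (π*a) = 2 * sin (π*a/2) * cos (π*a/2) := by rw [← sin_two_mul]; congr 1; ring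
  have hsp : 0 < sin (π*a/2) := sin_pos_of_pos_of_lt_pi po nl
  have hcp : 0 < cos (π*a/2) := cos_pos_of_mem_Ioo ⟨nl, nl⟩
  have c1 : ∀ s ∈ Ioi ca 0, s^((1-a)-1) / (1+s^ca 2) = s^(-a) * (1 / (1+s^2)) := by
    intro s hs; rw [show 1-a-1 = -a by ring, rpow_two]; ring
  have c2 : ∀ s ∈ Ioi ca 0, s^((2-a)-1) / (1+s^ca 2) = s^(-a) * (s / (1+s^2)) := by
    intro s hs; have hs : 0 < s := hs
    rw [show 2-a-1 = -a+1 by ring, rpow_two, rpow_add hs, rpow_one]; ring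
  refine ⟨A1.congr_fun c1 mi, ?_, B1.congr_fun c2 mi, ?_⟩
  · rw [← sf mi c1, A2, show π*(1-a)/2 = π/2 - π*a/2 by ring, sin_pi_div_two_sub, ← mul_assoc, mul_comm (Gamma (1-a)), hG, hs2]
    field_simp
  · rw [← sf mi c2, B2, show π*(2-a)/2 = π - π*a/2 by ring, sin_pi_sub, ← mul_assoc, mul_comm (Gamma (1-a)), hG, hs2]
    field_simp
lemma rho_int (a y : ℝ) (h0 : 0 < a) (h1 : a < 1) (hy : 0 ≤ y) :
    IntegrableOn (fun s : ℝ => s^(-a) * (exp (-(y*s)) / (1+s^2))) (Ioi 0) := by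
  refine Integrable.mono' (mell2 a h0 h1).1 fp ?_
  filter_upwards [ae_restrict_mem mi] with s hs
  have hs : 0 < s := hs
  rw [na, abs_of_nonneg po]
  gcongr
  rw [exp_le_one_iff]; nlinarith
lemma rho_bd (a y : ℝ) (h0 : 0 < a) (h1 : a < 1) (hy : 0 ≤ y) :
    0 ≤ rhof a y ∧ rhof a y ≤ Gamma a ∧ (0 < y → rhof a y ≤ y^(a-1)) := by
  have hΓ : 0 < Gamma (1-a) := gp li
  have hΓ' : 0 < Gamma a := gp li
  unfold rhof
  refine ⟨div_nonneg (setIntegral_nonneg mi fun s hs => ?_) hΓ.le, ?_, fun hy' => ?_⟩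
  · have hs : 0 < s := hs
    positivity
  · rw [div_le_iff₀ hΓ]
    have : ∫ s in Ioi ca 0, s^(-a) * (exp (-(y*s)) / (1+s^2)) ≤ ∫ s in Ioi ca 0, s^(-a) * (1 / (1+s^2)) := by
      refine setIntegral_mono_on (rho_int a y h0 h1 hy) (mell2 a h0 h1).1 mi fun s hs => ?_
      have hs : 0 < s := hs
      gcongr
      rw [exp_le_one_iff]; nlinarith
    rw [(mell2 a h0 h1).2.1] at this
    nlinarith [sin_le_one (π*a/2), mul_pos hΓ hΓ']
  · rw [div_le_iff₀ hΓ, mul_comm, ← (gam_int a y h1 hy').2]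
    refine setIntegral_mono_on (rho_int a y h0 h1 hy) (gam_int a y h1 hy').1 mi fun s hs => ?_
    have hs : 0 < s := hs
    gcongr
    exact div_le_self (exp_pos _).le nl
lemma sin_lap (s y : ℝ) (hy : 0 ≤ y) : ∫ u in Ioo 0 y, exp (-(s * (y-u))) * sin u =
    (s * sin y - cos y + exp (-(y*s))) / (1+s^2) := by
  rw [← oo, ← io hy]
  have hd : ∀ u ∈ uIcc 0 y, HasDerivAt (fun u => exp (-(s * (y-u))) * (s * sin u - cos u) / (1+s^2)) (exp (-(s * (y-u))) * sin u) u := by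
    intro u _
    have h1 : HasDerivAt (fun u => exp (-(s * (y-u)))) (exp (-(s * (y-u))) * s) u := by
      have := ((((hasDerivAt_id u).const_sub y).const_mul s).neg).exp
      simpa using this
    have := (h1.mul (((hasDerivAt_sin u).const_mul s).sub (hasDerivAt_cos u))).div_const (1+s^2)
    refine this.congr_deriv ?_
    simp only [Pi.sub_apply]
    field_simp; ring
  rw [intervalIntegral.integral_eq_sub_of_hasDerivAt hd (Continuous.intervalIntegrable fp _ _)]
  simp; rw [mul_comm s y]; ring
lemma int_rp (a y : ℝ) (h0 : 0 < a) : IntegrableOn (fun u : ℝ => (y-u)^(a-1)) (Ioo 0 y) := by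
  rcases le_or_gt 0 y with hy | hy
  · have := (intervalIntegral.intervalIntegrable_rpow' (r := a-1) (a := 0) (b := y) li).comp_sub_left y
    simp only [sub_zero, sub_self] at this
    exact ((intervalIntegrable_iff_integrableOn_Ioc_of_le hy).1 this.symm).mono_set Ioo_subset_Ioc_self
  · rw [Ioo_eq_empty li]; exact integrableOn_empty
lemma Sf_eq (a y : ℝ) (h0 : 0 < a) (h1 : a < 1) (hy : 0 ≤ y) :
    Sf a y = Gamma a * sin (y - π*a/2) + rhof a y := by
  have hΓ : 0 < Gamma (1-a) := gp li
  have := lap a h1 y sin (fun u => y-u) measurable_sin abs_sin_le_one fp (fun u hu => by linarith [hu.2]) (int_rp a y h0)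
  obtain ⟨A1, A2, B1, B2⟩ := mell2 a h0 h1
  simp only [sin_lap _ y hy] at this
  have e : ∀ s : ℝ, s^(-a) * ((s * sin y - cos y + exp (-(y*s))) / (1+s^2)) =
    sin y * (s^(-a) * (s / (1+s^2))) - cos y * (s^(-a) * (1 / (1+s^2))) + s^(-a) * (exp (-(y*s)) / (1+s^2)) := by
    intro s; ring
  simp only [e] at this
  have hBA : IntegrableOn (fun s : ℝ => sin y * (s^(-a) * (s / (1+s^2))) - cos y * (s^(-a) * (1 / (1+s^2)))) (Ioi 0) := (B1.const_mul _).sub (A1.const_mul _)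
  rw [integral_add hBA (rho_int a y h0 h1 hy), integral_sub (B1.const_mul _) (A1.const_mul _), im, im, A2, B2] at this
  unfold Sf rhof
  rw [sin_sub]
  field_simp
  rw [mul_comm, this]
  ring
lemma tail_bd (q v : ℝ) (k : ℕ) (h0 : 0 < q) (h1 : q < 1) (hv : 0 < v) :
    |∫ u in Ioo 0 (π*k), (u+v)^(q-1) * sin u| ≤ 4 * (Gamma q + 1) * (1+v)^(q-1) := by
  have hΓ : 0 < Gamma (1-q) := gp li
  have hΓ' : 0 < Gamma q := gp li
  have hN : 0 ≤ π*k := po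
  have := lap q h1 (π*k) sin (fun u => u+v) measurable_sin abs_sin_le_one fp (fun u hu => by linarith [hu.1])
    (((ContinuousOn.rpow_const (f := fun u : ℝ => u+v) (p := q-1) fp (fun u hu => Or.inl (by linarith [hu.1]))).integrableOn_Icc (a := 0) (b := π*k)).mono_set Ioo_subset_Icc_self)
  have e : ∀ s : ℝ, ∫ u in Ioo 0 (π*k), exp (-(s * (u+v))) * sin u = exp (-(v*s)) * ((1 - exp (-(s*(π*k))) * cos (π*k)) / (1+s^2)) := by
    intro s
    have h := sin_lap (-s) (π*k) hN
    have : ∀ u, exp (-(s * (u+v))) * sin u = exp (-(s*(π*k) + v*s)) * (exp (-(-s * (π*k-u))) * sin u) := by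
      intro u; rw [← mul_assoc, ← exp_add]; congr 2; ring
    simp only [this]
    rw [im, h, neg_add, exp_add, show sin (π*k) = 0 by rw [mul_comm]; exact sin_nat_mul_pi k]
    have e2 : exp (-(s*(π*k))) * exp (-(π*k*-s)) = 1 := by rw [← exp_add, ← exp_zero]; congr 1; ring
    rw [neg_sq]
    rw [mul_neg, neg_neg] at *
    field_simp
    rw [show -(s*(π*k)) = -(s*π*k) by ring, show π*k*s = s*π*k by ring] at e2
    linear_combination e2
  simp only [e] at this
  have h2 : |∫ u in Ioo 0 (π*k), (u+v)^(q-1) * sin u| ≤ 2 * rhof q v := by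
    have : Gamma (1-q) * |∫ u in Ioo 0 (π*k), (u+v)^(q-1) * sin u| ≤ ∫ s in Ioi ca 0, 2 * (s^(-q) * (exp (-(v*s)) / (1+s^2))) := by
      rw [← abs_of_pos hΓ, ← abs_mul, this]
      refine abs_integral_le_integral_abs.trans ?_
      refine integral_mono_of_nonneg (Eventually.of_forall fun s => abs_nonneg _) ((rho_int q v h0 h1 hv.le).const_mul 2) ?_
      filter_upwards [ae_restrict_mem mi] with s hs
      have hs : 0 < s := hs
      have hb : |1 - exp (-(s*(π*k))) * cos (π*k)| ≤ 2 := by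
        have h3 : |exp (-(s*(π*k))) * cos (π*k)| ≤ 1 := by
          rw [abs_mul, abs_of_pos (exp_pos _)]
          exact mul_le_one₀ (by rw [exp_le_one_iff]; nlinarith) (abs_nonneg _) (abs_cos_le_one _)
        rw [abs_le] at *; constructor <;> linarith
      simp only [abs_mul, abs_div]
      rw [abs_of_pos (exp_pos _), abs_of_nonneg (by positivity : 0 ≤ s^(-q)), abs_of_nonneg (by positivity : 0 ≤ 1+s^2)]
      calc _ ≤ s^(-q) * (exp (-(v*s)) * (2 / (1+s^2))) := by gcongr
        _ = _ := by ring
    rw [im] at this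
    unfold rhof
    rw [← mul_div_assoc, le_div_iff₀ hΓ, mul_comm]; exact this
  obtain ⟨-, b1, b2⟩ := rho_bd q v h0 h1 hv.le
  refine h2.trans ?_
  have h4 : ca 2^(q-1) ≥ 1/2 := by
    have := rpow_le_rpow_of_exponent_le (x := 2) nn (show (-1:ℝ) ≤ q-1 by linarith)
    rw [rpow_neg_one] at this; linarith
  rcases le_or_gt v 1 with hv1 | hv1
  · have : ca 2^(q-1) ≤ (1+v)^(q-1) := rp li li li
    nlinarith
  · have : (2*v)^(q-1) ≤ (1+v)^(q-1) := rp li li li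
    rw [mul_rpow nn hv.le] at this
    have h5 := b2 hv
    have h6 : 0 < v^(q-1) := po
    have h7 : 0 < (1+v)^(q-1) := po
    nlinarith
lemma sub_Ioo (f : ℝ → ℝ) (c d a b : ℝ) (hc : 0 < c) :
    ∫ x in Ioo a b, f (c*x+d) = c⁻¹ * ∫ x in Ioo (c*a+d) (c*b+d), f x := by
  rcases le_or_gt a b with h | h
  · rw [← oo, ← io h, ← oo,
      ← io nl, intervalIntegral.integral_comp_mul_add _ hc.ne', smul_eq_mul]
  · rw [Ioo_eq_empty li, Ioo_eq_empty nl]; simp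
lemma sub_Ioo' (f : ℝ → ℝ) (c d a b : ℝ) (hc : 0 < c) :
    ∫ x in Ioo a b, f (d-c*x) = c⁻¹ * ∫ x in Ioo (d-c*b) (d-c*a), f x := by
  rcases le_or_gt a b with h | h
  · rw [← oo, ← io h, ← oo,
      ← io nl, intervalIntegral.integral_comp_sub_mul _ hc.ne', smul_eq_mul]
  · rw [Ioo_eq_empty li, Ioo_eq_empty nl]; simp
lemma beta0 (q : ℝ) (h0 : 0 < q) (h1 : q < 1) :
    ∫ x in uI, (1-x)^q * x^(-q) = Gamma (1+q) * Gamma (1-q) := by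
  have h := ProbabilityTheory.lintegral_betaPDF_eq_one (α := 1-q) (β := 1+q) li li
  have hb := ProbabilityTheory.beta_pos (α := 1-q) (β := 1+q) li li
  rw [ProbabilityTheory.lintegral_betaPDF] at h
  have h2 := integral_eq_lintegral_of_nonneg_ae (μ := volume.restrict (uI)) (f := fun x => 1 / ProbabilityTheory.beta (1-q) (1+q) * x ^ (1-q - 1) * (1 - x) ^ (1+q - 1))
    (ae_restrict_of_forall_mem mo fun x hx => by
      have := hx.1; have := sub_pos.2 hx.2
      simp only [Pi.zero_apply]; positivity) fp
  rw [h] at h2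
  simp only [mul_assoc, im] at h2
  rw [ENNReal.toReal_one, one_div, inv_mul_eq_one₀ hb.ne'] at h2
  rw [ProbabilityTheory.beta, show (1-q+(1+q)) = 2 by ring, Gamma_two, div_one] at h2
  rw [mul_comm (Gamma (1+q)), h2]
  refine sf mo fun x hx => ?_
  rw [show 1-q-1 = -q by ring, show 1+q-1 = q by ring, mul_comm]
lemma beta1 (q s y : ℝ) (h0 : 0 < q) (h1 : q < 1) (hsy : s < y) :
    IntegrableOn (fun w => (y-w)^q * (w-s)^(-q)) (Ioo s y) ∧
    ∫ w in Ioo s y, (y-w)^q * (w-s)^(-q) = (y-s) * (Gamma (1+q) * Gamma (1-q)) := by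
  have hd : 0 < y - s := li
  have hv : ∫ w in Ioo s y, (y-w)^q * (w-s)^(-q) = (y-s) * (Gamma (1+q) * Gamma (1-q)) := by
    have h := sub_Ioo (fun w => (y-w)^q * (w-s)^(-q)) (y-s) s 0 1 hd
    rw [show (y-s)*0+s = s by ring, show (y-s)*1+s = y by ring] at h
    rw [← beta0 q h0 h1, eq_comm, ← eq_inv_mul_iff_mul_eq₀ hd.ne', ← h]
    refine sf mo fun x hx => ?_
    rw [show y - ((y-s)*x+s) = (y-s)*(1-x) by ring, show (y-s)*x+s-s = (y-s)*x by ring, mul_rpow hd.le (by linarith [hx.2]), mul_rpow hd.le hx.1.le, rpow_neg hd.le]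
    field_simp
  refine ⟨?_, hv⟩
  by_contra hc
  rw [integral_undef hc] at hv
  have : 0 < (y-s) * (Gamma (1+q) * Gamma (1-q)) := po
  linarith
def Uf (q y : ℝ) : ℝ := (y^(-q) - Sf (1-q) y) / Gamma (1-q)
lemma Sf_meas (a : ℝ) : Measurable (Sf a) := by
  have : Sf a = fun y => ∫ u, indicator {z : ℝ × ℝ | 0 < z.2 ∧ z.2 < z.1} (fun z => (z.1-z.2)^(a-1) * sin z.2) (y, u) := by
    ext y
    rw [Sf, ← integral_indicator mo]
    congr 1
  rw [this]
  have hm : Measurable (indicator {z : ℝ × ℝ | 0 < z.2 ∧ z.2 < z.1} (fun z => (z.1-z.2)^(a-1) * sin z.2)) :=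
    Measurable.indicator fp ((measurableSet_lt measurable_const measurable_snd).inter (measurableSet_lt measurable_snd measurable_fst))
  exact (hm.stronglyMeasurable.integral_prod_right').measurable
lemma Uf_meas (q : ℝ) : Measurable (Uf q) := by
  unfold Uf; have := Sf_meas (1-q); fun_prop
lemma lin_sin (y : ℝ) (hy : 0 ≤ y) : ∫ s in Ioo 0 y, sin s * (y-s) = y - sin y := by
  rw [← oo, ← io hy]
  have hd : ∀ u ∈ uIcc 0 y, HasDerivAt (fun u => -(y-u) * cos u - sin u) (sin u * (y-u)) u := by
    intro u _
    have := ((((hasDerivAt_id u).const_sub y).neg).mul (hasDerivAt_cos u)).sub (hasDerivAt_sin u)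
    refine this.congr_deriv ?_
    simp; ring
  rw [intervalIntegral.integral_eq_sub_of_hasDerivAt hd (Continuous.intervalIntegrable fp _ _)]
  simp; ring
lemma U_inv (q y : ℝ) (h0 : 0 < q) (h1 : q < 1) (hy : 0 < y) :
    ∫ w in Ioo 0 y, (y-w)^q * Uf q w = Gamma (1+q) * sin y := by
  have hΓ : 0 < Gamma (1-q) := gp li
  set B := Gamma (1+q) * Gamma (1-q) with hB
  set F : ℝ → ℝ → ℝ := fun s w => indicator {z : ℝ × ℝ | z.1 < z.2} (fun z => (y-z.2)^q * (z.2-z.1)^(-q) * sin z.1) (s, w) with hF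
  have hm : Measurable (Function.uncurry F) := by
    have : Function.uncurry F = indicator {z : ℝ × ℝ | z.1 < z.2} (fun z => (y-z.2)^q * (z.2-z.1)^(-q) * sin z.1) := by ext ⟨a, b⟩; rfl
    rw [this]
    exact Measurable.indicator fp (measurableSet_lt measurable_fst measurable_snd)
  have hFe : ∀ s w, F s w = indicator (Ioi s) (fun w => (y-w)^q * (w-s)^(-q) * sin s) w := by
    intro s w; simp only [hF, indicator, mem_setOf_eq, mem_Ioi]
  have hFe' : ∀ s w, F s w = indicator (Iio w) (fun s => (y-w)^q * (w-s)^(-q) * sin s) s := by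
    intro s w; simp only [hF, indicator, mem_setOf_eq, mem_Iio]
  have hset : ∀ s ∈ Ioo 0 y, Ioi s ∩ Ioo 0 y = Ioo s y := by
    intro s hs; ext w; simp only [mem_inter_iff, mem_Ioi, mem_Ioo]
    exact ⟨fun h => ⟨h.1, h.2.2⟩, fun h => ⟨h.1, hs.1.trans h.1, h.2⟩⟩
  have hset' : ∀ w ∈ Ioo 0 y, Iio w ∩ Ioo 0 y = Ioo 0 w := by
    intro s hs; ext w; simp only [mem_inter_iff, mem_Iio, mem_Ioo]
    exact ⟨fun h => ⟨h.2.1, h.1⟩, fun h => ⟨h.2, h.1, h.2.trans hs.2⟩⟩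
  have e1 : ∀ s ∈ Ioo 0 y, ∫ w in Ioo 0 y, F s w = B * (sin s * (y-s)) := by
    intro s hs
    simp only [hFe]
    rw [integral_indicator mi, Measure.restrict_restrict mi, hset s hs, integral_mul_const, (beta1 q s y h0 h1 hs.2).2]; ring
  have P := prod_int (μ := volume.restrict (Ioo 0 y)) (ν := volume.restrict (Ioo 0 y)) hm
    (G := fun s => B * (|sin s| * (y-s)))
    (by
      filter_upwards [ae_restrict_mem mo] with s hs
      have : F s = indicator (Ioi s) (fun w => (y-w)^q * (w-s)^(-q) * sin s) := by ext w; exact hFe s w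
      rw [this, integrable_indicator_iff mi, IntegrableOn, Measure.restrict_restrict mi, hset s hs]
      exact (beta1 q s y h0 h1 hs.2).1.mul_const _)
    ((Continuous.integrableOn_Icc (a := 0) (b := y) fp).mono_set Ioo_subset_Icc_self)
    (by
      filter_upwards [ae_restrict_mem mo] with s hs
      have : ∀ w, |F s w| = indicator (Ioi s) (fun w => |(y-w)^q * (w-s)^(-q) * sin s|) w := by
        intro w; rw [hFe]; simp only [indicator]; split_ifs <;> simp
      simp only [this]
      rw [integral_indicator mi, Measure.restrict_restrict mi, hset s hs]
      rw [setIntegral_congr_fun (g := fun w => (y-w)^q * (w-s)^(-q) * |sin s|) mo]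
      · rw [integral_mul_const, (beta1 q s y h0 h1 hs.2).2]; ring
      · intro w hw
        have := sub_pos.2 hw.1; have := sub_pos.2 hw.2
        simp only
        rw [abs_mul, abs_of_nonneg po])
  have sw := integral_integral_swap P
  rw [sf mo e1, im, lin_sin y hy.le] at sw
  have e2 : ∀ w ∈ Ioo 0 y, ∫ s in Ioo 0 y, F s w = (y-w)^q * Sf (1-q) w := by
    intro w hw
    simp only [hFe']
    rw [integral_indicator measurableSet_Iio, Measure.restrict_restrict measurableSet_Iio, hset' w hw, Sf, ← im]
    congr 1; ext u; rw [show 1-q-1 = -q by ring]; ring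
  have iS : IntegrableOn (fun w => (y-w)^q * Sf (1-q) w) (Ioo 0 y) :=
    P.integral_prod_right.congr (by
      filter_upwards [ae_restrict_mem mo] with x hx
      exact e2 x hx)
  rw [sf mo e2] at sw
  obtain ⟨b1, b2⟩ := beta1 q 0 y h0 h1 hy
  simp only [sub_zero] at b1 b2
  have e3 : ∀ w, (y-w)^q * Uf q w = (Gamma (1-q))⁻¹ * ((y-w)^q * w^(-q) - (y-w)^q * Sf (1-q) w) := by
    intro w; unfold Uf; ring
  simp only [e3]
  rw [im, integral_sub b1 iS, b2, ← sw, hB]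
  field_simp; ring
lemma sq_split (δ x y : ℝ) (hδ : 0 < δ) : (x+y)^2 ≤ (1+δ)*x^2 + (1+1/δ)*y^2 := by
  have : 0 ≤ (δ*x - y)^2/δ := po
  have e : (δ*x - y)^2/δ = δ*x^2 - 2*x*y + 1/δ*y^2 := by field_simp; ring
  nlinarith
lemma sin2_int (θ : ℝ) (k : ℕ) : ∫ y in Ioo 0 (π*k), sin (y-θ)^2 = π*k/2 := by
  have hk : 0 ≤ π*k := po
  rw [← oo, ← io hk, intervalIntegral.integral_comp_sub_right (fun y => sin y^2), integral_sin_sq]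
  have e1 : sin (π*k-θ) * cos (π*k-θ) = sin (0-θ) * cos (0-θ) := by
    have h1 : ∀ x, sin x * cos x = sin (2*x)/2 := by intro x; rw [sin_two_mul]; ring
    rw [h1, h1, show 2*(π*k-θ) = 2*(0-θ) + k*(2*π) by ring, sin_add_nat_mul_two_pi]
  rw [e1]; ring
lemma rp_int (c N : ℝ) (hc : -1 < c) (hN : 0 ≤ N) : IntegrableOn (fun y : ℝ => y^c) (Ioo 0 N) ∧ ∫ y in Ioo 0 N, y^c = N^(c+1)/(c+1) := by
  refine ⟨((intervalIntegrable_iff_integrableOn_Ioc_of_le hN).1 (intervalIntegral.intervalIntegrable_rpow' hc)).mono_set Ioo_subset_Ioc_self, ?_⟩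
  rw [← oo, ← io hN, integral_rpow (Or.inl hc), zero_rpow li, sub_zero]
lemma Sf_sq (a δ : ℝ) (k : ℕ) (h0 : 0 < a) (h1 : a < 1) (hδ : 0 < δ) :
    IntegrableOn (fun y => Sf a y^2) (Ioo 0 (π*k)) ∧
    ∫ y in Ioo 0 (π*k), Sf a y^2 ≤ (1+δ)*(Gamma a^2*(π*k/2)) + (1+1/δ)*(Gamma a * ((π*k)^a/a)) := by
  have hN : 0 ≤ π*k := po
  obtain ⟨r1, r2⟩ := rp_int (a-1) (π*k) li hN
  have hi : IntegrableOn (fun y => sin (y-π*a/2)^2) (Ioo 0 (π*k)) := (Continuous.integrableOn_Icc fp).mono_set Ioo_subset_Icc_self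
  have hI1 : IntegrableOn (fun y => (1+δ)*(Gamma a^2*sin (y-π*a/2)^2)) (Ioo 0 (π*k)) := (hi.const_mul _).const_mul _
  have hI2 : IntegrableOn (fun y => (1+1/δ)*(Gamma a * y^(a-1))) (Ioo 0 (π*k)) := (r1.const_mul _).const_mul _
  have hb : ∀ y ∈ Ioo 0 (π*k), Sf a y^2 ≤ (1+δ)*(Gamma a^2*sin (y-π*a/2)^2) + (1+1/δ)*(Gamma a * y^(a-1)) := by
    intro y hy
    obtain ⟨b0, b1, b2⟩ := rho_bd a y h0 h1 hy.1.le
    rw [Sf_eq a y h0 h1 hy.1.le]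
    refine (sq_split δ _ _ hδ).trans ?_
    rw [mul_pow]
    gcongr
    rw [sq]; exact mul_le_mul b1 (b2 hy.1) b0 (b0.trans b1)
  constructor
  · refine Integrable.mono' (hI1.add hI2) ((Sf_meas a).pow_const 2).aestronglyMeasurable ?_
    filter_upwards [ae_restrict_mem mo] with y hy
    rw [na, abs_of_nonneg (sq_nonneg _)]; exact hb y hy
  · have := integral_mono_of_nonneg (μ := volume.restrict (Ioo 0 (π*k))) (f := fun y => Sf a y^2) (Eventually.of_forall fun y => sq_nonneg _) (hI1.add hI2) (by
      filter_upwards [ae_restrict_mem mo] with y hy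
      exact hb y hy)
    simp only [Pi.add_apply] at this
    rw [integral_add hI1 hI2] at this
    simp only [im] at this
    rw [sin2_int, r2] at this
    simpa using this
lemma Uf_sq (q δ : ℝ) (k : ℕ) (h0 : 0 < q) (h1 : q < 1/2) (hδ : 0 < δ) :
    IntegrableOn (fun y => Uf q y^2) (Ioo 0 (π*k)) ∧
    ∫ y in Ioo 0 (π*k), Uf q y^2 ≤ (1+δ)*(π*k/2) + (1+1/δ)*((Gamma (1-q)^2)⁻¹ * ((π*k)^(1-2*q)/(1-2*q))) := by
  have hΓ : 0 < Gamma (1-q) := gp li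
  have hN : 0 ≤ π*k := po
  obtain ⟨r1, r2⟩ := rp_int (-2*q) (π*k) li hN
  have hi : IntegrableOn (fun y => sin (y-π*(1-q)/2)^2) (Ioo 0 (π*k)) := (Continuous.integrableOn_Icc fp).mono_set Ioo_subset_Icc_self
  have hI1 : IntegrableOn (fun y => (1+δ)*(sin (y-π*(1-q)/2)^2)) (Ioo 0 (π*k)) := (hi.const_mul _)
  have hI2 : IntegrableOn (fun y => (1+1/δ)*((Gamma (1-q)^2)⁻¹ * y^(-2*q))) (Ioo 0 (π*k)) := (r1.const_mul _).const_mul _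
  have hb : ∀ y ∈ Ioo 0 (π*k), Uf q y^2 ≤ (1+δ)*(sin (y-π*(1-q)/2)^2) + (1+1/δ)*((Gamma (1-q)^2)⁻¹ * y^(-2*q)) := by
    intro y hy
    obtain ⟨b0, b1, b2⟩ := rho_bd (1-q) y li li hy.1.le
    have b2 := b2 hy.1
    rw [show 1-q-1 = -q by ring] at b2
    have e : Uf q y = -sin (y-π*(1-q)/2) + (y^(-q) - rhof (1-q) y)/Gamma (1-q) := by
      rw [Uf, Sf_eq (1-q) y li li hy.1.le]; field_simp; ring
    rw [e]
    refine (sq_split δ _ _ hδ).trans ?_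
    rw [neg_sq, div_pow, div_eq_inv_mul _ (Gamma (1-q)^2)]
    gcongr
    rw [show -2*q = -q + -q by ring, rpow_add hy.1, ← sq]
    exact pow_le_pow_left₀ li li 2
  constructor
  · refine Integrable.mono' (hI1.add hI2) ((Uf_meas q).pow_const 2).aestronglyMeasurable ?_
    filter_upwards [ae_restrict_mem mo] with y hy
    rw [na, abs_of_nonneg (sq_nonneg _)]; exact hb y hy
  · have := integral_mono_of_nonneg (μ := volume.restrict (Ioo 0 (π*k))) (f := fun y => Uf q y^2) (Eventually.of_forall fun y => sq_nonneg _) (hI1.add hI2) (by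
      filter_upwards [ae_restrict_mem mo] with y hy
      exact hb y hy)
    simp only [Pi.add_apply] at this
    rw [integral_add hI1 hI2] at this
    simp only [im] at this
    rw [sin2_int, r2, show -2*q+1 = 1-2*q by ring] at this
    simpa using this
lemma Gam_cd (x : ℝ) (hx : 0 < x) : ContDiffAt ℝ 1 Gamma x := by
  have : ContDiffAt ℂ 1 Complex.Gamma (x:ℂ) := by
    have hd : DifferentiableOn ℂ Complex.Gamma {z | 0 < z.re} := fun z hz =>
      (Complex.differentiableAt_Gamma z (fun m h => by
        rw [h] at hz; simp at hz
        linarith)).differentiableWithinAt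
    exact (hd.analyticAt ((isOpen_lt continuous_const Complex.continuous_re).mem_nhds (by simpa using hx))).contDiffAt
  exact this.real_of_complex
def Ah (h : ℝ) : ℝ := Gamma (2*h+1) * sin (π*h)
def Gh (h : ℝ) : ℝ := Ah h^(1/(2*h+1)) / sin (π/(2*h+1))
lemma Ah_pos (h : ℝ) (h0 : 1/2 < h) (h1 : h < 1) : 0 < Ah h :=
  mul_pos (gp li) (sin_pos_of_pos_of_lt_pi po (by nlinarith [pi_pos]))
lemma cs_pos (h : ℝ) (h0 : 1/2 < h) (h1 : h < 1) : 0 < h * (2 * h - 1) * Gamma (3/2 - h) / (Gamma (2 - 2*h) * Gamma (h - 1/2)) := by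
  have a1 : 0 < Gamma (3/2-h) := gp li
  have a2 : 0 < Gamma (2-2*h) := gp li
  have : 0 < 2*h-1 := li
  positivity
lemma cstar_sq (h : ℝ) (h0 : 1/2 < h) (h1 : h < 1) : cstar h^2 * Gamma (h-1/2)^2 = Ah h := by
  have hpi := pi_pos
  have a2 : 0 < Gamma (2-2*h) := gp li
  have a3 : 0 < Gamma (h-1/2) := gp li
  rw [cstar, sq_sqrt (cs_pos h h0 h1).le, Ah]
  have g1 := Gamma_mul_Gamma_one_sub (h-1/2)
  have g2 := Gamma_mul_Gamma_one_sub (2*h-1)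
  rw [show 1-(h-1/2) = 3/2-h by ring] at g1
  rw [show 1-(2*h-1) = 2-2*h by ring] at g2
  have s1 : sin (π*(h-1/2)) = -cos (π*h) := by
    rw [show π*(h-1/2) = π*h-π/2 by ring, sin_sub_pi_div_two]
  have s2 : sin (π*(2*h-1)) = -(2*sin (π*h)*cos (π*h)) := by
    rw [show π*(2*h-1) = 2*(π*h)-π by ring, sin_sub_pi, sin_two_mul]
  have hc : cos (π*h) < 0 := cos_neg_of_pi_div_two_lt_of_lt nl nl
  have hs : 0 < sin (π*h) := sin_pos_of_pos_of_lt_pi po nl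
  have e1 : Gamma (2*h+1) = 2*h*((2*h-1)*Gamma (2*h-1)) := by
    rw [Gamma_add_one li, show 2*h = (2*h-1)+1 by ring, Gamma_add_one li]; ring
  rw [e1]
  rw [s1] at g1; rw [s2] at g2
  have e2 : Gamma (2*h-1) = π / -(2*sin (π*h)*cos (π*h)) / Gamma (2-2*h) := by rw [← g2, mul_div_cancel_right₀ _ a2.ne']
  have e3 : Gamma (3/2-h) = π / -cos (π*h) / Gamma (h-1/2) := by rw [← g1, mul_div_cancel_left₀ _ a3.ne']
  have hc' := hc.ne
  rw [e2, e3]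
  generalize Gamma (h-1/2) = x at *
  generalize Gamma (2-2*h) = y at *
  generalize sin (π*h) = u at *
  generalize cos (π*h) = v at *
  field_simp
lemma cstar_cd (h : ℝ) (h0 : 1/2 < h) (h1 : h < 1) : ContDiffAt ℝ 1 cstar h := by
  unfold cstar
  have a2 : 0 < Gamma (2-2*h) := gp li
  refine ContDiffAt.sqrt (ContDiffAt.div (ContDiffAt.mul fp ?_) (ContDiffAt.mul ?_ ?_) po) (cs_pos h h0 h1).ne'
  · exact (Gam_cd (3/2-h) li).comp h (f := fun h => 3/2-h) fp
  · exact (Gam_cd (2-2*h) li).comp h (f := fun h => 2-2*h) fp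
  · exact (Gam_cd (h-1/2) li).comp h (f := fun h => h-1/2) fp
lemma cstar_lip (Hm HM : ℝ) (h0 : 1/2 < Hm) (h1 : HM < 1) : ∃ C : ℝ, 0 < C ∧
    (∀ h ∈ Icc Hm HM, ∀ h' ∈ Icc Hm HM, |cstar h - cstar h'| ≤ C*|h-h'|) ∧ (∀ h ∈ Icc Hm HM, 0 < cstar h ∧ cstar h ≤ C) := by
  have hcd : ContDiffOn ℝ 1 cstar (Icc Hm HM) := fun h hh => (cstar_cd h (by linarith [hh.1]) (by linarith [hh.2])).contDiffWithinAt
  obtain ⟨K, hK⟩ := hcd.exists_lipschitzOnWith nn (convex_Icc _ _) isCompact_Icc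
  obtain ⟨B, hB⟩ := isCompact_Icc.exists_bound_of_continuousOn hcd.continuousOn
  refine ⟨K + |B| + 1, po, fun h hh h' hh' => ?_, fun h hh => ⟨?_, ?_⟩⟩
  · have := hK.dist_le_mul h hh h' hh'
    rw [dist_eq, dist_eq] at this
    refine this.trans (lr (by linarith [abs_nonneg B]) (abs_nonneg _))
  · exact sqrt_pos.2 (cs_pos h (by linarith [hh.1]) (by linarith [hh.2]))
  · have := (le_abs_self _).trans ((hB h hh).trans (le_abs_self B))
    linarith
lemma Ah_cont : ContinuousOn Ah (Ioo (1/2) 1) := by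
  intro h hh
  refine (ContinuousAt.mul ?_ fp).continuousWithinAt
  exact (Gam_cd (2*h+1) (by linarith [hh.1])).continuousAt.comp (f := fun h => 2*h+1) fp
lemma sinp_pos (h : ℝ) (h0 : 1/2 < h) : 0 < sin (π/(2*h+1)) :=
  sin_pos_of_pos_of_lt_pi (div_pos pi_pos li) (by rw [div_lt_iff₀ li]; nlinarith [pi_pos])
lemma Gh_cont : ContinuousOn Gh (Ioo (1/2) 1) := by
  have h1 : ContinuousOn (fun h : ℝ => 2*h+1) (Ioo (1/2) 1) := fp
  have h2 : ∀ h ∈ Ioo (1/2:ℝ) 1, 2*h+1 ≠ 0 := fun h hh => by linarith [hh.1]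
  refine ContinuousOn.div (ContinuousOn.rpow Ah_cont (continuousOn_const.div h1 h2) fun h hh => Or.inl (Ah_pos h hh.1 hh.2).ne')
    (continuous_sin.comp_continuousOn (continuousOn_const.div h1 h2)) fun h hh => (sinp_pos h hh.1).ne'
lemma Gh_pos (h : ℝ) (h0 : 1/2 < h) (h1 : h < 1) : 0 < Gh h := div_pos (rpow_pos_of_pos (Ah_pos h h0 h1) _) (sinp_pos h h0)
lemma logp_anti (p : ℝ) (hp : 0 < p) : AntitoneOn (fun x : ℝ => log (1 + x^(-p))) (Ioi 0) := by
  intro x hx y hy hxy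
  have hx : 0 < x := hx; have hy : 0 < y := hy
  have : y^(-p) ≤ x^(-p) := rp hx hxy li
  exact log_le_log po li
lemma sum_up (p c : ℝ) (hp : 1 < p) (hc : 0 < c) (s : Finset ℕ) (hs : ∀ k ∈ s, 1 ≤ k) :
    ∑ k ∈ s, log (1 + (k/c)^(-p)) ≤ c * (π / sin (π/p)) := by
  obtain ⟨i1, i2⟩ := logint p hp
  set f : ℝ → ℝ := fun x => log (1 + x^(-p))
  have hf0 : ∀ x ∈ Ioi ca 0, 0 ≤ f x := fun x hx => log_nonneg (by have : 0 < x := hx; have : 0 < x^(-p) := po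
                                                                   linarith)
  have hd : (s:Set ℕ).PairwiseDisjoint (fun k => Ioc ((ca k-1)/c) (k/c)) := by
    intro a _ b _ hab
    rcases lt_or_gt_of_ne hab with h | h
    · have : ca a + 1 ≤ b := by exact_mod_cast h
      exact Set.disjoint_left.2 fun x hx hx' => by
        have := hx.2.trans (div_le_div_of_nonneg_right (by linarith : ca a ≤ b-1) hc.le)
        linarith [hx'.1]
    · have : ca b + 1 ≤ a := by exact_mod_cast h
      exact Set.disjoint_left.2 fun x hx hx' => by
        have := hx'.2.trans (div_le_div_of_nonneg_right (by linarith : ca b ≤ a-1) hc.le)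
        linarith [hx.1]
  have hsub : ∀ k ∈ s, Ioc ((ca k-1)/c) (k/c) ⊆ Ioi 0 := by
    intro k hk x hx
    have : ca 1 ≤ k := by exact_mod_cast hs k hk
    exact lt_of_le_of_lt (div_nonneg li hc.le) hx.1
  have hsum : ∑ k ∈ s, ∫ x in Ioc ((ca k-1)/c) (k/c), f x ≤ π / sin (π/p) := by
    rw [← integral_biUnion_finset s (fun k _ => measurableSet_Ioc) hd (fun k hk => i1.mono_set (hsub k hk)), ← i2]
    exact setIntegral_mono_set i1 (ae_restrict_of_forall_mem mi hf0) (HasSubset.Subset.eventuallyLE (iUnion₂_subset hsub))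
  refine le_trans ?_ (ll hsum hc.le)
  rw [ms]
  refine Finset.sum_le_sum fun k hk => ?_
  have hk1 : ca 1 ≤ k := by exact_mod_cast hs k hk
  have : ∫ x in Ioc ((ca k-1)/c) (k/c), f (k/c) ≤ ∫ x in Ioc ((ca k-1)/c) (k/c), f x := by
    refine setIntegral_mono_on (integrableOn_const (by simp)) (i1.mono_set (hsub k hk)) measurableSet_Ioc fun x hx => ?_
    exact logp_anti p li (hsub k hk hx) (by simp only [mem_Ioi]; positivity) hx.2
  rw [setIntegral_const, volume_real_Ioc_of_le (by gcongr; linarith), smul_eq_mul, show ca k/c - (k-1)/c = 1/c by ring] at this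
  calc f (k/c) = c * (1/c * f (k/c)) := by field_simp
    _ ≤ _ := ll this hc.le
lemma sum_lo (p c : ℝ) (hp : 1 < p) (hc : 0 < c) (a b : ℕ) (ha : 1 ≤ a) :
    c * ∫ x in Ioc dv a c (b/c), log (1 + x^(-p)) ≤ ∑ k ∈ Finset.Ico a b, log (1 + (k/c)^(-p)) := by
  rcases le_or_gt b a with hab | hab
  · rw [Ioc_eq_empty, Finset.Ico_eq_empty (by omega)]
    · simp
    · have : ca b ≤ a := by exact_mod_cast hab
      exact not_lt.2 (by gcongr)
  have hab' : ca a ≤ b := by exact_mod_cast hab.le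
  have ha' : ca 1 ≤ a := by exact_mod_cast ha
  have h := AntitoneOn.integral_le_sum_Ico (f := fun x : ℝ => log (1 + (x/c)^(-p))) hab.le (by
    intro x hx y hy hxy
    have h1 : 0 < x := by linarith [hx.1]
    have h2 : 0 < y := by linarith
    exact logp_anti p li (show 0 < x/c by positivity) (show 0 < y/c by positivity) (by gcongr))
  rw [intervalIntegral.integral_comp_div (fun x => log (1 + x^(-p))) hc.ne', io (by gcongr)] at h
  exact h
structure Par (Hm HM ε : ℝ) : Prop where
  h1 : 1/2 < Hm
  h2 : Hm ≤ HM
  h3 : HM + 2*ε ≤ 1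
  e0 : 0 < ε
  e1 : ε < Hm - 1/2
  e2 : 8*ε < 1
def Lam (u z : ℝ) : ℝ := log (u*(u-z)/z)
def kq (q u z : ℝ) : ℝ := (u/z)^q * (u-z)^(q-1)
def Maj (Hm ε u z : ℝ) : ℝ := z^(-ε) * (u-z)^(Hm-1/2-ε-1) + z^em ε * (u-z)^(Hm-3*ε-1)
def wa (ε a z : ℝ) : ℝ := |z-a|^em ε + z^em ε
lemma Lam_bd (u z : ℝ) (hz : 0 < z) (hu : z < u) (hu1 : u ≤ 1) : |Lam u z| ≤ -log z - log (u-z) := by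
  have h1 := log_neg hz li
  have h2 : log (u-z) < 0 := log_neg li li
  have h3 := log_nonpos li hu1
  have h4 := log_le_log hz hu.le
  have hd : u - z ≠ 0 := li
  have hu0 : u ≠ 0 := li
  rw [Lam, log_div po hz.ne', log_mul hu0 hd, abs_le]
  constructor <;> linarith
lemma KA {Hm HM ε : ℝ} (P : Par Hm HM ε) (q u z : ℝ) (hq : Hm-1/2 ≤ q) (hq' : q ≤ HM-1/2) (hz : 0 < z) (hu : z < u) (hu1 : u ≤ 1) :
    exp (ε*|Lam u z|) * kq q u z ≤ Maj Hm ε u z := by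
  have := P.e0
  have hd : 0 < u - z := li
  have e1 : exp (ε*|Lam u z|) ≤ z^(-ε) * (u-z)^(-ε) := by
    rw [rpow_def_of_pos hz, rpow_def_of_pos hd, ← exp_add, exp_le_exp]
    nlinarith [Lam_bd u z hz hu hu1]
  have e2 : (u/z)^q ≤ 1 + (u-z)^(1/2-2*ε) * z^(-(1/2-2*ε)) := by
    calc (u/z)^q ≤ (u/z)^(1/2-2*ε) := rl (by rw [le_div_iff₀ hz]; linarith) (by linarith [P.h3])
      _ = (1 + (u-z)/z)^(1/2-2*ε) := by congr 1; field_simp; ring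
      _ ≤ 1^(1/2-2*ε) + ((u-z)/z)^(1/2-2*ε) := rpow_add_le_add_rpow zero_le_one po (by linarith [P.e2]) li
      _ = _ := by rw [one_rpow, div_rpow hd.le hz.le, rpow_neg hz.le, div_eq_mul_inv]
  have e3 : (u-z)^(q-1) ≤ (u-z)^(Hm-1/2-1) := rpow_le_rpow_of_exponent_ge hd li li
  calc _ ≤ (z^(-ε) * (u-z)^(-ε)) * ((1 + (u-z)^(1/2-2*ε) * z^(-(1/2-2*ε))) * (u-z)^(Hm-1/2-1)) := by
        have hu0 : 0 < u := li
        unfold kq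
        exact mul_le_mul e1 (mul_le_mul e2 e3 po po) po po
    _ = Maj Hm ε u z := by
        rw [Maj, show Hm-1/2-ε-1 = (Hm-1/2-1)+(-ε) by ring, show Hm-3*ε-1 = (Hm-1/2-1)+(-ε)+(1/2-2*ε) by ring, show -(1/2-ε) = -ε + -(1/2-2*ε) by ring]
        simp only [rpow_add hd, rpow_add hz]; ring
lemma int_sh (c z b x : ℝ) (hc : 0 < c) : IntegrableOn (fun u : ℝ => (u-z)^(c-1)) (Ioo b x) := by
  rcases le_or_gt b x with h | h
  · have := (intervalIntegral.intervalIntegrable_rpow' (r := c-1) (a := b-z) (b := x-z) li).comp_sub_right z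
    simp only [sub_add_cancel] at this
    exact ((intervalIntegrable_iff_integrableOn_Ioc_of_le h).1 this).mono_set Ioo_subset_Ioc_self
  · rw [Ioo_eq_empty li]; exact integrableOn_empty
lemma int_sh_eq (c b x : ℝ) (hc : 0 < c) (h : b ≤ x) : ∫ u in Ioo b x, (u-b)^(c-1) = (x-b)^c/c := by
  rw [← oo, ← io h, intervalIntegral.integral_comp_sub_right (fun u => u^(c-1)), integral_rpow (Or.inl li), sub_self, zero_rpow li]
  simp
lemma KB1 (c z b x l : ℝ) (hc : 0 < c) (hc1 : c ≤ 1) (hzb : z ≤ b) (hx : x ≤ b+l) (hl : 0 ≤ l) : ∫ u in Ioo b x, (u-z)^(c-1) ≤ l^c/c := by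
  rcases le_or_gt b x with h | h
  · calc _ ≤ ∫ u in Ioo b x, (u-b)^(c-1) := setIntegral_mono_on (int_sh c z b x hc) (int_sh c b b x hc) mo
          fun u hu => rp (by linarith [hu.1]) li li
      _ = (x-b)^c/c := int_sh_eq c b x hc h
      _ ≤ _ := by gcongr; linarith
  · rw [Ioo_eq_empty li]; simp; positivity
lemma KB2 (c t a z x l : ℝ) (hc : 0 < c) (ht : 0 ≤ t) (hct : c + t ≤ 1) (hza : z ≠ a) (hx : x ≤ a+l) (hl : 0 ≤ l) :
    ∫ u in Ioo (max a z) x, (u-z)^(c-1) ≤ l^(c+t) * |z-a|^(-t) / c := by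
  rcases le_or_gt (max a z) x with h | h
  swap
  · rw [Ioo_eq_empty li]; simp; positivity
  rcases lt_or_gt_of_ne hza with h1 | h1
  · have hd : 0 < a - z := li
    rw [max_eq_left h1.le] at *
    rw [abs_of_neg (by linarith : z - a < 0), neg_sub]
    calc ∫ u in Ioo a x, (u-z)^(c-1) ≤ ∫ u in Ioo a x, (a-z)^(-t) * (u-a)^(c+t-1) := by
          refine setIntegral_mono_on (int_sh c z a x hc) ((int_sh (c+t) a a x li).const_mul _) mo fun u hu => ?_
          have hua : 0 < u - a := by linarith [hu.1]
          have huz : 0 < u - z := li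
          calc (u-z)^(c-1) = (u-z)^(-t) * (u-z)^(c+t-1) := by rw [← rpow_add huz]; congr 1; ring
            _ ≤ _ := by
              exact mul_le_mul (rp hd li li) (rp hua li li) po po
      _ = (a-z)^(-t) * ((x-a)^(c+t)/(c+t)) := by rw [im, int_sh_eq _ _ _ li h]
      _ ≤ (a-z)^(-t) * (l^(c+t)/c) := by gcongr <;> linarith
      _ = _ := by ring
  · have hd : 0 < z - a := li
    rw [max_eq_right h1.le] at *
    rw [abs_of_pos hd]
    have hl0 : 0 < l := li
    calc _ ≤ l^c/c := KB1 c z z x l hc li le_rfl li hl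
      _ = l^(c+t) * l^(-t)/c := by rw [← rpow_add hl0]; congr 2; ring
      _ ≤ _ := by
        gcongr 2
        exact rp hd li li
lemma Maj_int {Hm HM ε : ℝ} (P : Par Hm HM ε) (z b x : ℝ) : IntegrableOn (fun u => Maj Hm ε u z) (Ioo b x) := by
  have := P.e1; have := P.e2
  exact ((int_sh _ z b x li).const_mul _).add ((int_sh _ z b x li).const_mul _)
lemma Maj_eq {Hm HM ε : ℝ} (P : Par Hm HM ε) (z b x : ℝ) : ∫ u in Ioo b x, Maj Hm ε u z =
    z^(-ε) * (∫ u in Ioo b x, (u-z)^(Hm-1/2-ε-1)) + z^em ε * ∫ u in Ioo b x, (u-z)^(Hm-3*ε-1) := by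
  have := P.e1; have := P.e2
  unfold Maj
  rw [integral_add ((int_sh _ z b x li).const_mul _) ((int_sh _ z b x li).const_mul _), im, im]
lemma KC {Hm HM ε : ℝ} (P : Par Hm HM ε) (a z x l : ℝ) (hz : 0 < z) (hza : z ≠ a) (hx : x ≤ a + l) (hl : 0 ≤ l) :
    ∫ u in Ioo (max a z) x, Maj Hm ε u z ≤ 2/(Hm-1/2-ε) * (l^(Hm-3*ε) * wa ε a z) := by
  have := P.e0; have := P.e1; have := P.h2; have := P.h3
  have hα : 0 < Hm-1/2-ε := li
  have b1 := KB2 (Hm-1/2-ε) (1/2-2*ε) a z x l hα li li hza hx hl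
  have b2 := KB1 (Hm-3*ε) z (max a z) x l li li (le_max_right _ _) (by linarith [le_max_left a z]) hl
  rw [Maj_eq P]
  rw [show Hm-1/2-ε+(1/2-2*ε) = Hm-3*ε by ring] at b1
  have hw : z^(-ε) * |z-a|^(-(1/2-2*ε)) ≤ wa ε a z := by
    have h0 := abs_pos.2 (sub_ne_zero.2 hza)
    unfold wa
    rcases le_total z |z-a| with h | h
    · have : |z-a|^(-(1/2-2*ε)) ≤ z^(-(1/2-2*ε)) := rp hz h li
      calc _ ≤ z^(-ε) * z^(-(1/2-2*ε)) := by gcongr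
        _ = z^em ε := by rw [← rpow_add hz]; congr 1; ring
        _ ≤ _ := by linarith [rpow_nonneg h0.le em ε]
    · have : z^(-ε) ≤ |z-a|^(-ε) := rp h0 h li
      calc _ ≤ |z-a|^(-ε) * |z-a|^(-(1/2-2*ε)) := by gcongr
        _ = |z-a|^em ε := by rw [← rpow_add h0]; congr 1; ring
        _ ≤ _ := by linarith [rpow_nonneg hz.le em ε]
  have hw2 : z^em ε ≤ wa ε a z := by unfold wa; linarith [rpow_nonneg (abs_nonneg (z-a)) em ε]
  have hE : 0 ≤ l^(Hm-3*ε) := po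
  calc _ ≤ z^(-ε) * (l^(Hm-3*ε) * |z-a|^(-(1/2-2*ε)) / (Hm-1/2-ε)) + z^em ε * (l^(Hm-3*ε)/(Hm-3*ε)) := by gcongr
    _ = l^(Hm-3*ε) * (z^(-ε) * |z-a|^(-(1/2-2*ε))) * (1/(Hm-1/2-ε)) + l^(Hm-3*ε) * z^em ε * (1/(Hm-3*ε)) := by ring
    _ ≤ l^(Hm-3*ε) * wa ε a z * (1/(Hm-1/2-ε)) + l^(Hm-3*ε) * wa ε a z * (1/(Hm-1/2-ε)) := by
      have h1 := one_div_le_one_div_of_le hα (show Hm-1/2-ε ≤ Hm-3*ε by linarith)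
      have h2 : 0 ≤ 1/(Hm-3*ε) := by have : 0 < Hm-3*ε := li
                                     positivity
      have h3 : 0 ≤ wa ε a z := by unfold wa; positivity
      exact add_le_add (lr (ll hw hE) po) (mul_le_mul (ll hw2 hE) h1 h2 po)
    _ = _ := by ring
lemma KD {Hm HM ε : ℝ} (P : Par Hm HM ε) (z y : ℝ) (hz : 0 < z) (hz1 : z ≤ 1) (hy : y ≤ 1) :
    ∫ u in Ioo z y, Maj Hm ε u z ≤ 2/(Hm-1/2-ε) * z^em ε := by
  have := P.e0; have := P.e1; have := P.h2; have := P.h3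
  have hα : 0 < Hm-1/2-ε := li
  have b1 := KB1 (Hm-1/2-ε) z z y 1 hα li le_rfl li zero_le_one
  have b2 := KB1 (Hm-3*ε) z z y 1 li li le_rfl li zero_le_one
  rw [one_rpow] at b1 b2
  rw [Maj_eq P]
  have : z^(-ε) ≤ z^em ε := rpow_le_rpow_of_exponent_ge hz hz1 li
  have h3 : 1/(Hm-3*ε) ≤ 1/(Hm-1/2-ε) := one_div_le_one_div_of_le hα li
  calc _ ≤ z^em ε * (1/(Hm-1/2-ε)) + z^em ε * (1/(Hm-1/2-ε)) := by
        refine add_le_add ((ll b1 po).trans (lr this po)) (ll (b2.trans h3) po)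
    _ = _ := by ring
lemma kq_shift (q t u z : ℝ) (hz : 0 < z) (hu : z < u) : kq (q+t) u z = kq q u z * exp (t * Lam u z) := by
  have hd : 0 < u-z := li
  have h1 := div_pos li hz
  have hu0 : 0 < u := li
  have h5 : 0 < u*(u-z)/z := po
  unfold kq Lam
  rw [show q+t-1 = (q-1)+t by ring, rpow_add h1, rpow_add hd, mul_comm t, ← rpow_def_of_pos h5,
    show u*(u-z)/z = (u/z)*(u-z) by ring, mul_rpow h1.le hd.le]
  ring
lemma pow_exp (ε x : ℝ) (m : ℕ) (hε : 0 < ε) (hx : 0 ≤ x) : x^m ≤ m.factorial * (1/ε)^m * exp (ε*x) := by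
  have := pow_div_factorial_le_exp (ε*x) po m
  have hm : ca 0 < m.factorial := po
  rw [div_le_iff₀ hm, mul_pow] at this
  rw [one_div, inv_pow]
  have : x^m = (ε^m)⁻¹ * (ε^m*x^m) := by field_simp
  rw [this]
  calc _ ≤ (ε^m)⁻¹ * (exp (ε*x) * m.factorial) := by gcongr
    _ = _ := by ring
lemma kq_pos (q u z : ℝ) (hz : 0 < z) (hu : z < u) : 0 ≤ kq q u z := by
  have : 0 ≤ u := li
  unfold kq; positivity
lemma kq_tay {Hm HM ε : ℝ} (P : Par Hm HM ε) (q t u z : ℝ) (M : ℕ) (hq : Hm-1/2 ≤ q) (hq' : q ≤ HM-1/2) (ht : |t| ≤ ε/2) (hz : 0 < z) (hu : z < u) (hu1 : u ≤ 1) :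
    |kq (q+t) u z - ∑ m ∈ rg M, t^m/m.factorial * (Lam u z^m * kq q u z)| ≤ M.factorial * (2/ε)^M * |t|^M * Maj Hm ε u z := by
  have he := P.e0
  have e : kq (q+t) u z - ∑ m ∈ rg M, t^m/m.factorial * (Lam u z^m * kq q u z) = kq q u z * (exp (t * Lam u z) - ∑ m ∈ rg M, (t * Lam u z)^m/m.factorial) := by
    rw [kq_shift q t u z hz hu, mul_sub, ms]; congr 1
    refine sc rfl fun m _ => ?_
    rw [mul_pow]; ring
  have hc := Complex.norm_exp_sub_sum_le_norm_mul_exp ((t * Lam u z : ℝ):ℂ) M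
  have hc' : |exp (t * Lam u z) - ∑ m ∈ rg M, (t * Lam u z)^m/m.factorial| ≤ |t * Lam u z|^M * exp |t * Lam u z| := by
    rw [← na, ← na, ← Complex.norm_real, ← Complex.norm_real]
    convert hc using 2
    push_cast; rfl
  rw [e, abs_mul, abs_of_nonneg (kq_pos q u z hz hu)]
  have h1 := pow_exp (ε/2) |Lam u z| M li (abs_nonneg _)
  have h2 : exp |t * Lam u z| ≤ exp (ε/2*|Lam u z|) := by
    rw [exp_le_exp, abs_mul]; gcongr
  have h3 : exp (ε/2*|Lam u z|) * exp (ε/2*|Lam u z|) = exp (ε*|Lam u z|) := by rw [← exp_add]; congr 1; ring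
  calc _ ≤ kq q u z * (|t|^M * (M.factorial * (1/(ε/2))^M * exp (ε/2*|Lam u z|)) * exp (ε/2*|Lam u z|)) := by
        refine ll (hc'.trans ?_) (kq_pos q u z hz hu)
        rw [abs_mul, mul_pow]; gcongr
    _ = M.factorial * (2/ε)^M * |t|^M * (exp (ε*|Lam u z|) * kq q u z) := by rw [← h3, one_div_div]; ring
    _ ≤ _ := by gcongr; exact KA P q u z hq hq' hz hu hu1
lemma kq_lam {Hm HM ε : ℝ} (P : Par Hm HM ε) (q u z : ℝ) (m : ℕ) (hq : Hm-1/2 ≤ q) (hq' : q ≤ HM-1/2) (hz : 0 < z) (hu : z < u) (hu1 : u ≤ 1) :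
    |Lam u z^m * kq q u z| ≤ m.factorial * (1/ε)^m * Maj Hm ε u z := by
  have he := P.e0
  rw [abs_mul, abs_of_nonneg (kq_pos q u z hz hu), abs_pow]
  calc _ ≤ (m.factorial * (1/ε)^m * exp (ε*|Lam u z|)) * kq q u z := lr (pow_exp ε |Lam u z| m he (abs_nonneg _)) (kq_pos q u z hz hu)
    _ ≤ _ := by rw [mul_assoc]; gcongr; exact KA P q u z hq hq' hz hu hu1
lemma kq_sub (q u z : ℝ) (hq : 0 ≤ q) (hq1 : q ≤ 1) (hz : 0 < z) (hu : z < u) (hu1 : u ≤ 1) :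
    0 ≤ kq q u z - (u-z)^(q-1) ∧ kq q u z - (u-z)^(q-1) ≤ z^(-q) / u := by
  have hd : 0 < u-z := li
  have hu0 : 0 < u := li
  have h1 : ca 1 ≤ (u/z)^q := one_le_rpow (by rw [le_div_iff₀ hz]; linarith) hq
  unfold kq
  constructor
  · have : 0 ≤ (u-z)^(q-1) := po
    nlinarith
  · have h2 : z/u ≤ (z/u)^q := by
      have := rpow_le_rpow_of_exponent_ge (x := z/u) po (by rw [div_le_one hu0]; linarith) hq1
      simpa using this
    have h3 : (u/z)^q - 1 ≤ (u/z)^q * ((u-z)/u) := by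
      have : (u/z)^q * (z/u)^q = 1 := by
        rw [← mul_rpow po po, show u/z*(z/u) = 1 by field_simp, one_rpow]
      have e : (u-z)/u = 1 - z/u := by field_simp
      rw [e]; nlinarith
    have h4 : (u/z)^q * (u-z)^q ≤ z^(-q) := by
      rw [div_rpow hu0.le hz.le, rpow_neg hz.le, div_mul_eq_mul_div, div_eq_mul_inv]
      have := rpow_le_one hu0.le hu1 hq
      have := rpow_le_one hd.le li hq
      have : u^q * (u-z)^q ≤ 1 := mul_le_one₀ (by assumption) po this
      have : 0 ≤ (z^q)⁻¹ := po
      nlinarith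
    calc _ = ((u/z)^q - 1) * (u-z)^(q-1) := by ring
      _ ≤ ((u/z)^q * ((u-z)/u)) * (u-z)^(q-1) := by gcongr
      _ = ((u/z)^q * (u-z)^q) / u := by rw [rpow_sub hd, rpow_one]; field_simp
      _ ≤ _ := by gcongr
structure Ctx (H : ℝ → ℝ) (Hm HM ε r Ch Cc : ℝ) : Prop where
  par : Par Hm HM ε
  cont : Continuous H
  lo : ∀ x, Hm ≤ H x
  hi : ∀ x, H x ≤ HM
  r0 : 0 < r
  Ch0 : 0 < Ch
  hol : ∀ x y, |H x - H y| ≤ Ch * |x-y|^r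
  Cc0 : 0 < Cc
  clip : ∀ x y, |cstar (H x) - cstar (H y)| ≤ Cc * |H x - H y|
  cpos : ∀ x, 0 < cstar (H x) ∧ cstar (H x) ≤ Cc
def an (n : ℕ) (x : ℝ) : ℝ := (⌊ca n*x⌋₊ : ℝ)/n
def KK (H : ℝ → ℝ) (x z : ℝ) : ℝ := Kker x z (H x)
def inc (q a x z : ℝ) : ℝ := ((max (x-z) 0)^q - (max (a-z) 0)^q)/q
def Am (H : ℝ → ℝ) (m : ℕ) (a z : ℝ) : ℝ := ∫ u in Ioo z a, Lam u z^m * kq (H a - 1/2) u z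
def T1 (H : ℝ → ℝ) (n : ℕ) (x z : ℝ) : ℝ := cstar (H (an n x)) * inc (H (an n x) - 1/2) (an n x) x z
def T2 (H : ℝ → ℝ) (n M : ℕ) (x z : ℝ) : ℝ := ∑ m ∈ rg M, cstar (H x) * ((H x - H (an n x))^m/m.factorial) * Am H m (an n x) z
def T3 (H : ℝ → ℝ) (n M : ℕ) (x z : ℝ) : ℝ := KK H x z - T1 H n x z - T2 H n M x z
lemma an_le (n : ℕ) (hn : 1 ≤ n) (x : ℝ) (hx : 0 ≤ x) : an n x ≤ x ∧ x < an n x + 1/n := by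
  have hn0 := c0p hn
  have h1 := Nat.floor_le (show 0 ≤ ca n*x by positivity)
  have h2 := Nat.lt_floor_add_one (ca n*x)
  unfold an
  rw [← add_div, div_le_iff₀ hn0, lt_div_iff₀ hn0]
  constructor <;> linarith
lemma an_nn (n : ℕ) (x : ℝ) : 0 ≤ an n x := by unfold an; positivity
lemma kq_meas (q z : ℝ) : Measurable (fun u => kq q u z) := by unfold kq; fun_prop
lemma Lam_meas (z : ℝ) : Measurable (fun u => Lam u z) := by unfold Lam; fun_prop
lemma lamkq_int {Hm HM ε : ℝ} (P : Par Hm HM ε) (q z b y : ℝ) (m : ℕ) (hq : Hm-1/2 ≤ q) (hq' : q ≤ HM-1/2) (hz : 0 < z) (hb : z ≤ b) (hy : y ≤ 1) :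
    IntegrableOn (fun u => Lam u z^m * kq q u z) (Ioo b y) ∧ |∫ u in Ioo b y, Lam u z^m * kq q u z| ≤ m.factorial * (1/ε)^m * ∫ u in Ioo b y, Maj Hm ε u z := by
  have hI : IntegrableOn (fun u => m.factorial * (1/ε)^m * Maj Hm ε u z) (Ioo b y) := (Maj_int P z b y).const_mul _
  have hb : ∀ u ∈ Ioo b y, ‖Lam u z^m * kq q u z‖ ≤ m.factorial * (1/ε)^m * Maj Hm ε u z := fun u hu =>
    kq_lam P q u z m hq hq' hz (by linarith [hu.1]) (by linarith [hu.2])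
  refine ⟨hI.mono' (((Lam_meas z).pow_const m).mul (kq_meas q z)).aestronglyMeasurable ((ae_restrict_iff' mo).2 (ae_of_all _ hb)), ?_⟩
  rw [← im]
  exact norm_integral_le_of_norm_le hI ((ae_restrict_iff' mo).2 (ae_of_all _ hb))
lemma kq_int {Hm HM ε : ℝ} (P : Par Hm HM ε) (q z b y : ℝ) (hq : Hm-1/2 ≤ q) (hq' : q ≤ HM-1/2) (hz : 0 < z) (hb : z ≤ b) (hy : y ≤ 1) :
    IntegrableOn (fun u => kq q u z) (Ioo b y) ∧ |∫ u in Ioo b y, kq q u z| ≤ ∫ u in Ioo b y, Maj Hm ε u z := by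
  have := lamkq_int P q z b y 0 hq hq' hz hb hy
  simpa using this
lemma kqtay_int {Hm HM ε : ℝ} (P : Par Hm HM ε) (q t z b y : ℝ) (M : ℕ) (hq : Hm-1/2 ≤ q) (hq' : q ≤ HM-1/2) (hqt : Hm-1/2 ≤ q+t) (hqt' : q+t ≤ HM-1/2) (ht : |t| ≤ ε/2) (hz : 0 < z) (hb : z ≤ b) (hy : y ≤ 1) :
    |(∫ u in Ioo b y, kq (q+t) u z) - ∑ m ∈ rg M, t^m/m.factorial * ∫ u in Ioo b y, Lam u z^m * kq q u z| ≤ M.factorial * (2/ε)^M * |t|^M * ∫ u in Ioo b y, Maj Hm ε u z := by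
  have hI := (Maj_int P z b y).const_mul (M.factorial * (2/ε)^M * |t|^M)
  have e : ∑ m ∈ rg M, t^m/m.factorial * ∫ u in Ioo b y, Lam u z^m * kq q u z = ∫ u in Ioo b y, ∑ m ∈ rg M, t^m/m.factorial * (Lam u z^m * kq q u z) := by
    rw [integral_finset_sum (rg M) fun m _ => ((lamkq_int P q z b y m hq hq' hz hb hy).1.const_mul _)]
    exact sc rfl fun m _ => (im _ _).symm
  have hI2 : Integrable (fun u => ∑ m ∈ rg M, t^m/m.factorial * (Lam u z^m * kq q u z)) (volume.restrict (Ioo b y)) := integrable_finset_sum _ fun m _ => ((lamkq_int P q z b y m hq hq' hz hb hy).1.const_mul _)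
  rw [e, ← integral_sub (kq_int P (q+t) z b y hqt hqt' hz hb hy).1 hI2, ← im]
  rw [← na]
  refine norm_integral_le_of_norm_le hI ((ae_restrict_iff' mo).2 (ae_of_all _ fun u hu => ?_))
  exact kq_tay P q t u z M hq hq' ht hz (by linarith [hu.1]) (by linarith [hu.2])
lemma KK_eq (H : ℝ → ℝ) (x z : ℝ) (hz : 0 < z) : KK H x z = cstar (H x) * ∫ u in Ioo z x, kq (H x - 1/2) u z := by
  unfold KK Kker
  split_ifs with h
  · rw [mul_assoc, ← im]; congr 1
    refine sf mo fun u hu => ?_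
    have : 0 < u := by linarith [hu.1]
    simp only [kq]
    rw [div_rpow this.le hz.le, show ca 1/2 - H x = -(H x - 1/2) by ring, rpow_neg hz.le, show H x - 3/2 = H x - 1/2 - 1 by ring]
    ring
  · rw [Ioo_eq_empty (fun h' => h ⟨hz, h'⟩)]; simp
lemma inc_eq (q a x z : ℝ) (hq : 0 < q) (hax : a ≤ x) : inc q a x z = ∫ u in Ioo (max a z) x, (u-z)^(q-1) := by
  rcases le_or_gt x z with h | h
  · rw [Ioo_eq_empty (by simp [h])]; unfold inc
    rw [max_eq_right li, max_eq_right li]; simp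
  · have h1 : max a z ≤ x := max_le hax h.le
    rw [← oo, ← io h1, intervalIntegral.integral_comp_sub_right (fun u => u^(q-1)), integral_rpow (Or.inl li), inc, sub_add_cancel,
      max_eq_left (by linarith : 0 ≤ x - z), show max (a-z) 0 = max a z - z by rw [← max_sub_sub_right]; simp]
lemma Ioo_split (f : ℝ → ℝ) (z a x : ℝ) (ha : a ≤ x) (hzx : z ≤ x) (hf : IntegrableOn f (Ioo z x)) : ∫ u in Ioo z x, f u = (∫ u in Ioo (max a z) x, f u) + ∫ u in Ioo z a, f u := by
  rcases le_or_gt a z with h | h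
  · rw [max_eq_right h, Ioo_eq_empty (a := z) (b := a) li]; simp
  · rw [max_eq_left h.le, add_comm, ← oo, ← oo, ← oo, ← Ioc_union_Ioc_eq_Ioc h.le ha]
    have hf' : IntegrableOn f (Ioc z x) := (integrableOn_Ioc_iff_integrableOn_Ioo).2 hf
    exact setIntegral_union (Ioc_disjoint_Ioc_of_le le_rfl) measurableSet_Ioc (hf'.mono_set (Ioc_subset_Ioc_right ha)) (hf'.mono_set (Ioc_subset_Ioc_left h.le))
lemma qrange {H : ℝ → ℝ} {Hm HM ε r Ch Cc : ℝ} (X : Ctx H Hm HM ε r Ch Cc) (x : ℝ) : Hm - 1/2 ≤ H x - 1/2 ∧ H x - 1/2 ≤ HM - 1/2 := ⟨by linarith [X.lo x], by linarith [X.hi x]⟩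
set_option maxHeartbeats 1000000 in
lemma T3_bd {H : ℝ → ℝ} {Hm HM ε r Ch Cc : ℝ} (X : Ctx H Hm HM ε r Ch Cc) (M : ℕ) : ∃ C > 0, ∀ n : ℕ, 1 ≤ n → Ch * (1/n:ℝ)^r ≤ ε/2 → ∀ x ∈ uI, ∀ z ∈ uI, z ≠ an n x →
    (|T3 H n M x z| ≤ C * ((1/n:ℝ)^(Hm-3*ε) + ((1/n:ℝ)^r)^M) * wa ε (an n x) z) ∧
    ∀ a0 > 0, a0 ≤ an n x → |T3 H n M x z| ≤ C * ((1/n:ℝ)^r*(1/n:ℝ)^(Hm-3*ε) + (1/n:ℝ)/a0 + ((1/n:ℝ)^r)^M) * wa ε (an n x) z := by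
  have P := X.par
  have := P.e0; have := P.e1; have := P.e2; have := P.h1; have := P.h2; have := P.h3
  have hCc := X.Cc0
  have hCh := X.Ch0
  set K1 := Cc*(2/ε*Ch*(2/(Hm-1/2-ε))) + Cc*Ch*(2/(Hm-1/2-ε)) with hK1
  set K2 := Cc*(M.factorial*(2/ε)^M*Ch^M*(2/(Hm-1/2-ε))) with hK2
  set K3 := Cc*(2/(Hm-1/2-ε)) with hK3
  have k1 : 0 < K1 := po
  have k2 : 0 < K2 := po
  have k3 : 0 < K3 := po
  refine ⟨K1 + K2 + K3 + Cc, po, fun n hn hη x hx z hz hza => ?_⟩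
  obtain ⟨ha1, ha2⟩ := an_le n hn x hx.1.le
  have ha0 := an_nn n x
  set a := an n x with ha
  set ℓ : ℝ := 1/n with hℓ
  have hℓ0 : 0 < ℓ := by rw [hℓ]; have : ca 0 < n := by exact_mod_cast hn
                         positivity
  have hℓ1 : ℓ ≤ 1 := by rw [hℓ, div_le_one (by exact_mod_cast hn)]; exact_mod_cast hn
  set η := ℓ^r
  have hη1 : η ≤ 1 := rpow_le_one hℓ0.le hℓ1 X.r0.le
  set E := ℓ^(Hm-3*ε)
  have hE0 : 0 ≤ E := po
  set W := wa ε a z with hW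
  have hW0 : 0 ≤ W := by have := hz.1; rw [hW]; unfold wa; positivity
  have hzW : z^em ε ≤ W := by rw [hW]; unfold wa; linarith [rpow_nonneg (abs_nonneg (z-a)) em ε]
  obtain ⟨q1, q2⟩ := qrange X a
  obtain ⟨q3, q4⟩ := qrange X x
  set q := H a - 1/2 with hq
  set t := H x - H a with ht
  have hqt : H x - 1/2 = q + t := by rw [hq, ht]; ring
  have htb : |t| ≤ Ch*η := (X.hol x a).trans (by
    rw [abs_of_nonneg li]
    have : (x-a)^r ≤ ℓ^r := rpow_le_rpow li li X.r0.le
    gcongr)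
  obtain ⟨cx0, cx1⟩ := X.cpos x
  obtain ⟨ca0, ca1⟩ := X.cpos a
  have hcd : |cstar (H x) - cstar (H a)| ≤ Cc*(Ch*η) := (X.clip x a).trans (by gcongr)
  rw [hqt] at q3 q4
  set R := ∫ u in Ioo (max a z) x, kq q u z with hR
  set N := ∫ u in Ioo (max a z) x, kq (q+t) u z with hN
  set I := inc q a x z with hI
  have hMaj := KC P a z x ℓ hz.1 hza li hℓ0.le
  have hRb : |R| ≤ 2/(Hm-1/2-ε) * (E*W) := (kq_int P q z (max a z) x q1 q2 hz.1 (le_max_right _ _) hx.2.le).2.trans hMaj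
  have hNR : |N - R| ≤ 2/ε*(Ch*η)*(2/(Hm-1/2-ε) * (E*W)) := by
    have := kqtay_int P q t z (max a z) x 1 q1 q2 q3 q4 (htb.trans hη) hz.1 (le_max_right _ _) hx.2.le
    simp only [Finset.range_one, Finset.sum_singleton, pow_zero, Nat.factorial, pow_one, one_mul, Nat.cast_one, div_one, mul_one] at this
    refine this.trans ?_
    have hM0 : 0 ≤ ∫ u in Ioo (max a z) x, Maj Hm ε u z := (abs_nonneg _).trans (kq_int P q z (max a z) x q1 q2 hz.1 (le_max_right _ _) hx.2.le).2
    gcongr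
  have hRI : 0 ≤ R - I ∧ R - I ≤ |R| ∧ ∀ a0 > 0, a0 ≤ a → R - I ≤ ℓ/a0*W := by
    rw [hI, inc_eq q a x z li ha1]
    have i1 := (kq_int P q z (max a z) x q1 q2 hz.1 (le_max_right _ _) hx.2.le).1
    have i2 := int_sh q z (max a z) x li
    have hks : ∀ u ∈ Ioo (max a z) x, _ := fun u hu => kq_sub q u z li li hz.1 (lt_of_le_of_lt (le_max_right a z) hu.1) (by linarith [hu.2, hx.2])
    have hnn : 0 ≤ ∫ u in Ioo (max a z) x, (u-z)^(q-1) := setIntegral_nonneg mo fun u hu => rpow_nonneg (by linarith [hu.1, le_max_right a z]) _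
    refine ⟨?_, ?_, fun a0 h0 h1 => ?_⟩
    · rw [hR, ← integral_sub i1 i2]
      exact setIntegral_nonneg mo fun u hu => (hks u hu).1
    · linarith [le_abs_self R]
    · rw [hR, ← integral_sub i1 i2]
      have hc : IntegrableOn (fun _ : ℝ => z^(-q)/a0) (Ioo (max a z) x) := by simp
      have h5 := setIntegral_mono_on (i1.sub i2) hc mo fun u hu => (hks u hu).2.trans (by
        have : a0 ≤ u := by linarith [hu.1, le_max_left a z]
        have := hz.1
        gcongr)
      refine h5.trans ?_
      rw [setIntegral_const, smul_eq_mul, Measure.real, volume_Ioo]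
      have h6 : (ENNReal.ofReal (x - max a z)).toReal ≤ ℓ := by
        rcases le_total (x - max a z) 0 with h | h
        · rw [ENNReal.ofReal_of_nonpos h]; simpa using hℓ0.le
        · rw [ENNReal.toReal_ofReal h]; linarith [le_max_left a z]
      have h7 : z^(-q) ≤ W := le_trans (rpow_le_rpow_of_exponent_ge hz.1 hz.2.le li) hzW
      calc _ ≤ ℓ * (W/a0) := by have := hz.1; gcongr
        _ = _ := by ring
  have hPast : |(∫ u in Ioo z a, kq (q+t) u z) - ∑ m ∈ rg M, t^m/m.factorial * ∫ u in Ioo z a, Lam u z^m * kq q u z| ≤ M.factorial*(2/ε)^M*Ch^M*(2/(Hm-1/2-ε))*(η^M*W) := by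
    refine (kqtay_int P q t z z a M q1 q2 q3 q4 (htb.trans hη) hz.1 le_rfl (by linarith [hx.2])).trans ?_
    calc _ ≤ M.factorial*(2/ε)^M*(Ch*η)^M*(2/(Hm-1/2-ε)*W) := by
          have := (KD P z a hz.1 hz.2.le (by linarith [hx.2])).trans (ll hzW (by positivity : 0 ≤ 2/(Hm-1/2-ε)))
          have hM0 : 0 ≤ ∫ u in Ioo z a, Maj Hm ε u z := (abs_nonneg _).trans (kq_int P q z z a q1 q2 hz.1 le_rfl (by linarith [hx.2])).2
          gcongr
      _ = _ := by rw [mul_pow]; ring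
  have hT : T3 H n M x z = cstar (H x) * (N-R) + (cstar (H x) - cstar (H a))*R + cstar (H a) * (R-I) + cstar (H x) * ((∫ u in Ioo z a, kq (q+t) u z) - ∑ m ∈ rg M, t^m/m.factorial * ∫ u in Ioo z a, Lam u z^m * kq q u z) := by
    have e1 : ∫ u in Ioo z x, kq (q+t) u z = N + ∫ u in Ioo z a, kq (q+t) u z := by
      rcases le_or_gt z x with h | h
      · exact Ioo_split _ z a x ha1 h (kq_int P (q+t) z z x q3 q4 hz.1 le_rfl hx.2.le).1
      · rw [hN, Ioo_eq_empty (a := z) li, Ioo_eq_empty (a := max a z) (by simp [h.le]), Ioo_eq_empty (a := z) li]; simp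
    unfold T3 T1 T2
    rw [KK_eq H x z hz.1, hqt, e1, ← ha, ← hq, ← hI]
    simp only [Am, mul_assoc]
    rw [← ms, ← ht]; ring
  have hmain : ∀ Q, R - I ≤ Q → |T3 H n M x z| ≤ K1*(η*E*W) + K2*(η^M*W) + Cc*Q := by
    intro Q hQ
    rw [hT]
    refine (abs_add_le _ _).trans ?_
    refine (add_le_add (abs_add_three _ _ _) le_rfl).trans ?_
    rw [abs_mul, abs_mul, abs_mul, abs_mul, abs_of_pos cx0, abs_of_pos ca0, abs_of_nonneg hRI.1]
    calc _ ≤ Cc * (2/ε*(Ch*η)*(2/(Hm-1/2-ε) * (E*W))) + Cc*(Ch*η)*(2/(Hm-1/2-ε) * (E*W)) + Cc * Q + Cc * (M.factorial*(2/ε)^M*Ch^M*(2/(Hm-1/2-ε))*(η^M*W)) := by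
          have := hRI.1
          gcongr
      _ = _ := by rw [hK1, hK2]; ring
  constructor
  · have h := hmain _ (hRI.2.1.trans hRb)
    have e : Cc*(2/(Hm-1/2-ε)*(E*W)) = K3*(E*W) := by rw [hK3]; ring
    have h1 : η*E*W ≤ E*W := by have := mul_nonneg hE0 hW0; nlinarith
    have h2 : 0 ≤ E*W := po
    have h3 : 0 ≤ η^M*W := po
    rw [e] at h
    linarith [ll h1 k1.le, mul_nonneg k1.le h3, mul_nonneg k2.le h2, mul_nonneg k3.le h3, mul_nonneg hCc.le h2, mul_nonneg hCc.le h3]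
  · intro a0 h0 h1
    have h := hmain _ (hRI.2.2 a0 h0 h1)
    have h2 : 0 ≤ η*E*W := po
    have h3 : 0 ≤ η^M*W := po
    have h4 : 0 ≤ ℓ/a0*W := po
    linarith [mul_nonneg k1.le h3, mul_nonneg k1.le h4, mul_nonneg k2.le h2, mul_nonneg k2.le h4, mul_nonneg k3.le h3, mul_nonneg k3.le h2, mul_nonneg k3.le h4, mul_nonneg hCc.le h2, mul_nonneg hCc.le h3]
section
abbrev nu : Measure ℝ := volume.restrict (uI)
abbrev EE := Lp ℝ 2 nu
open Classical in
def toE (f : ℝ → ℝ) : EE := if h : MemLp f 2 nu then h.toLp f else 0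
lemma toE_coe {f : ℝ → ℝ} (h : MemLp f 2 nu) : (toE f : ℝ → ℝ) =ᵐ[nu] f := by
  unfold toE; rw [dif_pos h]; exact h.coeFn_toLp
lemma inner_EE (f g : EE) : inner ℝ f g = ∫ x, f x * g x ∂nu := by
  rw [MeasureTheory.L2.inner_def]
  simp [mul_comm]
lemma toE_inner {f g : ℝ → ℝ} (hf : MemLp f 2 nu) (hg : MemLp g 2 nu) : inner ℝ (toE f) (toE g) = ∫ x, f x * g x ∂nu := by
  rw [inner_EE]
  refine integral_congr_ae ?_
  filter_upwards [toE_coe hf, toE_coe hg] with x h1 h2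
  rw [h1, h2]
lemma toE_norm {f : ℝ → ℝ} (hf : MemLp f 2 nu) : ‖toE f‖^2 = ∫ x, f x^2 ∂nu := by
  rw [← real_inner_self_eq_norm_sq, toE_inner hf hf]; simp [sq]
lemma toE_congr {f g : ℝ → ℝ} (hf : MemLp f 2 nu) (h : f =ᵐ[nu] g) : toE f = toE g := by
  have hg := hf.ae_eq h
  apply Lp.ext; exact (toE_coe hf).trans (h.trans (toE_coe hg).symm)
lemma toE_add {f g : ℝ → ℝ} (hf : MemLp f 2 nu) (hg : MemLp g 2 nu) : toE (fun x => f x + g x) = toE f + toE g := by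
  apply Lp.ext
  filter_upwards [toE_coe (hf.add hg), toE_coe hf, toE_coe hg, Lp.coeFn_add (toE f) (toE g)] with x h1 h2 h3 h4
  rw [h4, Pi.add_apply, h2, h3]; exact h1
lemma toE_smul {f : ℝ → ℝ} (c : ℝ) (hf : MemLp f 2 nu) : toE (fun x => c * f x) = c • toE f := by
  apply Lp.ext
  filter_upwards [toE_coe (hf.const_mul c), toE_coe hf, Lp.coeFn_smul c (toE f)] with x h1 h2 h4
  rw [h4, Pi.smul_apply, h2]; exact h1
lemma toE_sum {ι : Type*} (s : Finset ι) (c : ι → ℝ) (f : ι → ℝ → ℝ) (hf : ∀ i ∈ s, MemLp (f i) 2 nu) : toE (fun x => ∑ i ∈ s, c i * f i x) = ∑ i ∈ s, c i • toE (f i) := by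
  classical
  induction s using Finset.induction_on with
  | empty =>
    simp only [Finset.sum_empty]
    apply Lp.ext
    filter_upwards [toE_coe (f := fun _ => ca 0) MemLp.zero, Lp.coeFn_zero ℝ 2 nu] with x h1 h2
    rw [h1, h2]; rfl
  | insert a s ha ih =>
    simp only [Finset.sum_insert ha]
    rw [← ih fun i hi => hf i (Finset.mem_insert_of_mem hi), ← toE_smul _ (hf a (Finset.mem_insert_self _ _))]
    exact toE_add ((hf a (Finset.mem_insert_self _ _)).const_mul _) (memLp_finset_sum s fun i hi => (hf i (Finset.mem_insert_of_mem hi)).const_mul _)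
lemma zs_mem (ε : ℝ) (hε : 0 < ε) : MemLp (fun z : ℝ => z^em ε) 2 nu := by
  rw [memLp_two_iff_integrable_sq fp]
  refine ((rp_int (2*ε-1) 1 li zero_le_one).1).congr_fun (fun z hz => ?_) mo
  simp only
  rw [← rpow_natCast, ← rpow_mul hz.1.le]; congr 1; push_cast; ring
structure Ker (ε : ℝ) (k : ℝ → ℝ → ℝ) : Prop where
  e0 : 0 < ε
  meas : Measurable (fun p : ℝ × ℝ => k p.1 p.2)
  bd : ∃ C : ℝ, 0 ≤ C ∧ ∀ x ∈ uI, ∀ z ∈ uI, |k x z| ≤ C * z^em ε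
lemma Ker.add {ε : ℝ} {k k' : ℝ → ℝ → ℝ} (h : Ker ε k) (h' : Ker ε k') : Ker ε (fun x z => k x z + k' x z) := by
  obtain ⟨C, c0, hC⟩ := h.bd
  obtain ⟨C', c0', hC'⟩ := h'.bd
  refine ⟨h.e0, h.meas.add h'.meas, C+C', po, fun x hx z hz => (abs_add_le _ _).trans ?_⟩
  linarith [hC x hx z hz, hC' x hx z hz]
lemma Ker.neg {ε : ℝ} {k : ℝ → ℝ → ℝ} (h : Ker ε k) : Ker ε (fun x z => - k x z) := by
  obtain ⟨C, c0, hC⟩ := h.bd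
  exact ⟨h.e0, h.meas.neg, C, c0, fun x hx z hz => by rw [abs_neg]; exact hC x hx z hz⟩
lemma ae_nu {p : ℝ → Prop} (h : ∀ x ∈ uI, p x) : ∀ᵐ x ∂nu, p x := (ae_restrict_iff' mo).2 (ae_of_all _ h)
lemma ae_nu2 {p : ℝ × ℝ → Prop} (h : ∀ x ∈ uI, ∀ z ∈ uI, p (x,z)) : ∀ᵐ x ∂(nu.prod nu), p x := by
  rw [Measure.prod_restrict]
  exact (ae_restrict_iff' (measurableSet_Ioo.prod mo)).2 (ae_of_all _ fun y hy => h _ hy.1 _ hy.2)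
def KO (k : ℝ → ℝ → ℝ) (e : ℝ → ℝ) (z : ℝ) : ℝ := ∫ x, k x z * e x ∂nu
def BM (e : ℝ → ℝ) : Prop := Measurable e ∧ ∃ B : ℝ, 0 ≤ B ∧ ∀ x, |e x| ≤ B
lemma BM.mem {e : ℝ → ℝ} (h : BM e) : MemLp e 2 nu := by
  obtain ⟨hm, B, _, hB⟩ := h
  exact MemLp.of_bound hm.aestronglyMeasurable B (ae_of_all _ hB)
lemma Ker.sec {ε : ℝ} {k : ℝ → ℝ → ℝ} (h : Ker ε k) {z : ℝ} (hz : z ∈ uI) : MemLp (fun x => k x z) 2 nu := by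
  obtain ⟨C, c0, hC⟩ := h.bd
  exact MemLp.of_bound (h.meas.comp (measurable_id.prodMk measurable_const)).aestronglyMeasurable (C * z^em ε) (ae_nu fun x hx => hC x hx z hz)
lemma KO_meas {ε : ℝ} {k : ℝ → ℝ → ℝ} (h : Ker ε k) {e : ℝ → ℝ} (he : BM e) : Measurable (KO k e) := by
  have : StronglyMeasurable (fun p : ℝ × ℝ => k p.2 p.1 * e p.2) := ((h.meas.comp (measurable_snd.prodMk measurable_fst)).mul (he.1.comp measurable_snd)).stronglyMeasurable
  exact (this.integral_prod_right' (ν := nu)).measurable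
lemma KO_bd {ε : ℝ} {k : ℝ → ℝ → ℝ} (h : Ker ε k) {e : ℝ → ℝ} (he : BM e) : ∃ C : ℝ, 0 ≤ C ∧ ∀ z ∈ uI, |KO k e z| ≤ C * z^em ε := by
  obtain ⟨C, c0, hC⟩ := h.bd
  obtain ⟨hm, B, b0, hB⟩ := he
  refine ⟨C*B, po, fun z hz => ?_⟩
  have := norm_integral_le_of_norm_le_const (μ := nu) (f := fun x => k x z * e x) (C := C*B*z^em ε) (ae_nu fun x hx => by
    rw [norm_mul, na, na]
    calc _ ≤ (C * z^em ε) * B := mul_le_mul (hC x hx z hz) (hB x) (abs_nonneg _) (mul_nonneg c0 (rpow_nonneg hz.1.le _))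
      _ = _ := by ring)
  simpa [KO, Measure.real] using this
lemma mem_zs {ε : ℝ} (hε : 0 < ε) {g : ℝ → ℝ} (hm : Measurable g) (C : ℝ) (hC : ∀ z ∈ uI, |g z| ≤ C * z^em ε) : MemLp g 2 nu :=
  ((zs_mem ε hε).const_mul C).mono' hm.aestronglyMeasurable (ae_nu hC)
lemma KO_mem {ε : ℝ} {k : ℝ → ℝ → ℝ} (h : Ker ε k) {e : ℝ → ℝ} (he : BM e) : MemLp (KO k e) 2 nu := by
  obtain ⟨C, c0, hC⟩ := KO_bd h he
  exact mem_zs h.e0 (KO_meas h he) C hC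
lemma KO_add {ε : ℝ} {k k' : ℝ → ℝ → ℝ} (h : Ker ε k) (h' : Ker ε k') {e : ℝ → ℝ} (he : BM e) : toE (KO (fun x z => k x z + k' x z) e) = toE (KO k e) + toE (KO k' e) := by
  rw [← toE_add (KO_mem h he) (KO_mem h' he)]
  refine toE_congr (KO_mem (h.add h') he) (ae_nu fun z hz => ?_)
  simp only [KO, add_mul]
  exact integral_add ((h.sec hz).integrable_mul he.mem) ((h'.sec hz).integrable_mul he.mem)
lemma prod_bd {ε : ℝ} (hε : 0 < ε) {F : ℝ × ℝ → ℝ} (hF : Measurable F) {g : ℝ → ℝ} (hg : Integrable g nu) (C : ℝ) (hb : ∀ x ∈ uI, ∀ z ∈ uI, |F (x,z)| ≤ C * (g x * (z^em ε)^2)) : Integrable F (nu.prod nu) := by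
  have h1 : Integrable (fun p : ℝ × ℝ => g p.1 * (p.2^em ε)^2) (nu.prod nu) := hg.mul_prod (zs_mem ε hε).integrable_sq
  exact (h1.const_mul C).mono' hF.aestronglyMeasurable (ae_nu2 hb)
lemma KO_cov {ε : ℝ} {k : ℝ → ℝ → ℝ} (h : Ker ε k) {u v : ℝ → ℝ} (hu : BM u) (hv : BM v) :
    ∫ x, ∫ y, (∫ z, k x z * k y z ∂nu) * u x * v y ∂nu ∂nu = inner ℝ (toE (KO k u)) (toE (KO k v)) := by
  rw [toE_inner (KO_mem h hu) (KO_mem h hv)]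
  obtain ⟨C, c0, hC⟩ := h.bd
  obtain ⟨D, d0, hD⟩ := KO_bd h hv
  obtain ⟨Bv, bv0, hBv⟩ := hv.2
  obtain ⟨Bu, bu0, hBu⟩ := hu.2
  have h1 : ∀ x ∈ uI, ∫ y, (∫ z, k x z * k y z ∂nu) * u x * v y ∂nu = ∫ z, k x z * u x * KO k v z ∂nu := by
    intro x hx
    have e1 : ∀ y, (∫ z, k x z * k y z ∂nu) * u x * v y = ∫ z, k x z * k y z * u x * v y ∂nu := fun y => by
      rw [integral_mul_const, integral_mul_const]
    simp_rw [e1]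
    rw [integral_integral_swap]
    · refine integral_congr_ae (ae_nu fun z _ => ?_)
      simp only [KO]
      rw [← im]
      refine integral_congr_ae (ae_of_all _ fun y => ?_)
      simp only; ring
    · have hm : Measurable (fun p : ℝ × ℝ => k x p.2 * k p.1 p.2 * u x * v p.1) := (((h.meas.comp (measurable_const.prodMk measurable_snd)).mul h.meas).mul_const _).mul (hv.1.comp measurable_fst)
      refine prod_bd h.e0 hm (g := fun _ => ca 1) (integrable_const _) (C*C*Bu*Bv) fun y hy z hz => ?_
      have z0 : 0 ≤ z^em ε := rpow_nonneg hz.1.le _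
      rw [Function.uncurry_apply_pair, abs_mul, abs_mul, abs_mul]
      calc _ ≤ (C * z^em ε) * (C * z^em ε) * Bu * Bv := by
            gcongr
            · exact hC x hx z hz
            · exact hC y hy z hz
            · exact hBu x
            · exact hBv y
        _ = _ := by ring
  rw [integral_congr_ae (ae_nu h1), integral_integral_swap]
  · refine integral_congr_ae (ae_of_all _ fun z => ?_)
    simp only [KO]
    rw [integral_mul_const]
  · have hm : Measurable (fun p : ℝ × ℝ => k p.1 p.2 * u p.1 * KO k v p.2) := (h.meas.mul (hu.1.comp measurable_fst)).mul ((KO_meas h hv).comp measurable_snd)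
    refine prod_bd h.e0 hm (g := fun _ => ca 1) (integrable_const _) (C*D*Bu) fun y hy z hz => ?_
    have z0 : 0 ≤ z^em ε := rpow_nonneg hz.1.le _
    rw [Function.uncurry_apply_pair, abs_mul, abs_mul]
    calc _ ≤ (C * z^em ε) * Bu * (D * z^em ε) := by
          gcongr
          · exact hC y hy z hz
          · exact hBu y
          · exact hD z hz
      _ = _ := by ring
lemma bessel {ι : Type*} (s : Finset ι) (e : ι → ℝ → ℝ) (he : ∀ i, MemLp (e i) 2 nu) (ho : Orthonormal ℝ fun i => toE (e i)) {f : ℝ → ℝ} (hf : MemLp f 2 nu) :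
    ∑ i ∈ s, (∫ x, f x * e i x ∂nu)^2 ≤ ∫ x, f x^2 ∂nu := by
  have := ho.sum_inner_products_le (toE f) (s := s)
  rw [toE_norm hf] at this
  convert this using 2 with i hi
  rw [toE_inner (he i) hf, na, sq_abs]; simp_rw [mul_comm (f _)]
lemma Ker.sq_int {ε : ℝ} {k : ℝ → ℝ → ℝ} (h : Ker ε k) : Integrable (fun p : ℝ × ℝ => k p.1 p.2^2) (nu.prod nu) := by
  obtain ⟨C, c0, hC⟩ := h.bd
  refine prod_bd h.e0 (h.meas.pow_const 2) (g := fun _ => ca 1) (integrable_const _) (C^2) fun y hy z hz => ?_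
  rw [abs_pow, one_mul, ← mul_pow]
  exact pow_le_pow_left₀ (abs_nonneg _) (hC y hy z hz) 2
lemma HS {ι : Type*} (s : Finset ι) (e : ι → ℝ → ℝ) (he : ∀ i, BM (e i)) (ho : Orthonormal ℝ fun i => toE (e i)) {ε : ℝ} {k : ℝ → ℝ → ℝ} (h : Ker ε k) :
    ∑ i ∈ s, ‖toE (KO k (e i))‖^2 ≤ ∫ x, ∫ z, k x z^2 ∂nu ∂nu := by
  have h2 : Integrable (fun p : ℝ × ℝ => k p.2 p.1^2) (nu.prod nu) := h.sq_int.swap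
  rw [integral_integral_swap h.sq_int]
  simp_rw [fun i => toE_norm (KO_mem h (he i))]
  rw [← integral_finset_sum _ fun i _ => (KO_mem h (he i)).integrable_sq]
  refine integral_mono_ae (integrable_finset_sum _ fun i _ => (KO_mem h (he i)).integrable_sq) h2.integral_prod_left (ae_nu fun z hz => ?_)
  exact bessel s e (fun i => (he i).mem) ho (h.sec hz)
end
section
lemma meas_int (F : (ℝ × ℝ) × ℝ → ℝ) (hF : Measurable F) (lo hi : ℝ × ℝ → ℝ) (hl : Measurable lo) (hh : Measurable hi) :
    Measurable (fun p : ℝ × ℝ => ∫ u in Ioo (lo p) (hi p), F (p,u)) := by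
  have hS : MeasurableSet {y : (ℝ × ℝ) × ℝ | lo y.1 < y.2 ∧ y.2 < hi y.1} :=
    (measurableSet_lt (hl.comp measurable_fst) measurable_snd).inter (measurableSet_lt measurable_snd (hh.comp measurable_fst))
  have h2 : StronglyMeasurable (indicator {y : (ℝ × ℝ) × ℝ | lo y.1 < y.2 ∧ y.2 < hi y.1} F) := (hF.indicator hS).stronglyMeasurable
  have := (h2.integral_prod_right' (ν := volume)).measurable
  convert this using 2 with p
  rw [← integral_indicator mo]
  rfl
section
variable {H : ℝ → ℝ} {Hm HM ε r Ch Cc : ℝ}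
lemma cst_cont (X : Ctx H Hm HM ε r Ch Cc) : Continuous (fun x => cstar (H x)) := by
  have hC := X.cont
  rw [continuous_iff_continuousAt] at hC ⊢
  intro x
  unfold ContinuousAt
  rw [tendsto_iff_dist_tendsto_zero]
  have h1 : Tendsto (fun y => Cc * dist (H y) (H x)) (nhds x) (nhds (Cc*0)) := (tendsto_iff_dist_tendsto_zero.1 (hC x)).const_mul _
  rw [mul_zero] at h1
  exact squeeze_zero (fun _ => dist_nonneg) (fun y => X.clip y x) h1
lemma an_meas (n : ℕ) : Measurable (an n) := by
  unfold an
  exact ((measurable_from_nat (f := fun k : ℕ => ca k)).comp (Nat.measurable_floor.comp (measurable_const.mul measurable_id))).div_const _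
lemma Am_meas' (X : Ctx H Hm HM ε r Ch Cc) (m : ℕ) (b : ℝ → ℝ) (hb : Measurable b) : Measurable (fun p : ℝ × ℝ => Am H m (b p.1) p.2) := by
  have hH := X.cont.measurable
  have : Measurable (fun y : (ℝ × ℝ) × ℝ => Lam y.2 y.1.2^m * kq (H (b y.1.1) - 1/2) y.2 y.1.2) := by
    unfold Lam kq; fun_prop
  exact meas_int _ this (fun p => p.2) (fun p => b p.1) measurable_snd (hb.comp measurable_fst)
lemma Am_bd (X : Ctx H Hm HM ε r Ch Cc) (m : ℕ) (a z : ℝ) (hz : z ∈ uI) (ha : a ≤ 1) : |Am H m a z| ≤ m.factorial * (1/ε)^m * (2/(Hm-1/2-ε)) * z^em ε := by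
  have P := X.par; have := P.e0
  rw [mul_assoc]
  exact (lamkq_int P (H a - 1/2) z z a m (qrange X a).1 (qrange X a).2 hz.1 le_rfl ha).2.trans (ll (KD P z a hz.1 hz.2.le ha) po)
lemma KK_ker (X : Ctx H Hm HM ε r Ch Cc) : Ker ε (KK H) := by
  have P := X.par; have := P.e0; have := P.e1
  have hCc := X.Cc0
  have hH := X.cont.measurable
  refine ⟨P.e0, ?_, Cc*(2/(Hm-1/2-ε)), po, fun x hx z hz => ?_⟩
  · unfold KK Kker
    refine Measurable.ite ((measurableSet_lt measurable_const measurable_snd).inter (measurableSet_lt measurable_snd measurable_fst)) ?_ measurable_const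
    refine Measurable.mul (((cst_cont X).measurable.comp measurable_fst).mul fp) ?_
    have : Measurable (fun y : (ℝ × ℝ) × ℝ => (y.2 - y.1.2)^(H y.1.1 - 3/2) * y.2^(H y.1.1 - 1/2)) := fp
    exact meas_int _ this (fun p => p.2) (fun p => p.1) measurable_snd measurable_fst
  · rw [KK_eq H x z hz.1, abs_mul, abs_of_pos (X.cpos x).1, mul_assoc]
    exact mul_le_mul (X.cpos x).2 ((kq_int P _ z z x (qrange X x).1 (qrange X x).2 hz.1 le_rfl hx.2.le).2.trans (KD P z x hz.1 hz.2.le hx.2.le)) (abs_nonneg _) hCc.le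
lemma an_le1 (n : ℕ) (hn : 1 ≤ n) (x : ℝ) (hx : x ∈ uI) : an n x ≤ 1 := by linarith [(an_le n hn x hx.1.le).1, hx.2]
lemma T1_bd (X : Ctx H Hm HM ε r Ch Cc) (n : ℕ) (hn : 1 ≤ n) (x z : ℝ) (hx : x ∈ uI) (hz : z ∈ uI) : |T1 H n x z| ≤ Cc/(Hm-1/2) := by
  have P := X.par
  have h0 : 0 < Hm - 1/2 := by linarith [P.h1]
  have hCc := X.Cc0
  have := (an_le n hn x hx.1.le).1
  have ha := an_nn n x
  unfold T1
  set a := an n x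
  obtain ⟨q1, q2⟩ := qrange X a
  have hq : 0 < H a - 1/2 := li
  rw [abs_mul, abs_of_pos (X.cpos a).1]
  unfold inc
  have m1 : max (x-z) 0 ≤ 1 := max_le (by linarith [hx.2, hz.1]) zero_le_one
  have h1 : (max (x-z) 0)^(H a - 1/2) ≤ 1 := rpow_le_one (le_max_right _ _) m1 hq.le
  have h2 : (max (a-z) 0)^(H a - 1/2) ≤ (max (x-z) 0)^(H a - 1/2) := rpow_le_rpow (le_max_right _ _) (max_le_max li le_rfl) hq.le
  have h3 : 0 ≤ (max (a-z) 0)^(H a - 1/2) := rpow_nonneg (le_max_right _ _) _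
  rw [abs_div, abs_of_pos hq, abs_of_nonneg li, mul_div_assoc']
  gcongr
  calc _ ≤ Cc*1 := mul_le_mul (X.cpos a).2 li li hCc.le
    _ = _ := mul_one _
lemma one_zs {ε z : ℝ} (hz : z ∈ uI) (he : ε < 1/2) : 1 ≤ z^em ε := one_le_rpow_of_pos_of_le_one_of_nonpos hz.1 hz.2.le li
lemma T1_ker (X : Ctx H Hm HM ε r Ch Cc) (n : ℕ) (hn : 1 ≤ n) : Ker ε (T1 H n) := by
  have P := X.par
  have h0 : 0 < Hm - 1/2 := by linarith [P.h1]
  have hCc := X.Cc0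
  have hH := X.cont.measurable
  have ha := an_meas n
  refine ⟨P.e0, ?_, Cc/(Hm-1/2), po, fun x hx z hz => (T1_bd X n hn x z hx hz).trans ?_⟩
  · unfold T1 inc
    exact ((cst_cont X).measurable.comp (ha.comp measurable_fst)).mul fp
  · have := one_zs hz (by linarith [P.e2] : ε < 1/2)
    have h3 : 0 ≤ Cc/(Hm-1/2) := po
    nlinarith
lemma tb (X : Ctx H Hm HM ε r Ch Cc) (x y : ℝ) : |H x - H y| ≤ 1 := by
  have := X.par.h1; have := X.par.h3; have := X.par.e0
  rw [abs_le]; constructor <;> linarith [X.lo x, X.lo y, X.hi x, X.hi y]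
lemma fm_bd (X : Ctx H Hm HM ε r Ch Cc) (x y : ℝ) (m : ℕ) : |cstar (H x) * ((H x - H y)^m/m.factorial)| ≤ Cc := by
  rw [abs_mul, abs_of_pos (X.cpos x).1, abs_div, abs_pow, Nat.abs_cast]
  have h1 : |H x - H y|^m ≤ 1 := pow_le_one₀ (abs_nonneg _) (tb X x y)
  have h2 : ca 1 ≤ m.factorial := by exact_mod_cast Nat.one_le_iff_ne_zero.2 (Nat.factorial_ne_zero m)
  have h3 : |H x - H y|^m/m.factorial ≤ 1 := div_le_one_of_le₀ (h1.trans h2) po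
  calc _ ≤ Cc*1 := mul_le_mul (X.cpos x).2 h3 po X.Cc0.le
    _ = _ := mul_one _
lemma T2_ker (X : Ctx H Hm HM ε r Ch Cc) (n M : ℕ) (hn : 1 ≤ n) : Ker ε (T2 H n M) := by
  have P := X.par; have := P.e0; have := P.e1
  have hCc := X.Cc0
  have hH := X.cont.measurable
  have ha := an_meas n
  refine ⟨P.e0, ?_, ∑ m ∈ rg M, Cc * (m.factorial * (1/ε)^m * (2/(Hm-1/2-ε))), Finset.sum_nonneg fun m _ => po, fun x hx z hz => ?_⟩
  · unfold T2
    refine Finset.measurable_sum _ fun m _ => Measurable.mul (((cst_cont X).measurable.comp measurable_fst).mul fp) (Am_meas' X m _ ha)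
  · unfold T2
    rw [Finset.sum_mul]
    refine (Finset.abs_sum_le_sum_abs _ _).trans (Finset.sum_le_sum fun m _ => ?_)
    rw [abs_mul, mul_assoc]
    exact mul_le_mul (fm_bd X _ _ _) (Am_bd X m _ z hz (an_le1 n hn x hx)) (abs_nonneg _) hCc.le
lemma T3_ker (X : Ctx H Hm HM ε r Ch Cc) (n M : ℕ) (hn : 1 ≤ n) : Ker ε (T3 H n M) := by
  convert ((KK_ker X).add (T1_ker X n hn).neg).add (T2_ker X n M hn).neg using 3
  unfold T3; ring
lemma KK_split (H : ℝ → ℝ) (n M : ℕ) : KK H = fun x z => (T1 H n x z + T2 H n M x z) + T3 H n M x z := by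
  funext x z; unfold T3; ring
lemma wa_sq (ε a : ℝ) (h0 : 0 < ε) (he : ε < 1/2) (ha : a ∈ Icc ca 0 1) : Integrable (fun z => wa ε a z^2) nu ∧ ∫ z, wa ε a z^2 ∂nu ≤ 3/ε := by
  obtain ⟨i1, e1⟩ := rp_int (2*ε-1) 1 li zero_le_one
  rw [show 2*ε-1+1 = 2*ε by ring, one_rpow] at e1
  have hg : ∀ y : ℝ, 0 ≤ y → (y^em ε)^2 = y^(2*ε-1) := fun y hy => by
    rw [← rpow_natCast, ← rpow_mul hy]; congr 1; push_cast; ring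
  have k1 : IntegrableOn (fun z => |z-a|^(2*ε-1)) (Ioo a 1) ∧ ∫ z in Ioo a 1, |z-a|^(2*ε-1) ≤ 1/(2*ε) := by
    have hc : EqOn (fun z : ℝ => (z-a)^(2*ε-1)) (fun z => |z-a|^(2*ε-1)) (Ioo a 1) := fun z hz => by
      simp only; rw [abs_of_pos (by linarith [hz.1])]
    refine ⟨(int_sh (2*ε) a a 1 li).congr_fun hc mo, ?_⟩
    rw [← sf mo hc]
    have := KB1 (2*ε) a a 1 1 li li le_rfl (by linarith [ha.1]) zero_le_one
    rwa [one_rpow] at this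
  have k2 : IntegrableOn (fun z => |z-a|^(2*ε-1)) (Ioo 0 a) ∧ ∫ z in Ioo 0 a, |z-a|^(2*ε-1) ≤ 1/(2*ε) := by
    obtain ⟨i2, e2⟩ := rp_int (2*ε-1) a li ha.1
    have hc : EqOn (fun z : ℝ => (a-1*z)^(2*ε-1)) (fun z => |z-a|^(2*ε-1)) (Ioo 0 a) := fun z hz => by
      simp only; rw [abs_sub_comm, abs_of_pos (by linarith [hz.2]), one_mul]
    have h5 : IntervalIntegrable (fun z : ℝ => (a-z)^(2*ε-1)) volume 0 a := by
      have := (intervalIntegral.intervalIntegrable_rpow' (r := 2*ε-1) (a := a) (b := 0) li).comp_sub_left a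
      simpa using this
    rw [intervalIntegrable_iff_integrableOn_Ioc_of_le ha.1] at h5
    refine ⟨(h5.mono_set Ioo_subset_Ioc_self).congr_fun (by simpa using hc) mo, ?_⟩
    rw [← sf mo hc, sub_Ioo' (fun y => y^(2*ε-1)) 1 a 0 a one_pos]
    simp only [one_mul, sub_self, mul_zero, sub_zero, inv_one]
    rw [e2, show 2*ε-1+1 = 2*ε by ring]
    gcongr
    exact rpow_le_one ha.1 ha.2 li
  have k3 : IntegrableOn (fun z => |z-a|^(2*ε-1)) (Ioo 0 1) ∧ ∫ z in Ioo 0 1, |z-a|^(2*ε-1) ≤ 1/(2*ε) + 1/(2*ε) := by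
    have hu : uI =ᵐ[volume] (Ioo 0 a ∪ Ioo a 1 : Set ℝ) := by
      have h6 : (Ioo 0 a ∪ Ioo a 1 : Set ℝ) = Ioo 0 1 \ {a} := by
        ext y; simp only [mem_union, mem_Ioo, mem_diff, mem_singleton_iff]
        constructor
        · rintro (⟨h1, h2⟩ | ⟨h1, h2⟩)
          · exact ⟨⟨h1, by linarith [ha.2]⟩, h2.ne⟩
          · exact ⟨⟨by linarith [ha.1], h2⟩, h1.ne'⟩
        · rintro ⟨⟨h1, h2⟩, h3⟩
          rcases lt_or_gt_of_ne h3 with h | h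
          · exact Or.inl ⟨h1, h⟩
          · exact Or.inr ⟨h, h2⟩
      rw [h6]
      exact (diff_null_ae_eq_self (by simp)).symm
    have hi : IntegrableOn (fun z => |z-a|^(2*ε-1)) (Ioo 0 a ∪ Ioo a 1) := k2.1.union k1.1
    refine ⟨hi.congr_set_ae hu, ?_⟩
    rw [setIntegral_congr_set hu, setIntegral_union (by
      rw [Set.disjoint_left]; rintro y ⟨_, h1⟩ ⟨h2, _⟩; linarith) mo k2.1 k1.1]
    linarith [k1.2, k2.2]
  have hI : Integrable (fun z => 2*(|z-a|^(2*ε-1) + z^(2*ε-1))) nu := (Integrable.add k3.1 i1).const_mul 2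
  have hle : ∀ z ∈ uI, wa ε a z^2 ≤ 2*(|z-a|^(2*ε-1) + z^(2*ε-1)) := fun z hz => by
    rw [← hg _ (abs_nonneg _), ← hg z hz.1.le]; unfold wa
    nlinarith [sq_nonneg (|z-a|^em ε - z^em ε)]
  have hJ : Integrable (fun z => wa ε a z^2) nu := hI.mono' (by unfold wa; fun_prop) (ae_nu fun z hz => by
    rw [norm_of_nonneg (sq_nonneg _)]; exact hle z hz)
  refine ⟨hJ, (integral_mono_ae hJ hI (ae_nu hle)).trans ?_⟩
  rw [im, integral_add k3.1 i1, e1]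
  calc _ ≤ 2*((1/(2*ε) + 1/(2*ε)) + 1/(2*ε)) := by gcongr; exact k3.2
    _ = _ := by field_simp; ring
lemma T3_sec (X : Ctx H Hm HM ε r Ch Cc) (n M : ℕ) (hn : 1 ≤ n) (x : ℝ) (hx : x ∈ uI) (B : ℝ) (hB : ∀ z ∈ uI, z ≠ an n x → |T3 H n M x z| ≤ B * wa ε (an n x) z) :
    Integrable (fun z => T3 H n M x z^2) nu ∧ ∫ z, T3 H n M x z^2 ∂nu ≤ B^2*(3/ε) := by
  obtain ⟨i, e⟩ := wa_sq ε (an n x) X.par.e0 (by linarith [X.par.e2]) ⟨an_nn n x, an_le1 n hn x hx⟩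
  have hne : ∀ᵐ z ∂nu, z ≠ an n x := by
    refine ae_restrict_of_ae ?_
    rw [ae_iff]; simp
  have hle : ∀ᵐ z ∂nu, T3 H n M x z^2 ≤ B^2 * wa ε (an n x) z^2 := by
    filter_upwards [hne, ae_nu (p := fun z => z ∈ uI) fun z hz => hz] with z h1 h2
    rw [← mul_pow, ← sq_abs]
    exact pow_le_pow_left₀ (abs_nonneg _) (hB z h2 h1) 2
  have hm : Measurable (fun z => T3 H n M x z) := (T3_ker X n M hn).meas.comp (measurable_const.prodMk measurable_id)
  have hJ : Integrable (fun z => T3 H n M x z^2) nu := (i.const_mul (B^2)).mono' (hm.pow_const 2).aestronglyMeasurable (by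
    filter_upwards [hle] with z hz
    rw [norm_of_nonneg (sq_nonneg _)]; exact hz)
  refine ⟨hJ, (integral_mono_ae hJ (i.const_mul _) hle).trans ?_⟩
  rw [im]
  exact ll e (sq_nonneg _)
end
end
section
section
variable {H : ℝ → ℝ} {Hm HM ε r Ch Cc : ℝ}
lemma T3_HS (X : Ctx H Hm HM ε r Ch Cc) (M : ℕ) : ∃ C > 0, ∀ n : ℕ, 1 ≤ n → Ch * (1/n:ℝ)^r ≤ ε/2 → ∀ a0 > 0,
    ∫ x, ∫ z, T3 H n M x z^2 ∂nu ∂nu ≤ C * (((1/n:ℝ)^r*(1/n:ℝ)^(Hm-3*ε) + (1/n:ℝ)/a0 + ((1/n:ℝ)^r)^M)^2 + (a0+1/n)*((1/n:ℝ)^(Hm-3*ε) + ((1/n:ℝ)^r)^M)^2) := by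
  obtain ⟨C, c0, hC⟩ := T3_bd X M
  have he := X.par.e0
  refine ⟨C^2*(3/ε), po, fun n hn hη a0 ha0 => ?_⟩
  set bg := (1/n:ℝ)^r*(1/n:ℝ)^(Hm-3*ε) + (1/n:ℝ)/a0 + ((1/n:ℝ)^r)^M
  set bb := (1/n:ℝ)^(Hm-3*ε) + ((1/n:ℝ)^r)^M
  have hb0 : 0 ≤ a0 + 1/ca n - 0 := by rw [sub_zero]; positivity
  have hci : IntegrableOn (fun _ : ℝ => C^2*(3/ε)*bb^2) (Ioo 0 (a0+1/n)) := integrableOn_const (by simp)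
  have h2 : IntegrableOn (fun x => indicator (Ioo 0 (a0+1/n)) (fun _ => C^2*(3/ε)*bb^2) x) (uI) :=
    (integrable_indicator_iff mo).2 hci |>.integrableOn
  have h3 : Integrable (fun x => C^2*(3/ε)*bg^2 + indicator (Ioo 0 (a0+1/n)) (fun _ => C^2*(3/ε)*bb^2) x) nu := (integrable_const _).add h2
  have h4 : ∫ x, indicator (Ioo 0 (a0+1/n)) (fun _ => C^2*(3/ε)*bb^2) x ∂nu ≤ (a0+1/n)*(C^2*(3/ε)*bb^2) := by
    have : ∫ x, indicator (Ioo 0 (a0+1/n)) (fun _ => C^2*(3/ε)*bb^2) x ∂nu ≤ ∫ x, indicator (Ioo 0 (a0+1/n)) (fun _ => C^2*(3/ε)*bb^2) x :=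
      setIntegral_le_integral ((integrable_indicator_iff mo).2 hci) (ae_of_all _ fun x => indicator_nonneg (fun _ _ => po) _)
    refine this.trans ?_
    rw [integral_indicator mo, setIntegral_const, smul_eq_mul, Measure.real, volume_Ioo, ENNReal.toReal_ofReal hb0, sub_zero]
  calc _ ≤ ∫ x, C^2*(3/ε)*bg^2 + indicator (Ioo 0 (a0+1/n)) (fun _ => C^2*(3/ε)*bb^2) x ∂nu := by
        refine integral_mono_ae (T3_ker X n M hn).sq_int.integral_prod_left h3 (ae_nu fun x hx => ?_)
        rcases le_or_gt a0 (an n x) with h | h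
        · have := (T3_sec X n M hn x hx _ fun z hz hza => (hC n hn hη x hx z hz hza).2 a0 ha0 h).2
          have h5 : 0 ≤ indicator (Ioo 0 (a0+1/n)) (fun _ => C^2*(3/ε)*bb^2) x := indicator_nonneg (fun _ _ => po) _
          refine this.trans ?_
          rw [mul_pow]; linarith
        · have := (T3_sec X n M hn x hx _ fun z hz hza => (hC n hn hη x hx z hz hza).1).2
          have h6 := (an_le n hn x hx.1.le).2
          beta_reduce; rw [indicator_of_mem (show x ∈ Ioo 0 (a0+1/n) from ⟨hx.1, li⟩)]
          refine this.trans ?_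
          have h5 : 0 ≤ C^2*(3/ε)*bg^2 := po
          rw [mul_pow]; linarith
    _ ≤ C^2*(3/ε)*bg^2 + (a0+1/n)*(C^2*(3/ε)*bb^2) := by
        rw [integral_add (integrable_const _) h2]
        refine add_le_add (le_of_eq ?_) h4
        simp [Measure.real]
    _ = _ := by ring
def fjm (H : ℝ → ℝ) (n j m : ℕ) (x : ℝ) : ℝ := if ⌊ca n*x⌋₊ = j then cstar (H x) * ((H x - H (j/n))^m/m.factorial) else 0
lemma fjm_bm (X : Ctx H Hm HM ε r Ch Cc) (n j m : ℕ) : BM (fjm H n j m) := by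
  have hH := X.cont.measurable
  refine ⟨?_, Cc, X.Cc0.le, fun x => ?_⟩
  · unfold fjm
    refine Measurable.ite ?_ ((cst_cont X).measurable.mul fp) measurable_const
    exact (Nat.measurable_floor.comp (measurable_const.mul measurable_id)) (measurableSet_singleton j)
  · unfold fjm; split_ifs
    · exact fm_bd X _ _ _
    · simpa using X.Cc0.le
lemma fl_lt (n : ℕ) (hn : 1 ≤ n) (x : ℝ) (hx : x ∈ uI) : ⌊ca n*x⌋₊ < n := by
  have hn0 := c0p hn
  rw [Nat.floor_lt (by have := hx.1; positivity)]; nlinarith [hx.2]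
lemma T2_eq (H : ℝ → ℝ) (n M : ℕ) (hn : 1 ≤ n) (x z : ℝ) (hx : x ∈ uI) :
    T2 H n M x z = ∑ i : Fin n × Fin M, fjm H n i.1 i.2 x * Am H i.2 ((i.1:ℕ)/ca n) z := by
  rw [Fintype.sum_prod_type, Finset.sum_eq_single (⟨⌊ca n*x⌋₊, fl_lt n hn x hx⟩ : Fin n)]
  · unfold T2 fjm an
    rw [Finset.sum_range]; simp
  · intro j _ hj
    refine Finset.sum_eq_zero fun m _ => ?_
    unfold fjm; rw [if_neg, zero_mul]
    intro h; exact hj (Fin.ext h.symm)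
  · intro h; exact absurd (Finset.mem_univ _) h
lemma rank_bd (X : Ctx H Hm HM ε r Ch Cc) (M : ℕ) : ∃ C > 0, ∀ n : ℕ, 1 ≤ n → ∀ (ι : Type) [Fintype ι] [DecidableEq ι] (e : ι → ℝ → ℝ), (∀ i, BM (e i)) → (Orthonormal ℝ fun i => toE (e i)) →
    ∀ c : ℝ, 0 ≤ c → (1 + c • Matrix.gram ℝ (fun i => toE (KO (T2 H n M) (e i)))).det ≤ (1 + c * (C*n))^(n*M) := by
  have P := X.par; have he := P.e0; have := P.e1
  have hCc := X.Cc0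
  set C1 := ∑ m ∈ rg M, (m.factorial * (1/ε)^m * (2/(Hm-1/2-ε)))^2 * ∫ z, (z^em ε)^2 ∂nu with hC1
  refine ⟨(C1+1)*Cc^2, po, fun n hn ι _ _ e hbm ho c hc => ?_⟩
  have hn0 := c0p hn
  have hAm : ∀ (i : Fin n × Fin M), MemLp (Am H i.2 ((i.1:ℕ)/ca n)) 2 nu ∧ ‖toE (Am H i.2 ((i.1:ℕ)/ca n))‖^2 ≤ ((i.2:ℕ).factorial * (1/ε)^(i.2:ℕ) * (2/(Hm-1/2-ε)))^2 * ∫ z, (z^em ε)^2 ∂nu := by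
    intro i
    have ha1 : ((i.1:ℕ):ℝ)/n ≤ 1 := by
      rw [div_le_one hn0]; exact_mod_cast i.1.2.le
    have hm : Measurable (Am H i.2 ((i.1:ℕ)/ca n)) := (Am_meas' X i.2 (fun _ => ((i.1:ℕ):ℝ)/n) measurable_const).comp ((measurable_const (a := ca 0)).prodMk measurable_id)
    have hb : ∀ z ∈ uI, |Am H i.2 ((i.1:ℕ)/ca n) z| ≤ _ := fun z hz => Am_bd X i.2 _ z hz ha1
    have hM := mem_zs he hm _ hb
    refine ⟨hM, ?_⟩
    rw [toE_norm hM, ← im]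
    refine integral_mono_ae hM.integrable_sq ((zs_mem ε he).integrable_sq.const_mul _) (ae_nu fun z hz => ?_)
    simp only
    rw [← mul_pow, ← sq_abs]
    exact pow_le_pow_left₀ (abs_nonneg _) (hb z hz) 2
  have hKO : ∀ i, toE (KO (T2 H n M) (e i)) = ∑ l : Fin n × Fin M, (∫ x, fjm H n l.1 l.2 x * e i x ∂nu) • toE (Am H l.2 ((l.1:ℕ)/ca n)) := by
    intro i
    rw [← toE_sum _ _ _ fun l _ => (hAm l).1]
    refine toE_congr (KO_mem (T2_ker X n M hn) (hbm i)) (ae_nu fun z hz => ?_)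
    unfold KO
    rw [integral_congr_ae (ae_nu fun x hx => by rw [T2_eq H n M hn x z hx, Finset.sum_mul])]
    rw [integral_finset_sum]
    · refine sc rfl fun l _ => ?_
      rw [← integral_mul_const]
      refine integral_congr_ae (ae_of_all _ fun x => ?_)
      simp only; ring
    · intro l _
      have := (((fjm_bm X n l.1 l.2).mem).integrable_mul (hbm i).mem).mul_const (Am H l.2 ((l.1:ℕ)/ca n) z)
      refine this.congr (ae_of_all _ fun x => ?_)
      simp only [Pi.mul_apply]; ring
  simp_rw [hKO]
  have hS : ∑ l : Fin n × Fin M, ‖toE (Am H l.2 ((l.1:ℕ)/ca n))‖^2 ≤ n*(C1+1) := by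
    refine (Finset.sum_le_sum fun l _ => (hAm l).2).trans ?_
    rw [Fintype.sum_prod_type]
    simp only [Finset.sum_const, Finset.card_univ, Fintype.card_fin, nsmul_eq_mul]
    rw [← Finset.sum_range (fun m => (m.factorial * (1/ε)^m * (2/(Hm-1/2-ε)))^2 * ∫ z, (z^em ε)^2 ∂nu), ← hC1]
    gcongr; linarith
  have hQ : ∀ l : Fin n × Fin M, ∑ i, (∫ x, fjm H n l.1 l.2 x * e i x ∂nu)^2 ≤ Cc^2 := by
    intro l
    refine (bessel Finset.univ e (fun i => (hbm i).mem) ho (fjm_bm X n l.1 l.2).mem).trans ?_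
    have h1 : ∫ x, fjm H n l.1 l.2 x^2 ∂nu ≤ ∫ x, Cc^2 ∂nu := by
      refine integral_mono_ae (fjm_bm X n l.1 l.2).mem.integrable_sq (integrable_const _) (ae_of_all _ fun x => ?_)
      simp only
      rw [← sq_abs]
      refine pow_le_pow_left₀ (abs_nonneg _) ?_ 2
      unfold fjm; split_ifs
      · exact fm_bd X _ _ _
      · simpa using hCc.le
    simpa [Measure.real] using h1
  have := la_rank (fun i (l : Fin n × Fin M) => ∫ x, fjm H n l.1 l.2 x * e i x ∂nu) (fun l => toE (Am H l.2 ((l.1:ℕ)/ca n))) c (n*(C1+1)) (Cc^2) hc hS hQ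
  refine this.trans (le_of_eq ?_)
  rw [Fintype.card_prod, Fintype.card_fin, Fintype.card_fin]; congr 2; ring
lemma cov_eq (X : Ctx H Hm HM ε r Ch Cc) (H' : ℝ → ℝ) (hH' : ∀ x ∈ Icc ca 0 1, H' x = H x) [MeasurableSpace EE]
    (μ : Measure EE) (hCov : ∀ u v : EE, ∫ f, (inner ℝ u f) * (inner ℝ v f) ∂μ = ∫ x in uI, ∫ y in uI, GmfBM H' x y * u x * v y)
    {u v : ℝ → ℝ} (hu : BM u) (hv : BM v) : ∫ f, (inner ℝ (toE u) f) * (inner ℝ (toE v) f) ∂μ = inner ℝ (toE (KO (KK H) u)) (toE (KO (KK H) v)) := by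
  rw [hCov, ← KO_cov (KK_ker X) hu hv]
  have hG : ∀ x ∈ uI, ∀ y ∈ uI, GmfBM H' x y = ∫ z, KK H x z * KK H y z ∂nu := by
    intro x hx y hy
    unfold GmfBM
    rw [hH' x ⟨hx.1.le, hx.2.le⟩, hH' y ⟨hy.1.le, hy.2.le⟩]
    symm
    refine setIntegral_eq_of_subset_of_forall_diff_eq_zero mo (Ioo_subset_Ioo le_rfl ((min_le_left _ _).trans hx.2.le)) fun z hz => ?_
    have h1 : min x y ≤ z := by
      by_contra h; push Not at h; exact hz.2 ⟨hz.1.1, h⟩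
    unfold KK Kker
    rcases min_le_iff.1 h1 with h | h
    · rw [if_neg (fun h' => by linarith [h'.2]), zero_mul]
    · rw [if_neg (c := 0 < z ∧ z < y) (fun h' => by linarith [h'.2]), mul_zero]
  have hx0 := toE_coe hu.mem
  have hy0 := toE_coe hv.mem
  refine integral_congr_ae ?_
  filter_upwards [hx0, ae_nu (p := fun z => z ∈ uI) fun z hz => hz] with x h1 hx
  refine integral_congr_ae ?_
  filter_upwards [hy0, ae_nu (p := fun z => z ∈ uI) fun z hz => hz] with y h2 hy
  rw [h1, h2, hG x hx y hy]
end
structure GM (H H' : ℝ → ℝ) [MeasurableSpace EE] (μ : Measure EE) : Prop where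
  e : ∀ x ∈ Icc ca 0 1, H' x = H x
  p : IsProbabilityMeasure μ
  g : ∀ L : EE →L[ℝ] ℝ, ∃ v : ℝ≥0, μ.map L = gR 0 v
  c : ∀ u v : EE, ∫ f, (inner ℝ u f) * (inner ℝ v f) ∂μ = ∫ x in uI, ∫ y in uI, GmfBM H' x y * u x * v y
end
lemma fl_iff (n j : ℕ) (hn : 1 ≤ n) (x : ℝ) (hx : 0 ≤ x) : ⌊ca n*x⌋₊ = j ↔ x ∈ Ico dv j n ((j+1)/n) := by
  have hn0 := c0p hn
  rw [Nat.floor_eq_iff po, mem_Ico, div_le_iff₀ hn0, lt_div_iff₀ hn0, mul_comm x]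
lemma blk_sub (n j : ℕ) (hn : 1 ≤ n) (hj : j < n) : Ioo dv j n ((j+1)/n) ⊆ Ioo 0 1 := by
  have hn0 := c0p hn
  refine Ioo_subset_Ioo po ?_
  rw [div_le_one hn0]; exact_mod_cast hj
def bl (n j : ℕ) (F : ℝ → ℝ) (x : ℝ) : ℝ := if ⌊ca n*x⌋₊ = j then F (n*x-j) else 0
lemma bl_set (n j : ℕ) (hn : 1 ≤ n) (hj : j < n) (f : ℝ → ℝ) : ∫ x, (if ⌊ca n*x⌋₊ = j then f x else 0) ∂nu = ∫ x in Ioo dv j n ((j+1)/n), f x := by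
  have h1 : ∀ x ∈ uI, (if ⌊ca n*x⌋₊ = j then f x else 0) = indicator (Ico dv j n ((j+1)/n)) f x := by
    intro x hx
    simp only [indicator, fl_iff n j hn x hx.1.le]
    split_ifs <;> rfl
  rw [sf mo h1, setIntegral_indicator measurableSet_Ico]
  refine setIntegral_congr_set ?_
  have h2 : Ioo dv j n ((j+1)/n) =ᵐ[volume] Ico dv j n ((j+1)/n) := Ioo_ae_eq_Ico
  have h3 : uI ∩ Ioo dv j n ((j+1)/n) = Ioo dv j n ((j+1)/n) := inter_eq_right.2 (blk_sub n j hn hj)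
  have h4 := (ae_eq_refl (uI) (μ := volume)).inter h2.symm
  rw [h3] at h4
  exact h4
lemma bl_mul (n j : ℕ) (F : ℝ → ℝ) (g : ℝ → ℝ) (x : ℝ) : bl n j F x * g x = if ⌊ca n*x⌋₊ = j then F (n*x-j) * g x else 0 := by
  unfold bl; split_ifs <;> simp
lemma blk_sc (n j : ℕ) (hn : 1 ≤ n) (F : ℝ → ℝ) : ∫ x in Ioo dv j n ((j+1)/n), F (n*x-j) = (n:ℝ)⁻¹ * ∫ y in Ioo 0 1, F y := by
  have hn0 := c0p hn
  have := sub_Ioo F n (-j) dv j n ((j+1)/n) hn0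
  rw [mul_div_cancel₀ _ hn0.ne', mul_div_cancel₀ _ hn0.ne'] at this
  simp only [← sub_eq_add_neg] at this
  rw [this]; congr 3 <;> ring_nf
lemma bl_int (n j : ℕ) (hn : 1 ≤ n) (hj : j < n) (F G : ℝ → ℝ) : ∫ x, bl n j F x * bl n j G x ∂nu = (n:ℝ)⁻¹ * ∫ y in Ioo 0 1, F y * G y := by
  rw [← blk_sc n j hn (fun y => F y * G y), ← bl_set n j hn hj]
  refine integral_congr_ae (ae_of_all _ fun x => ?_)
  simp only [bl]; split_ifs <;> simp
lemma bl_off (n j j' : ℕ) (h : j ≠ j') (F G : ℝ → ℝ) : ∫ x, bl n j F x * bl n j' G x ∂nu = 0 := by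
  rw [← integral_zero ℝ ℝ (μ := nu)]
  refine integral_congr_ae (ae_of_all _ fun x => ?_)
  simp only [bl]; split_ifs with h1 h2
  · exact absurd (h1.symm.trans h2) h
  all_goals simp
lemma bl_bm (n j : ℕ) (F : ℝ → ℝ) (hF : Measurable F) (B : ℝ) (hB : ∀ x, |F x| ≤ B) : BM (bl n j F) := by
  have b0 : 0 ≤ B := (abs_nonneg _).trans (hB 0)
  refine ⟨?_, B, b0, fun x => ?_⟩
  · unfold bl
    refine Measurable.ite ?_ fp measurable_const
    exact (Nat.measurable_floor.comp (measurable_const.mul measurable_id)) (measurableSet_singleton j)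
  · unfold bl; split_ifs
    · exact hB _
    · simpa using b0
lemma cosint (m : ℤ) : ∫ y in uI, cos (π*m*y) = if m = 0 then 1 else 0 := by
  split_ifs with h
  · subst h; simp
  · have hm : ca m ≠ 0 := by exact_mod_cast h
    have hp : π*ca m ≠ 0 := mul_ne_zero pi_ne_zero hm
    rw [← oo, ← io zero_le_one, intervalIntegral.integral_comp_mul_left (fun x => cos x) hp, integral_cos]
    simp [mul_comm π, sin_int_mul_pi]
def fc (n k : ℕ) (y : ℝ) : ℝ := (if k = 0 then √n else √(2*n)) * cos (π*k*y)
def fs (n k : ℕ) (y : ℝ) : ℝ := √(2*n) * sin (π*k*y)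
lemma ci_int (c : ℝ) : IntegrableOn (fun y => cos (c*y)) (Ioo 0 1) :=
  (Continuous.integrableOn_Icc fp).mono_set Ioo_subset_Icc_self
lemma fc_orth (n k l : ℕ) (hn : 1 ≤ n) : (n:ℝ)⁻¹ * ∫ y in Ioo 0 1, fc n k y * fc n l y = if k = l then 1 else 0 := by
  set a := (if k = 0 then √ca n else √(2*n)) with ha
  set b := (if l = 0 then √ca n else √(2*n)) with hb
  have e : ∀ y, fc n k y * fc n l y = a*b/2 * (cos (π*((k:ℤ)-(l:ℤ):ℤ)*y) + cos (π*((k:ℤ)+(l:ℤ):ℤ)*y)) := by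
    intro y; unfold fc; push_cast
    rw [show π*(ca k-l)*y = π*k*y - π*l*y by ring, show π*(ca k+l)*y = π*k*y + π*l*y by ring, cos_sub, cos_add]; ring
  simp_rw [e]
  rw [im, integral_add (ci_int _) (ci_int _), cosint, cosint]
  by_cases h : k = l
  · subst h
    by_cases h0 : k = 0
    · subst h0
      simp only [if_true] at ha hb
      rw [ha, hb]; simp; field_simp; norm_num
    · have : ¬ ((k:ℤ)+k = 0) := by omega
      simp only [if_neg h0] at ha hb
      rw [if_pos (by ring), if_neg this, if_pos rfl, ha, hb, mul_self_sqrt po]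
      field_simp; norm_num
  · have h1 : ¬ ((k:ℤ)-l = 0) := by omega
    have h2 : ¬ ((k:ℤ)+l = 0) := by omega
    rw [if_neg h1, if_neg h2, if_neg h]; simp
lemma fs_orth (n k l : ℕ) (hn : 1 ≤ n) (hk : 1 ≤ k) (hl : 1 ≤ l) : (n:ℝ)⁻¹ * ∫ y in Ioo 0 1, fs n k y * fs n l y = if k = l then 1 else 0 := by
  have e : ∀ y, fs n k y * fs n l y = n * (cos (π*((k:ℤ)-(l:ℤ):ℤ)*y) - cos (π*((k:ℤ)+(l:ℤ):ℤ)*y)) := by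
    intro y; unfold fs; push_cast
    have : √(2*n:ℝ) * √(2*n) = 2*n := mul_self_sqrt po
    rw [show π*(ca k-l)*y = π*k*y - π*l*y by ring, show π*(ca k+l)*y = π*k*y + π*l*y by ring, cos_sub, cos_add]
    linear_combination (sin (π*k*y) * sin (π*l*y)) * this
  simp_rw [e]
  rw [im, integral_sub (ci_int _) (ci_int _), cosint, cosint]
  have h2 : ¬ ((k:ℤ)+l = 0) := by omega
  rw [if_neg h2]
  by_cases h : k = l
  · subst h; rw [if_pos (by ring), if_pos rfl]; field_simp; simp
  · have h1 : ¬ ((k:ℤ)-l = 0) := by omega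
    rw [if_neg h1, if_neg h]; simp
lemma fc_bm (n j k : ℕ) : BM (bl n j (fc n k)) := by
  refine bl_bm n j _ (by unfold fc; fun_prop) (√n+√(2*n)) fun x => ?_
  unfold fc; rw [abs_mul]
  have : |if k = 0 then √ca n else √(2*n)| ≤ √n+√(2*n) := by
    split_ifs <;> rw [abs_of_nonneg po] <;> linarith [sqrt_nonneg ca n, sqrt_nonneg (2*n:ℝ)]
  calc _ ≤ (√n+√(2*n))*1 := mul_le_mul this (abs_cos_le_one _) (abs_nonneg _) po
    _ = _ := mul_one _
lemma fs_bm (n j k : ℕ) : BM (bl n j (fs n k)) := by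
  refine bl_bm n j _ (by unfold fs; fun_prop) (√(2*n)) fun x => ?_
  unfold fs; rw [abs_mul, abs_of_nonneg po]
  calc _ ≤ √(2*n)*1 := mul_le_mul le_rfl (abs_sin_le_one _) (abs_nonneg _) po
    _ = _ := mul_one _
lemma fc_on (n : ℕ) (hn : 1 ≤ n) : Orthonormal ℝ (fun i : Fin n × ℕ => toE (bl n i.1 (fc n i.2))) := by
  rw [orthonormal_iff_ite]
  rintro ⟨j, k⟩ ⟨j', l⟩
  rw [toE_inner (fc_bm _ _ _).mem (fc_bm _ _ _).mem]
  by_cases h : j = j'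
  · subst h
    simp only
    rw [bl_int n j hn j.2, fc_orth n k l hn]; simp
  · rw [bl_off n j j' (fun h' => h (Fin.ext h')), if_neg (fun h' => h (Prod.ext_iff.1 h').1)]
lemma cos_complete (n j : ℕ) (hn : 1 ≤ n) (f : ℝ → ℝ) (hf : IntegrableOn f (Ioo dv j n ((j+1)/n)))
    (h : ∀ k : ℕ, ∫ x in Ioo dv j n ((j+1)/n), f x * cos (π*k*(n*x-j)) = 0) : ∀ᵐ x, x ∈ Ioo dv j n ((j+1)/n) → f x = 0 := by
  have hn0 := c0p hn
  set I := Ioo dv j n ((j+1)/n)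
  have hint : ∀ ψ : ℝ → ℝ, Continuous ψ → IntegrableOn (fun x => f x * ψ (n*x-j)) I := fun ψ hψ => by
    obtain ⟨B, hB⟩ := (isCompact_Icc (a := ca j/n) (b := (j+1)/n)).exists_bound_of_continuousOn (f := fun x => ψ (n*x-j)) fp
    exact Integrable.mul_bdd (c := B) hf fp ((ae_restrict_iff' mo).2 (ae_of_all _ fun x hx => hB x ⟨hx.1.le, hx.2.le⟩))
  have h1 : ∀ m k : ℕ, ∫ x in I, f x * (cos (π*(n*x-j))^m * cos (π*k*(n*x-j))) = 0 := by
    intro m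
    induction m with
    | zero => intro k; simpa using h k
    | succ m ih =>
      intro k
      rcases Nat.eq_zero_or_pos k with rfl | hk
      · have := ih 1
        rw [← this]; refine sf mo fun x _ => ?_
        simp [pow_succ]
      · obtain ⟨k', rfl⟩ : ∃ k', k = k'+1 := ⟨k-1, by omega⟩
        have i1 := hint (fun y => cos (π*y)^m * cos (π*((k'+2:ℕ):ℝ)*y)) fp
        have i2 := hint (fun y => cos (π*y)^m * cos (π*ca k'*y)) fp
        have e : ∀ x, f x * (cos (π*(n*x-j))^(m+1) * cos (π*((k'+1:ℕ):ℝ)*(n*x-j))) = 1/2*(f x * (cos (π*(n*x-j))^m * cos (π*((k'+2:ℕ):ℝ)*(n*x-j))) + f x * (cos (π*(n*x-j))^m * cos (π*k'*(n*x-j)))) := by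
          intro x
          push_cast
          rw [show π*(ca k'+2)*(n*x-j) = π*(k'+1)*(n*x-j) + π*(n*x-j) by ring, show π*ca k'*(n*x-j) = π*(k'+1)*(n*x-j) - π*(n*x-j) by ring, cos_add, cos_sub]; ring
        simp_rw [e]
        rw [im, integral_add i1 i2, ih, ih]; simp
  have h2 : ∀ p : Polynomial ℝ, ∫ x in I, f x * p.eval (cos (π*(n*x-j))) = 0 := by
    intro p
    simp_rw [Polynomial.eval_eq_sum_range, ms]
    rw [integral_finset_sum]
    · refine Finset.sum_eq_zero fun m _ => ?_
      have := h1 m 0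
      simp only [Nat.cast_zero, mul_zero, zero_mul, cos_zero, mul_one] at this
      calc _ = ∫ x in I, p.coeff m * (f x * cos (π*(n*x-j))^m) := by congr 1; ext x; ring
        _ = 0 := by rw [im, this, mul_zero]
    · intro m _
      exact hint (fun y => p.coeff m * cos (π*y)^m) fp
  have h3 : ∀ ψ : ℝ → ℝ, Continuous ψ → ∫ x in I, f x * ψ (n*x-j) = 0 := by
    intro ψ hψ
    by_contra hne
    set B := ∫ x in I, |f x| with hB
    have hB0 : 0 ≤ B := integral_nonneg fun _ => abs_nonneg _
    obtain ⟨p, hp⟩ := exists_polynomial_near_of_continuousOn (-1) 1 (fun t => ψ (arccos t/π)) fp (|∫ x in I, f x * ψ (n*x-j)|/(B+1)) po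
    have h4 : |∫ x in I, f x * ψ (n*x-j)| ≤ |∫ x in I, f x * ψ (n*x-j)|/(B+1) * B := by
      set R := |∫ x in I, f x * ψ (n*x-j)|/(B+1)
      have e : ∫ x in I, f x * ψ (n*x-j) = ∫ x in I, f x * (ψ (n*x-j) - p.eval (cos (π*(n*x-j)))) := by
        rw [← sub_zero (∫ x in I, f x * ψ (n*x-j)), ← h2 p, ← integral_sub (hint ψ hψ) (hint (fun y => p.eval (cos (π*y))) fp)]
        simp only [← mul_sub]
      rw [e, hB, ← im, ← na]
      refine norm_integral_le_of_norm_le (hf.abs.const_mul _) ((ae_restrict_iff' mo).2 (ae_of_all _ fun x hx => ?_))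
      rw [norm_mul, mul_comm, na, na]
      gcongr
      have y0 : 0 ≤ ca n*x - j := by have := (div_lt_iff₀ hn0).1 hx.1; linarith
      have y1 : ca n*x - j ≤ 1 := by have := (lt_div_iff₀ hn0).1 hx.2; linarith
      have := hp (cos (π*(n*x-j))) ⟨neg_one_le_cos _, cos_le_one _⟩
      rw [arccos_cos (by have := pi_pos; positivity) (by have := pi_pos; nlinarith), mul_div_cancel_left₀ _ pi_ne_zero, abs_sub_comm] at this
      exact this.le
    have h5 : 0 < |∫ x in I, f x * ψ (n*x-j)| := abs_pos.2 hne
    rw [div_mul_eq_mul_div, le_div_iff₀ li] at h4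
    linarith
  refine isOpen_Ioo.ae_eq_zero_of_integral_contDiff_smul_eq_zero hf.locallyIntegrableOn fun g hg hc hs => ?_
  have := h3 (fun y => g ((y+j)/n)) (by have := hg.continuous; fun_prop)
  rw [← setIntegral_eq_integral_of_forall_compl_eq_zero (s := I), ← this]
  · refine sf mo fun x _ => ?_
    simp only [smul_eq_mul]
    rw [mul_comm]; congr 2; field_simp; ring
  · intro x hx
    rw [image_eq_zero_of_notMem_tsupport (fun h' => hx (hs h')), zero_smul]
def fcB (n : ℕ) (hn : 1 ≤ n) : HilbertBasis (Fin n × ℕ) ℝ EE := by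
  refine HilbertBasis.mkOfOrthogonalEqBot (fc_on n hn) ?_
  rw [Submodule.eq_bot_iff]
  intro f hf
  rw [Submodule.mem_orthogonal] at hf
  have hf' : ∀ i : Fin n × ℕ, inner ℝ (toE (bl n i.1 (fc n i.2))) f = 0 := fun i => hf _ (Submodule.subset_span ⟨i, rfl⟩)
  have hfi : Integrable f nu := (Lp.memLp f).integrable nn
  have h1 : ∀ j : Fin n, ∀ᵐ x, x ∈ Ioo (((j:ℕ):ℝ)/n) (((j:ℕ)+1)/n) → f x = 0 := by
    intro j
    refine cos_complete n j hn f (IntegrableOn.mono_set hfi (blk_sub n j hn j.2)) fun k => ?_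
    have := hf' (j,k)
    rw [inner_EE, integral_congr_ae (g := fun x => bl n j (fc n k) x * f x) (by filter_upwards [toE_coe (fc_bm n j k).mem] with x hx; rw [hx])] at this
    simp_rw [bl_mul] at this
    rw [bl_set n j hn j.2] at this
    unfold fc at this
    have hc : (if k = 0 then √ca n else √(2*n)) ≠ 0 := by split_ifs <;> positivity
    have e : ∀ x, (if k = 0 then √ca n else √(2*n)) * cos (π*k*(n*x-(j:ℕ))) * f x = (if k = 0 then √ca n else √(2*n)) * (f x * cos (π*k*(n*x-(j:ℕ)))) := fun x => by ring
    simp_rw [e] at this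
    rw [im] at this
    exact (mul_eq_zero.1 this).resolve_left hc
  have h2 : ∀ᵐ x : ℝ, ∀ j : Fin n, x ≠ ((j:ℕ):ℝ)/n := by
    rw [ae_all_iff]; intro j; rw [ae_iff]; simp
  apply Lp.ext
  have h3 : ∀ᵐ x : ℝ, x ∈ uI → f x = 0 := by
    filter_upwards [ae_all_iff.2 h1, h2] with x a1 a2 hx
    have := (fl_iff n ⌊ca n*x⌋₊ hn x hx.1.le).1 rfl
    exact a1 ⟨_, fl_lt n hn x hx⟩ ⟨lt_of_le_of_ne this.1 (a2 ⟨_, fl_lt n hn x hx⟩).symm, this.2⟩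
  filter_upwards [(ae_restrict_iff' mo).2 h3, Lp.coeFn_zero ℝ 2 nu] with x a1 a2
  rw [a1, a2]; rfl
lemma fcB_apply (n : ℕ) (hn : 1 ≤ n) (i : Fin n × ℕ) : fcB n hn i = toE (bl n i.1 (fc n i.2)) := by
  unfold fcB; simp
lemma inc_cos (q a b κ z : ℝ) (hq : 0 < q) (hab : a < b) (hκ : 0 < κ) (hs : sin (κ*(b-a)) = 0) :
    ∫ x in Ioo a b, inc q a x z * cos (κ*(x-a)) = -κ⁻¹ * ∫ x in Ioo (max a z) b, (x-z)^(q-1) * sin (κ*(x-a)) := by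
  have ic : Continuous (fun x => inc q a x z) := by
    unfold inc
    exact ((Continuous.rpow_const fp fun _ => Or.inr hq.le).sub continuous_const).div_const _
  have h0 : ∀ x, a ≤ x → x ≤ z → inc q a x z = 0 := by
    intro x h1 h2; unfold inc; rw [max_eq_right li, max_eq_right li]; simp
  rcases le_or_gt b z with h | h
  · rw [Ioo_eq_empty (a := max a z) (by simp [h]), setIntegral_congr_fun (g := fun _ => 0) mo fun x hx => by simp only [h0 x hx.1.le (hx.2.le.trans h), zero_mul]]
    simp
  have hm : max a z < b := max_lt hab h
  have fi : IntegrableOn (fun x => inc q a x z * cos (κ*(x-a))) (Ioo a b) := (Continuous.integrableOn_Icc fp).mono_set Ioo_subset_Icc_self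
  rw [Ioo_split _ a z b h.le hab.le fi, max_comm z a, setIntegral_congr_fun (s := Ioo a z) (g := fun _ => 0) mo fun x hx => by simp only [h0 x hx.1.le hx.2.le, zero_mul]]
  have := intervalIntegral.integral_mul_deriv_eq_deriv_mul_of_hasDerivAt (a := max a z) (b := b) (u := fun x => inc q a x z) (v := fun x => sin (κ*(x-a))/κ) (u' := fun x => (x-z)^(q-1)) (v' := fun x => cos (κ*(x-a))) ic.continuousOn fp ?_ ?_ ?_ (Continuous.intervalIntegrable fp _ _)
  · rw [hs, show inc q a (max a z) z = 0 by unfold inc; rcases le_total a z with h1 | h1 <;> simp [h1]] at this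
    rw [io hm.le, io hm.le, oo, oo] at this
    rw [this]
    simp only [mul_div_assoc', integral_div]
    simp; ring
  · intro x hx
    rw [min_eq_left hm.le] at hx
    have hxz : 0 < x - z := by have := (le_max_right a z).trans_lt hx.1; linarith
    have h1 : HasDerivAt (fun x => ((x-z)^q - (max (a-z) 0)^q)/q) (1*q*(x-z)^(q-1)/q) x :=
      ((((hasDerivAt_id x).sub_const z).rpow_const (Or.inl hxz.ne')).sub_const _).div_const _
    rw [show (x-z)^(q-1) = 1*q*(x-z)^(q-1)/q by field_simp]
    refine h1.congr_of_eventuallyEq ?_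
    filter_upwards [lt_mem_nhds (show z < x by linarith)] with y hy
    unfold inc; rw [max_eq_left li]
  · intro x _
    have h1 := (((hasDerivAt_id x).sub_const a).const_mul κ).sin.div_const κ
    convert h1 using 1
    simp; field_simp; rfl
  · rw [intervalIntegrable_iff_integrableOn_Ioo_of_le hm.le]; exact int_sh q z _ _ hq
lemma ic_bd (q a b z : ℝ) (k : ℕ) (κ : ℝ) (hq : 0 < q) (hq1 : q < 1) (hab : a < b) (hκ : 0 < κ) (hk : κ*(b-a) = π*k) :
    (∫ x in Ioo a b, inc q a x z * cos (κ*(x-a)))^2 ≤ κ^(-2-2*q) * (indicator (Ioo a b) (fun z => Sf q (κ*b-κ*z)^2) z +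
      indicator (Iio a) (fun z => 16*(Gamma q+1)^2*((1+κ*a)-κ*z)^(2*q-2)) z) ∨ z = a := by
  rw [inc_cos q a b κ z hq hab hκ (by rw [hk, mul_comm]; exact sin_nat_mul_pi k)]
  have e1 : ∀ t : ℝ, κ^(-2-2*q) * t^2 = (κ⁻¹*(κ^(-q)*t))^2 := by
    intro t
    rw [mul_pow, mul_pow, ← rpow_natCast (κ^(-q)), ← rpow_mul hκ.le, inv_pow, ← mul_assoc, show (-2-2*q) = -q*(2:ℕ) + (-2:ℤ) by push_cast; ring, rpow_add hκ, rpow_intCast]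
    rw [zpow_neg]; norm_cast; ring
  have e2 : ∀ w, 0 < w → κ⁻¹*(w/κ)^(q-1) = κ^(-q)*w^(q-1) := by
    intro w hw
    rw [div_rpow hw.le hκ.le, rpow_sub_one hκ.ne', rpow_neg hκ.le]; field_simp
  rcases lt_trichotomy z a with h | h | h
  · left
    rw [indicator_of_notMem (by simp [h.le]), indicator_of_mem (by exact h), max_eq_left h.le, zero_add]
    have h1 := sub_Ioo (fun w => ((w+κ*(a-z))/κ)^(q-1) * sin w) κ (-κ*a) a b hκ
    rw [show κ*a+-κ*a = 0 by ring, show κ*b+-κ*a = π*k by linarith] at h1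
    have h2 : ∫ x in Ioo a b, (x-z)^(q-1) * sin (κ*(x-a)) = κ^(-q) * ∫ w in Ioo 0 (π*k), (w+κ*(a-z))^(q-1) * sin w := by
      rw [← im] at h1 ⊢
      rw [show (fun x => (x-z)^(q-1) * sin (κ*(x-a))) = fun x => ((κ*x+-κ*a+κ*(a-z))/κ)^(q-1) * sin (κ*x+-κ*a) by ext x; congr 2; (field_simp; ring); ring, h1]
      refine sf mo fun w hw => ?_
      rw [← mul_assoc, ← mul_assoc, e2 _ (by have := hw.1; have := mul_pos hκ (sub_pos.2 h); linarith)]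
    have h3 := tail_bd q (κ*(a-z)) k hq hq1 (mul_pos hκ (sub_pos.2 h))
    rw [h2, show (16*(Gamma q+1)^2*((1+κ*a)-κ*z)^(2*q-2)) = (4*(Gamma q+1)*(1+κ*(a-z))^(q-1))^2 by
      rw [mul_pow, ← rpow_natCast (_^(q-1)), ← rpow_mul (by have := mul_pos hκ (sub_pos.2 h); linarith)]; push_cast; ring_nf, e1, neg_mul, neg_sq]
    rw [mul_pow, mul_pow, mul_pow κ⁻¹ (_*_), mul_pow (κ^(-q)) (_*_)]
    refine ll (ll ?_ (sq_nonneg _)) (sq_nonneg _)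
    exact sq_le_sq.2 (h3.trans (le_abs_self _))
  · exact Or.inr h
  left
  rw [indicator_of_notMem (s := Iio a) (by simp [h.le]), max_eq_right h.le, add_zero]
  rcases le_or_gt b z with hb | hb
  · rw [Ioo_eq_empty (by simp [hb])]; simp
    exact mul_nonneg po (indicator_nonneg (fun _ _ => sq_nonneg _) _)
  rw [indicator_of_mem (by exact ⟨h, hb⟩), e1]
  apply le_of_eq
  have h1 := sub_Ioo' (fun w => ((κ*b-κ*z-w)/κ)^(q-1) * sin (π*k-w)) κ (κ*b) z b hκ
  rw [sub_self] at h1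
  have h2 : ∫ x in Ioo z b, (x-z)^(q-1) * sin (κ*(x-a)) = κ^(-q) * (-cos (π*k) * Sf q (κ*b-κ*z)) := by
    unfold Sf
    rw [← im] at h1 ⊢
    rw [← im]
    rw [show (fun x => (x-z)^(q-1) * sin (κ*(x-a))) = fun x => ((κ*b-κ*z-(κ*b-κ*x))/κ)^(q-1) * sin (π*k-(κ*b-κ*x)) by ext x; rw [← hk]; congr 2; (field_simp; ring); ring, h1]
    refine sf mo fun w hw => ?_
    rw [← mul_assoc, e2 _ (by linarith [hw.2]), sin_sub, mul_comm π, sin_nat_mul_pi]; ring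
  have h3 : cos (π*k)^2 = 1 := by
    have := sin_sq_add_cos_sq (π*k); rw [mul_comm, sin_nat_mul_pi] at this; rw [mul_comm]; simpa using this
  rw [h2]
  linear_combination (κ⁻¹*(κ^(-q)*Sf q (κ*b-κ*z)))^2 * h3
lemma an_bl (n j : ℕ) (hn : 1 ≤ n) (x : ℝ) (hx : x ∈ Ioo dv j n ((j+1)/n)) : an n x = ca j/n := by
  have : 0 ≤ x := le_trans po hx.1.le
  unfold an; rw [(fl_iff n j hn x this).2 ⟨hx.1.le, hx.2⟩]
lemma KO_bl (H : ℝ → ℝ) (n j : ℕ) (hn : 1 ≤ n) (hj : j < n) (F : ℝ → ℝ) (z : ℝ) : KO (T1 H n) (bl n j F) z =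
    cstar (H dv j n) * ∫ x in Ioo dv j n ((j+1)/n), inc (H dv j n-1/2) dv j n x z * F (n*x-j) := by
  unfold KO
  simp_rw [fun x => (mul_comm (T1 H n x z) _).trans (bl_mul n j F (fun x => T1 H n x z) x)]
  rw [bl_set n j hn hj, ← im]
  refine sf mo fun x hx => ?_
  simp only [T1]
  rw [an_bl n j hn x hx]; ring
lemma g1_bd {H : ℝ → ℝ} {Hm HM ε r Ch Cc : ℝ} (X : Ctx H Hm HM ε r Ch Cc) (n j k : ℕ) (hn : 1 ≤ n) (hj : j < n) (hk : 1 ≤ k) (δ : ℝ) (hδ : 0 < δ) (q : ℝ) (hq : q = H dv j n - 1/2) :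
    ‖toE (KO (T1 H n) (bl n j (fc n k)))‖^2 ≤ cstar (H dv j n)^2 * (2/(π*k)) * (π*k*n)^(-2-2*q) *
      ((1+δ)*(Gamma q^2*(π*k/2)) + (1+1/δ)*(Gamma q * ((π*k)^q/q)) + 16*(Gamma q+1)^2/(1-2*q)) := by
  have hn0 := c0p hn
  have hqr := qrange X dv j n
  rw [← hq] at hqr
  have p1 := X.par.h1; have p3 := X.par.h3; have p0 := X.par.e0
  have q0 : 0 < q := li
  set κ := π*k*n with hκd
  have hκ : 0 < κ := po
  set a := ca j/n with ha
  set b := (ca j+1)/n with hb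
  set c := cstar (H a)
  have hab : a < b := by rw [ha, hb]; gcongr; linarith
  have hkk : κ*(b-a) = π*k := by rw [ha, hb, hκd]; field_simp; ring
  have hs := Sf_sq q δ k q0 li hδ
  set G1 := indicator (Ioo a b) (fun z => Sf q (κ*b-κ*z)^2) with hG1
  set G2 := indicator (Iio a) (fun z => 16*(Gamma q+1)^2*((1+κ*a)-κ*z)^(2*q-2)) with hG2
  have i1' : IntegrableOn (fun z => Sf q (κ*b-κ*z)^2) (Ioo a b) := by
    have h1 := hs.1
    rw [← intervalIntegrable_iff_integrableOn_Ioo_of_le po] at h1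
    have h2 := (h1.comp_mul_left (c := -κ)).comp_add_right (-b)
    rw [← intervalIntegrable_iff_integrableOn_Ioo_of_le hab.le]
    convert h2.symm using 1
    · ext z; ring_nf
    · rw [← hkk]; field_simp; ring
    · simp
  have i2' : IntegrableOn (fun z => 16*(Gamma q+1)^2*((1+κ*a)-κ*z)^(2*q-2)) (Ioo 0 a) := by
    refine (ContinuousOn.integrableOn_Icc (ContinuousOn.mul continuousOn_const (ContinuousOn.rpow_const fp fun z hz => Or.inl ?_))).mono_set Ioo_subset_Icc_self
    have := ll hz.2 hκ.le
    linarith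
  have s1 : uI ∩ Ioo a b = Ioo a b := inter_eq_right.2 (blk_sub n j hn hj)
  have s2 : uI ∩ Iio a = Ioo 0 a := by
    have : a ≤ 1 := by rw [ha, div_le_one hn0]; exact_mod_cast hj.le
    ext z; exact ⟨fun h => ⟨h.1.1, h.2⟩, fun h => ⟨⟨h.1, h.2.trans_le this⟩, h.2⟩⟩
  have i1 : Integrable G1 nu := by
    rw [hG1, integrable_indicator_iff mo, IntegrableOn, Measure.restrict_restrict mo, inter_comm, s1]; exact i1'
  have i2 : Integrable G2 nu := by
    rw [hG2, integrable_indicator_iff measurableSet_Iio, IntegrableOn, Measure.restrict_restrict measurableSet_Iio, inter_comm, s2]; exact i2'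
  have v1 : ∫ z, G1 z ∂nu ≤ κ⁻¹*((1+δ)*(Gamma q^2*(π*k/2)) + (1+1/δ)*(Gamma q * ((π*k)^q/q))) := by
    rw [hG1, setIntegral_indicator mo, s1, sub_Ioo' (fun w => Sf q w^2) κ (κ*b) a b hκ, sub_self, ← mul_sub, hkk]
    gcongr; exact hs.2
  have v2 : ∫ z, G2 z ∂nu ≤ κ⁻¹*(16*(Gamma q+1)^2/(1-2*q)) := by
    rw [hG2, setIntegral_indicator measurableSet_Iio, s2, im, sub_Ioo' (fun w => w^(2*q-2)) κ (1+κ*a) 0 a hκ]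
    have h1 : ∫ w in Ioo (1+κ*a-κ*a) (1+κ*a-κ*0), w^(2*q-2) ≤ 1/(1-2*q) := by
      calc _ ≤ ∫ w in Ioi ca 1, w^(2*q-2) := by
            refine setIntegral_mono_set (integrableOn_Ioi_rpow_of_lt li one_pos) ?_ (HasSubset.Subset.eventuallyLE ?_)
            · exact (ae_restrict_iff' mi).2 (ae_of_all _ fun w hw => rpow_nonneg (le_trans zero_le_one (le_of_lt hw)) _)
            · intro w hw; simp at hw ⊢; exact hw.1
        _ = _ := by rw [integral_Ioi_rpow_of_lt li one_pos, one_rpow, neg_div, ← div_neg]; congr 1; ring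
    calc _ ≤ 16*(Gamma q+1)^2*(κ⁻¹*(1/(1-2*q))) := by gcongr
      _ = _ := by ring
  rw [toE_norm (KO_mem (T1_ker X n hn) (fc_bm n j k))]
  have hpt : ∀ᵐ z ∂nu, KO (T1 H n) (bl n j (fc n k)) z^2 ≤ c^2*(2*n)*κ^(-2-2*q)*(G1 z + G2 z) := by
    filter_upwards [(measure_eq_zero_iff_ae_notMem.1 (measure_singleton (μ := nu) a))] with z hz
    have h1 := (ic_bd q a b z k κ q0 li hab hκ hkk).resolve_right hz
    rw [KO_bl H n j hn hj, ← ha, ← hb, ← hq, show (∫ x in Ioo a b, inc q a x z * fc n k (n*x-j)) = √(2*n) * ∫ x in Ioo a b, inc q a x z * cos (κ*(x-a)) by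
      rw [← im]; congr 1; ext x; unfold fc; rw [if_neg (by omega), show π*k*(n*x-j) = κ*(x-a) by rw [hκd, ha]; field_simp]; ring, mul_pow, mul_pow, sq_sqrt po]
    calc _ ≤ c^2*(2*n*(κ^(-2-2*q)*(G1 z + G2 z))) := by gcongr
      _ = _ := by ring
  calc _ ≤ ∫ z, c^2*(2*n)*κ^(-2-2*q)*(G1 z + G2 z) ∂nu := integral_mono_of_nonneg (ae_of_all _ fun _ => sq_nonneg _) ((i1.add i2).const_mul _) hpt
    _ ≤ c^2*(2*n)*κ^(-2-2*q)*(κ⁻¹*((1+δ)*(Gamma q^2*(π*k/2)) + (1+1/δ)*(Gamma q * ((π*k)^q/q))) + κ⁻¹*(16*(Gamma q+1)^2/(1-2*q))) := by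
        rw [im, integral_add i1 i2]; gcongr
    _ = _ := by
        rw [show (2/(π*k)) = 2*n*κ⁻¹ by rw [hκd]; field_simp]; ring
lemma gam_rng (a b : ℝ) (ha : 0 < a) (hab : a ≤ b) : ∃ L > 0, ∃ U > 0, ∀ x ∈ Icc a b, L ≤ Gamma x ∧ Gamma x ≤ U := by
  have hc : ContinuousOn Gamma (Icc a b) := fun x hx => (Gam_cd x (ha.trans_le hx.1)).continuousAt.continuousWithinAt
  obtain ⟨x, hx, h1⟩ := isCompact_Icc.exists_isMinOn (nonempty_Icc.2 hab) hc
  obtain ⟨y, hy, h2⟩ := isCompact_Icc.exists_isMaxOn (nonempty_Icc.2 hab) hc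
  exact ⟨_, gp (ha.trans_le hx.1), _, gp (ha.trans_le hy.1), fun z hz => ⟨h1 hz, h2 hz⟩⟩
lemma k_large (B t : ℝ) (ht : 0 < t) : ∃ k0 : ℕ, 1 ≤ k0 ∧ ∀ k : ℕ, k0 ≤ k → B ≤ (π*k)^t := by
  have h1 : Tendsto (fun k : ℕ => (π*ca k)^t) atTop atTop := (tendsto_rpow_atTop ht).comp (tendsto_natCast_atTop_atTop.const_mul_atTop pi_pos)
  obtain ⟨k0, h⟩ := eventually_atTop.1 (h1.eventually_ge_atTop B)
  exact ⟨k0+1, by omega, fun k hk => h k (by omega)⟩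
lemma pik (k : ℕ) (hk : 1 ≤ k) : 1 ≤ π*k := by
  have : ca 1 ≤ k := by exact_mod_cast hk
  nlinarith [pi_gt_three]
lemma g1_up {H : ℝ → ℝ} {Hm HM ε r Ch Cc : ℝ} (X : Ctx H Hm HM ε r Ch Cc) (δ : ℝ) (hδ : 0 < δ) : ∃ k0 : ℕ, 1 ≤ k0 ∧ ∀ n j k : ℕ, 1 ≤ n → j < n → k0 ≤ k →
    ‖toE (KO (T1 H n) (bl n j (fc n k)))‖^2 ≤ (1+2*δ) * Ah (H dv j n) * (π*k*n)^(-(2*H dv j n+1)) := by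
  have p1 := X.par.h1; have p2 := X.par.h2; have p3 := X.par.h3; have p0 := X.par.e0
  obtain ⟨L, hL, U, hU, hg⟩ := gam_rng (Hm-1/2) (HM-1/2) li li
  set B1 := (1+1/δ)*(U/(Hm-1/2)) with hB1
  set B2 := 16*(U+1)^2/(1-2*(HM-1/2)) with hB2
  have q00 : 0 < Hm-1/2 := li
  have q11 : 0 < 1-2*(HM-1/2) := li
  have hB2' : 0 ≤ B2 := po
  obtain ⟨k0, k1, hk0⟩ := k_large (2*(B1+B2)/(δ*L^2)) (1/2) nn
  refine ⟨k0, k1, fun n j k hn hj hk => (g1_bd X n j k hn hj (k1.trans hk) δ hδ _ rfl).trans ?_⟩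
  have hqr := qrange X dv j n
  set h := H dv j n
  set q := h - 1/2 with hq
  have hy := pik k (k1.trans hk)
  have hk' := hk0 k hk
  set y := π*k with hyd
  have hn0 := c0p hn
  have hA := cstar_sq h li li
  have hG := hg q hqr
  have hGp : 0 < Gamma q := hL.trans_le hG.1
  rw [← hq] at hA
  have qp : 0 < q := q00.trans_le hqr.1
  have qp' : 0 < 1-2*q := by linarith [hqr.2]
  have e1 : (1+1/δ)*(Gamma q * (y^q/q)) + 16*(Gamma q+1)^2/(1-2*q) ≤ δ*Gamma q^2*(y/2) := by
    have ys : y^(1/2:ℝ)*y^(1/2:ℝ) = y := by rw [← rpow_add li]; norm_num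
    have y1 : 1 ≤ y^(1/2:ℝ) := one_le_rpow hy nn
    rw [div_le_iff₀ po] at hk'
    calc _ ≤ (1+1/δ)*(U * (y^(1/2:ℝ)/(Hm-1/2))) + 16*(U+1)^2/(1-2*(HM-1/2)) := by
          gcongr <;> first | exact hG.2 | exact hy | exact hqr.1 | exact hqr.2 | linarith [hqr.2]
      _ = B1*y^(1/2:ℝ) + B2 := by rw [hB1, hB2]; ring
      _ ≤ (B1+B2)*y^(1/2:ℝ) := by nlinarith
      _ ≤ (y^(1/2:ℝ)*(δ*L^2)/2)*y^(1/2:ℝ) := by gcongr; linarith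
      _ = δ*L^2*(y/2) := by linear_combination (δ*L^2/2)*ys
      _ ≤ _ := by gcongr; exact hG.1
  have e2 : -(2*h+1) = -2-2*q := by rw [hq]; ring
  rw [e2, ← hA]
  calc _ ≤ cstar h^2*(2/y)*(y*n)^(-2-2*q)*((1+δ)*(Gamma q^2*(y/2)) + δ*Gamma q^2*(y/2)) := by
        refine ll ?_ po; linarith
    _ = _ := by field_simp; ring
lemma U_up (q0 q1 δ : ℝ) (h0 : 0 < q0) (h01 : q0 ≤ q1) (h1 : q1 < 1/2) (hδ : 0 < δ) : ∃ k0 : ℕ, 1 ≤ k0 ∧ ∀ k : ℕ, k0 ≤ k → ∀ q ∈ Icc q0 q1,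
    ∫ y in Ioo 0 (π*k), Uf q y^2 ≤ (1+2*δ)*(π*k/2) := by
  obtain ⟨L, hL, U, hU, hg⟩ := gam_rng (1-q1) (1-q0) li li
  have q11 : 0 < 1-2*q1 := li
  obtain ⟨k0, k1, hk0⟩ := k_large (2*(1+1/δ)/(δ*L^2*(1-2*q1))) (2*q0) li
  refine ⟨k0, k1, fun k hk q hq => (Uf_sq q δ k (h0.trans_le hq.1) (by linarith [hq.2]) hδ).2.trans ?_⟩
  have hy := pik k (k1.trans hk)
  have hk' := hk0 k hk
  set y := π*k with hyd
  have hG := (hg (1-q) ⟨by linarith [hq.2], by linarith [hq.1]⟩).1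
  rw [div_le_iff₀ po] at hk'
  have qp' : 0 < 1-2*q := by linarith [hq.2]
  have e : (1+1/δ)*((Gamma (1-q)^2)⁻¹*(y^(1-2*q)/(1-2*q))) ≤ δ*(y/2) := by
    calc _ ≤ (1+1/δ)*((L^2)⁻¹*(y^(1-2*q0)/(1-2*q1))) := by
          gcongr <;> first | exact hy | exact hq.1 | exact hq.2 | linarith [hq.2]
      _ ≤ (y^(2*q0)*(δ*L^2*(1-2*q1))/2)*((L^2)⁻¹*(y^(1-2*q0)/(1-2*q1))) := by gcongr; linarith
      _ = δ*(y^(2*q0)*y^(1-2*q0)/2) := by field_simp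
      _ = _ := by rw [← rpow_add li]; ring_nf; rw [rpow_one]
  linarith
lemma g1_all {H : ℝ → ℝ} {Hm HM ε r Ch Cc : ℝ} (X : Ctx H Hm HM ε r Ch Cc) (n j k : ℕ) (hn : 1 ≤ n) (hj : j < n) :
    ‖toE (KO (T1 H n) (bl n j (fc n k)))‖^2 ≤ (Cc/(Hm-1/2))^2 := by
  have := HS {((⟨j,hj⟩ : Fin n),k)} (fun i : Fin n × ℕ => bl n i.1 (fc n i.2)) (fun i => fc_bm _ _ _) (fc_on n hn) (T1_ker X n hn)
  simp only [Finset.sum_singleton] at this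
  refine this.trans ?_
  have e : volume.real (uI) = 1 := by simp
  have h1 : ∀ x ∈ uI, ∫ z, T1 H n x z^2 ∂nu ≤ (Cc/(Hm-1/2))^2 := by
    intro x hx
    have := norm_setIntegral_le_of_norm_le_const (μ := volume) (s := uI) (f := fun z => T1 H n x z^2) (C := (Cc/(Hm-1/2))^2) (by simp) fun z hz => by
      rw [na, abs_pow]; exact pow_le_pow_left₀ (abs_nonneg _) (T1_bd X n hn x z hx hz) 2
    rw [e, mul_one] at this; exact (le_abs_self _).trans this
  have := norm_setIntegral_le_of_norm_le_const (μ := volume) (s := uI) (f := fun x => ∫ z, T1 H n x z^2 ∂nu) (C := (Cc/(Hm-1/2))^2) (by simp) fun x hx => by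
      rw [na, abs_of_nonneg (integral_nonneg fun _ => sq_nonneg _)]; exact h1 x hx
  rw [e, mul_one] at this; exact (le_abs_self _).trans this
section
def cc (B p : ℝ) (n : ℕ) : ℝ := B^(1/p)/(π*n)
lemma cc_pow (B p : ℝ) (n k : ℕ) (hB : 0 < B) (hp : 1 < p) (hn : 1 ≤ n) : (ca k/cc B p n)^(-p) = B*(π*k*n)^(-p) := by
  unfold cc
  rw [show ca k/(B^(1/p)/(π*n)) = (π*k*n)/B^(1/p) by field_simp, div_rpow po po, ← rpow_mul hB.le, show 1/p*(-p) = -1 by field_simp, rpow_neg_one]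
  field_simp
lemma cc_pos (B p : ℝ) (n : ℕ) (hB : 0 < B) (hn : 1 ≤ n) : 0 < cc B p n := by
  unfold cc; positivity
lemma cc_up (t γ h : ℝ) (n : ℕ) (hh : 1/2 < h) (hh1 : h < 1) (ht : 1 ≤ t) (hγ : 0 < γ) (hn : 1 ≤ n) :
    cc (t*γ*Ah h) (2*h+1) n * (π/sin (π/(2*h+1))) ≤ t*(1/n*Gh h*γ^(1/(2*h+1))) := by
  have hA := Ah_pos h hh hh1
  have hs := sinp_pos h hh
  unfold cc Gh
  rw [mul_rpow po hA.le, mul_rpow po hγ.le]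
  have : t^(1/(2*h+1)) ≤ t := by
    calc _ ≤ t^ca 1 := rl ht (by rw [div_le_one li]; linarith)
      _ = t := rpow_one t
  calc _ = t^(1/(2*h+1)) * (1/n*(Ah h^(1/(2*h+1))/sin (π/(2*h+1)))*γ^(1/(2*h+1))) := by field_simp
    _ ≤ _ := by gcongr
variable {H : ℝ → ℝ} {Hm HM ε r Ch Cc : ℝ}
lemma KO3 (X : Ctx H Hm HM ε r Ch Cc) (n M : ℕ) (hn : 1 ≤ n) {e : ℝ → ℝ} (he : BM e) :
    toE (KO (KK H) e) = toE (KO (T1 H n) e) + toE (KO (T2 H n M) e) + toE (KO (T3 H n M) e) := by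
  rw [KK_split H n M, KO_add ((T1_ker X n hn).add (T2_ker X n M hn)) (T3_ker X n M hn) he, KO_add (T1_ker X n hn) (T2_ker X n M hn) he]
def T3E (Hm ε r a0 : ℝ) (n M : ℕ) : ℝ := ((1/n:ℝ)^r*(1/n:ℝ)^(Hm-3*ε) + (1/n:ℝ)/a0 + ((1/n:ℝ)^r)^M)^2 + (a0+1/n)*((1/n:ℝ)^(Hm-3*ε) + ((1/n:ℝ)^r)^M)^2
lemma up1 (X : Ctx H Hm HM ε r Ch Cc) {H' : ℝ → ℝ} [MeasurableSpace EE] [BorelSpace EE] {μ : Measure EE} (Z : GM H H' μ)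
    (M : ℕ) (δ : ℝ) (hδ : 0 < δ) (hδ1 : δ ≤ 1) : ∃ k0 : ℕ, ∃ C > 0, ∀ n : ℕ, 1 ≤ n → Ch * (1/n:ℝ)^r ≤ ε/2 → ∀ a0 > 0, ∀ γ ≥ 1,
    Flog μ γ ≤ (1+δ)*(1+2*δ)*∑ j ∈ rg n, 1/n*Gh (H dv j n)*γ^(1/(2*H dv j n+1)) + n*(k0+M)*log (1+C*γ*n) + C*γ*T3E Hm ε r a0 n M := by
  classical
  obtain ⟨k0, k1, hk0⟩ := g1_up X δ hδ
  obtain ⟨C2, hC2, hr2⟩ := rank_bd X M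
  obtain ⟨C3, hC3, hr3⟩ := T3_HS X M
  set C1 := (Cc/(Hm-1/2))^2
  have hC10 : 0 ≤ C1 := sq_nonneg _
  have p1 := X.par.h1; have p3 := X.par.h3; have p0 := X.par.e0
  refine ⟨k0, 2*C1+4/δ*C2+4/δ*C3, po, fun n hn hη a0 ha0 γ hγ => ?_⟩
  have hγ0 : 0 < γ := li
  have hn1 : ca 1 ≤ n := by exact_mod_cast hn
  set C := 2*C1+4/δ*C2+4/δ*C3 with hC
  have q2 : 0 < 4/δ*C2 := po
  set e : Fin n × ℕ → ℝ → ℝ := fun i => bl n i.1 (fc n i.2)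
  have he : ∀ i, BM (e i) := fun i => fc_bm _ _ _
  have ho : Orthonormal ℝ (fun i => toE (e i)) := fc_on n hn
  haveI := Z.p; refine F_upper μ Z.g (fcB n hn) (fun i k => inner ℝ (toE (KO (KK H) (e i))) (toE (KO (KK H) (e k)))) (fun i k => by rw [fcB_apply, fcB_apply]; exact cov_eq X H' Z.e μ Z.c (he i) (he k)) γ hγ0.le _ fun s => ?_
  have eg : (Matrix.of fun i j : s => inner ℝ (toE (KO (KK H) (e i))) (toE (KO (KK H) (e j)))) = Matrix.gram ℝ (fun i : s => toE (KO (T1 H n) (e i)) + toE (KO (T2 H n M) (e i)) + toE (KO (T3 H n M) (e i))) := by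
    ext i j; rw [Matrix.of_apply, Matrix.gram_apply, KO3 X n M hn (he i), KO3 X n M hn (he j)]
  rw [eg]
  refine ⟨la_one_le _ (gram_psd _ γ hγ0.le), (la_upper _ _ _ γ δ hγ0 hδ hδ1).trans ?_⟩
  set L := log (1+C*γ*n)
  have hLn : 0 < 1+C*γ*n := po
  have hL0 : 0 ≤ L := log_nonneg (by have : 0 ≤ C*γ*n := po
                                     linarith)
  have hq := fun j : ℕ => qrange X dv j n
  have h1 : ∀ j : ℕ, 1/2 < H dv j n := fun j => by linarith [(hq j).1]
  have h2 : ∀ j : ℕ, H dv j n < 1 := fun j => by linarith [(hq j).2]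
  set c : ℕ → ℝ := fun j => cc ((1+δ)*(1+2*δ)*γ*Ah (H dv j n)) (2*H dv j n+1) n
  have hBp : ∀ j : ℕ, 0 < (1+δ)*(1+2*δ)*γ*Ah (H dv j n) := fun j => mul_pos po (Ah_pos _ (h1 j) (h2 j))
  have a1 : (∏ i : s, (1 + (1+δ)*γ*‖toE (KO (T1 H n) (e i))‖^2)) ≤ exp ((1+δ)*(1+2*δ)*(∑ j ∈ rg n, 1/n*Gh (H dv j n)*γ^(1/(2*H dv j n+1))) + n*k0*L) := by
    set f : Fin n × ℕ → ℝ := fun i => if i.2 < k0 then L else log (1+((i.2:ℝ)/c i.1)^(-(2*H ((i.1:ℕ)/n:ℝ)+1))) with hf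
    have b1 : ∀ i, 1 + (1+δ)*γ*‖toE (KO (T1 H n) (e i))‖^2 ≤ exp (f i) := by
      intro i
      simp only [hf]
      split_ifs with hi
      · rw [exp_log hLn]
        have := g1_all X n i.1 i.2 hn i.1.2
        have h3 : C1*γ*1 ≤ C1*γ*n := by gcongr
        have h4 : 0 ≤ (4/δ*C2+4/δ*C3)*γ*n := po
        have : (1+δ)*γ*‖toE (KO (T1 H n) (e i))‖^2 ≤ 2*γ*C1 := by gcongr; linarith
        rw [hC]; nlinarith
      · have hc := cc_pow _ (2*H ((i.1:ℕ)/n:ℝ)+1) n i.2 (hBp i.1) (by linarith [h1 i.1]) hn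
        have := hk0 n i.1 i.2 hn i.1.2 (not_lt.1 hi)
        have h5 : 0 ≤ ((i.2:ℝ)/c i.1)^(-(2*H ((i.1:ℕ)/n:ℝ)+1)) := rpow_nonneg (div_nonneg po (cc_pos _ _ _ (hBp i.1) hn).le) _
        rw [exp_log li, hc]
        have := ll this (show 0 ≤ (1+δ)*γ by positivity)
        linarith
    have f0 : ∀ i, 0 ≤ f i := by
      intro i
      have := (le_add_of_nonneg_right (show 0 ≤ (1+δ)*γ*‖toE (KO (T1 H n) (e i))‖^2 by positivity)).trans (b1 i)
      exact one_le_exp_iff.1 this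
    calc _ ≤ ∏ i : s, exp (f i) := Finset.prod_le_prod (fun i _ => po) fun i _ => b1 i
      _ = exp (∑ i ∈ s, f i) := by rw [← exp_sum, Finset.sum_coe_sort s f]
      _ ≤ _ := exp_le_exp.2 ?_
    set N := s.sup (fun i => i.2) + 1
    calc ∑ i ∈ s, f i ≤ ∑ i ∈ Finset.univ ×ˢ rg N, f i := Finset.sum_le_sum_of_subset_of_nonneg (fun i hi => by exact Finset.mem_product.2 ⟨Finset.mem_univ _, Finset.mem_range.2 (Nat.lt_succ_of_le (Finset.le_sup (f := fun i : Fin n × ℕ => i.2) hi))⟩) fun i _ _ => f0 i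
      _ = ∑ j ∈ rg n, ∑ k ∈ rg N, (if k < k0 then L else log (1+(ca k/c j)^(-(2*H dv j n+1)))) := by
          rw [Finset.sum_product, Finset.sum_range]
      _ ≤ ∑ j ∈ rg n, (k0*L + (1+δ)*(1+2*δ)*(1/n*Gh (H dv j n)*γ^(1/(2*H dv j n+1)))) := by
          refine Finset.sum_le_sum fun j _ => ?_
          rw [Finset.sum_ite]
          refine add_le_add ?_ ((sum_up _ _ (by linarith [h1 j]) (cc_pos _ _ _ (hBp j) hn) _ ?_).trans (cc_up _ _ _ n (h1 j) (h2 j) nl hγ0 hn))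
          · rw [Finset.sum_const, nsmul_eq_mul]
            refine lr (Nat.cast_le.2 ?_) hL0
            calc _ ≤ (rg k0).card := Finset.card_le_card fun k hk => by simp at hk ⊢; exact hk.2
              _ = k0 := Finset.card_range _
          · intro k hk; simp at hk; omega
      _ = _ := by rw [Finset.sum_add_distrib, Finset.sum_const, Finset.card_range, nsmul_eq_mul, ms, add_comm, mul_assoc ca n]
  have a2 : (1 + (γ*(4/δ)) • Matrix.gram ℝ (fun i : s => toE (KO (T2 H n M) (e i)))).det ≤ exp (n*M*L) := by
    refine (hr2 n hn s (fun i => e i) (fun i => he i) (ho.comp _ Subtype.val_injective) _ po).trans ?_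
    rw [show ca n*M*L = ((n*M:ℕ):ℝ)*L by push_cast; ring, exp_nat_mul, exp_log hLn]
    refine pow_le_pow_left₀ po ?_ _
    have : 0 ≤ (2*C1+4/δ*C3)*γ*n := po
    rw [hC]; linarith
  have a3 : γ*(4/δ)*∑ i : s, ‖toE (KO (T3 H n M) (e i))‖^2 ≤ C*γ*T3E Hm ε r a0 n M := by
    rw [Finset.sum_coe_sort s (fun i => ‖toE (KO (T3 H n M) (e i))‖^2)]
    have hT : 0 ≤ T3E Hm ε r a0 n M := by unfold T3E; positivity
    calc _ ≤ γ*(4/δ)*(C3*T3E Hm ε r a0 n M) := by gcongr; exact (HS s e he ho (T3_ker X n M hn)).trans (hr3 n hn hη a0 ha0)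
      _ = (4/δ*C3)*γ*T3E Hm ε r a0 n M := by ring
      _ ≤ _ := by gcongr; rw [hC]; linarith
  calc _ ≤ exp ((1+δ)*(1+2*δ)*(∑ j ∈ rg n, 1/n*Gh (H dv j n)*γ^(1/(2*H dv j n+1))) + n*k0*L) * exp (n*M*L) * exp (C*γ*T3E Hm ε r a0 n M) := by
        gcongr
        exact zero_le_one.trans (la_one_le _ (gram_psd _ _ po))
    _ = _ := by rw [← exp_add, ← exp_add]; ring_nf
end
section
variable {H : ℝ → ℝ} {Hm HM ε r Ch Cc : ℝ}
lemma Ker.secz {k : ℝ → ℝ → ℝ} (h : Ker ε k) {x : ℝ} (hx : x ∈ uI) : MemLp (k x) 2 nu := by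
  obtain ⟨C, c0, hC⟩ := h.bd
  exact mem_zs h.e0 (h.meas.comp (measurable_const.prodMk measurable_id)) C (hC x hx)
lemma KO_dual {k : ℝ → ℝ → ℝ} (h : Ker ε k) {e u : ℝ → ℝ} (he : BM e) (hum : Measurable u) (hu : MemLp u 2 nu) :
    inner ℝ (toE (KO k e)) (toE u) = ∫ x, e x * (∫ z, k x z * u z ∂nu) ∂nu := by
  rw [toE_inner (KO_mem h he) hu]
  simp_rw [KO, ← im, ← integral_mul_const]
  rw [integral_integral_swap]
  · congr 1; ext x; congr 1; ext z; ring
  obtain ⟨C, c0, hC⟩ := h.bd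
  obtain ⟨hm, B, b0, hB⟩ := he
  have h1 : Integrable (fun p : ℝ × ℝ => (p.1^em ε * |u p.1|) * 1) (nu.prod nu) := ((zs_mem ε h.e0).integrable_mul hu.abs).mul_prod (integrable_const ca 1)
  refine (h1.const_mul (C*B)).mono' ?_ (ae_nu2 fun z hz x hx => ?_)
  · exact ((((h.meas.comp measurable_swap).mul (hm.comp measurable_snd)).mul (hum.comp measurable_fst))).aestronglyMeasurable
  · simp only [Function.uncurry_apply_pair, na, abs_mul]
    have z0 : 0 ≤ z^em ε := rpow_nonneg hz.1.le _
    calc _ ≤ (C*z^em ε)*B*|u z| := by gcongr; exacts [hC x hx z hz, hB x]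
      _ = _ := by ring
def lam (H : ℝ → ℝ) (n j k : ℕ) : ℝ := √(2*n)*(π*k*n)^(H dv j n+1/2)/(cstar (H dv j n)*Gamma (H dv j n-1/2))
def ud (H : ℝ → ℝ) (n j k : ℕ) : ℝ → ℝ := bl n j (fun y => lam H n j k * Uf (H dv j n-1/2) (π*k*y))
lemma bl_meas (n j : ℕ) (F : ℝ → ℝ) (hF : Measurable F) : Measurable (bl n j F) := by
  unfold bl
  exact Measurable.ite (measurableSet_eq_fun fp measurable_const) fp measurable_const
lemma ud_meas (H : ℝ → ℝ) (n j k : ℕ) : Measurable (ud H n j k) := bl_meas n j _ (by have := Uf_meas (H dv j n-1/2); fun_prop)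
lemma ud_sq (X : Ctx H Hm HM ε r Ch Cc) (n j k : ℕ) (hn : 1 ≤ n) (hj : j < n) (hk : 1 ≤ k) : MemLp (ud H n j k) 2 nu ∧
    ‖toE (ud H n j k)‖^2 = (π*k*n)^(2*H dv j n+1)/Ah (H dv j n)*((2/(π*k)) * ∫ y in Ioo 0 (π*k), Uf (H dv j n-1/2) y^2) := by
  have hqr := qrange X dv j n
  have p1 := X.par.h1; have p3 := X.par.h3; have p0 := X.par.e0
  set h := H dv j n with hh
  have iU := (Uf_sq (h-1/2) 1 k li li one_pos).1
  set l := lam H n j k with hl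
  have i1 : IntegrableOn (fun x => (l * Uf (h-1/2) (π*k*(n*x-j)))^2) (Ioo dv j n ((j+1)/n)) := by
    simp_rw [mul_pow]
    refine Integrable.const_mul ?_ _
    have h1 := iU
    rw [← intervalIntegrable_iff_integrableOn_Ioo_of_le po] at h1
    have h2 := (h1.comp_mul_left (c := π*k*n)).comp_sub_right (j/n:ℝ)
    rw [← IntegrableOn, ← intervalIntegrable_iff_integrableOn_Ioo_of_le (by gcongr; linarith)]
    convert h2 using 1
    · ext x; congr 2; field_simp
    · simp
    · field_simp; ring
  have hM : MemLp (ud H n j k) 2 nu := by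
    rw [memLp_two_iff_integrable_sq (ud_meas H n j k).aestronglyMeasurable]
    refine Integrable.mono' (g := indicator (Ico dv j n ((j+1)/n)) (fun x => (l * Uf (h-1/2) (π*k*(n*x-j)))^2)) ?_ ((ud_meas H n j k).pow_const 2).aestronglyMeasurable (ae_nu fun x hx => ?_)
    · rw [← integrableOn_Ico_iff_integrableOn_Ioo] at i1
      exact (i1.integrable_indicator measurableSet_Ico).integrableOn
    · rw [na, abs_of_nonneg (sq_nonneg _)]
      by_cases hf : ⌊ca n*x⌋₊ = j
      · rw [indicator_of_mem ((fl_iff n j hn x hx.1.le).1 hf), ud, bl, if_pos hf]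
      · rw [ud, bl, if_neg hf]; simp; exact indicator_nonneg (fun _ _ => sq_nonneg _) _
  refine ⟨hM, ?_⟩
  rw [toE_norm hM]
  simp_rw [sq (ud H n j k _), ud]
  rw [bl_int n j hn hj]
  have e1 := sub_Ioo (fun w => Uf (h-1/2) w^2) (π*k) 0 0 1 po
  simp only [add_zero, mul_zero, mul_one] at e1
  rw [show (fun y => lam H n j k * Uf (H dv j n-1/2) (π*k*y) * (lam H n j k * Uf (H dv j n-1/2) (π*k*y))) = fun y => l^2 * Uf (h-1/2) (π*k*y)^2 by ext y; ring, im, e1]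
  have hA := cstar_sq h li li
  have hAp := Ah_pos h li li
  have e2 : l^2 = 2*n*(π*k*n)^(2*h+1)/Ah h := by
    rw [hl, lam, div_pow, mul_pow, mul_pow, ← hh, hA, sq_sqrt po, ← rpow_natCast, ← rpow_mul po]
    congr 3; push_cast; ring
  rw [e2]; field_simp
lemma ud_lo (q : ℝ) (k : ℕ) (hq : 0 < q) (hq1 : q < 1/2) (hk : 1 ≤ k) : Gamma (1+q)^2/4 ≤ ∫ y in Ioo 0 (π*k), Uf q y^2 := by
  have hpi := pi_gt_three
  have hpi' := pi_lt_four
  have iU := (Uf_sq q 1 k hq hq1 one_pos).1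
  have hk1 : ca 1 ≤ k := by exact_mod_cast hk
  have hU := U_inv q (π/2) hq li li
  rw [sin_pi_div_two, mul_one] at hU
  have ss : Ioo 0 (π/2) ⊆ Ioo 0 (π*k) := Ioo_subset_Ioo_right nl
  have i2 := iU.mono_set ss
  have g0 : 0 < Gamma (1+q) := gp li
  have h1 : Gamma (1+q) ≤ ∫ w in Ioo 0 (π/2), (Gamma (1+q)/4 + 2/Gamma (1+q)*Uf q w^2) := by
    rw [← hU]
    refine setIntegral_mono_on ?_ (by rw [hU]; exact (integrableOn_const (by simp)).add (i2.const_mul _)) mo fun w hw => ?_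
    · by_contra hni
      rw [integral_undef hni] at hU; linarith
    · rw [hU]
      have h2 : (π/2-w)^q ≤ √2 := by
        have : (π/2-w)^q ≤ 2^(1/2:ℝ) := by
          calc _ ≤ ca 2^q := rpow_le_rpow (by linarith [hw.2]) (by linarith [hw.1]) hq.le
            _ ≤ _ := rl nn hq1.le
        rwa [← sqrt_eq_rpow] at this
      have h3 : (π/2-w)^q * Uf q w ≤ √2*|Uf q w| := (ll (le_abs_self _) (rpow_nonneg (by linarith [hw.2]) _)).trans (by gcongr)
      refine h3.trans ?_
      set G := Gamma (1+q)
      have s2 : √2^2 = 2 := sq_sqrt nn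
      have : 0 ≤ (G/2 - √2*|Uf q w|)^2/G := po
      have e : (G/2 - √2*|Uf q w|)^2/G = G/4 + 2/G*Uf q w^2 - √2*|Uf q w| := by
        field_simp; rw [← sq_abs (Uf q w)]; ring_nf; rw [s2]; ring
      linarith
  have ic : IntegrableOn (fun _ : ℝ => Gamma (1+q)/4) (Ioo 0 (π/2)) := integrableOn_const (by simp)
  rw [integral_add ic (i2.const_mul _), im, setIntegral_const] at h1
  have h4 : ∫ w in Ioo 0 (π/2), Uf q w^2 ≤ ∫ y in Ioo 0 (π*k), Uf q y^2 := setIntegral_mono_set iU (ae_of_all _ fun _ => sq_nonneg _) (HasSubset.Subset.eventuallyLE ss)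
  simp only [Measure.real, volume_Ioo, sub_zero, smul_eq_mul, ENNReal.toReal_ofReal (show ca 0 ≤ π/2 by linarith)] at h1
  have h5 : Gamma (1+q)/2 ≤ 2/Gamma (1+q)*∫ w in Ioo 0 (π/2), Uf q w^2 := by nlinarith
  rw [div_mul_eq_mul_div, le_div_iff₀ g0] at h5
  nlinarith
lemma T1_dual (X : Ctx H Hm HM ε r Ch Cc) (n j k : ℕ) (hn : 1 ≤ n) (hj : j < n) (hk : 1 ≤ k) (x : ℝ) (hx : x ∈ Ioo dv j n ((j+1)/n)) :
    ∫ z, T1 H n x z * ud H n j k z ∂nu = fs n k (n*x-j) := by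
  have hqr := qrange X dv j n
  have p1 := X.par.h1; have p3 := X.par.h3; have p0 := X.par.e0
  set a := ca j/n with ha
  set q := H a - 1/2 with hq
  have q0 : 0 < q := li
  set κ := π*k*n with hκd
  have hκ : 0 < κ := po
  have hc := (X.cpos a).1
  simp_rw [fun z => (mul_comm (T1 H n x z) _), ud, bl_mul n j _ (fun z => T1 H n x z)]
  rw [bl_set n j hn hj, setIntegral_eq_of_subset_of_forall_diff_eq_zero (s := Ioo a x) mo (Ioo_subset_Ioo_right hx.2.le)]
  · have e1 := sub_Ioo (fun w => ((κ*(x-a)-w)/κ)^q * Uf q w) κ (-κ*a) a x hκ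
    have hy : 0 < κ*(x-a) := mul_pos hκ (sub_pos.2 hx.1)
    rw [show κ*a+-κ*a = 0 by ring, show κ*x+-κ*a = κ*(x-a) by ring] at e1
    have e2 : ∫ w in Ioo 0 (κ*(x-a)), ((κ*(x-a)-w)/κ)^q * Uf q w = κ^(-q)*(Gamma (1+q)*sin (κ*(x-a))) := by
      rw [← U_inv q _ q0 li hy, ← im]
      refine sf mo fun w hw => ?_
      rw [div_rpow (by linarith [hw.2]) hκ.le, rpow_neg hκ.le]; field_simp
    rw [e2] at e1
    calc _ = ∫ z in Ioo a x, (lam H n j k * cstar (H a)/q) * (((κ*(x-a)-(κ*z+-κ*a))/κ)^q * Uf q (κ*z+-κ*a)) := by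
          refine sf mo fun z hz => ?_
          simp only [T1]
          rw [an_bl n j hn x hx, ← ha, ← hq, inc, max_eq_right (show a-z ≤ 0 by linarith [hz.1]), max_eq_left (by linarith [hz.2]), zero_rpow q0.ne', sub_zero,
            show (κ*(x-a)-(κ*z+-κ*a))/κ = x-z by field_simp; ring, show κ*z+-κ*a = π*k*(n*z-j) by rw [hκd, ha]; field_simp; ring]
          ring
      _ = fs n k (n*x-j) := by
          rw [im, e1, lam, fs, show H dv j n+1/2 = q+1 by rw [hq, ha]; ring, ← ha, ← hq, ← hκd, add_comm 1 q, Gamma_add_one q0.ne', rpow_add hκ, rpow_one, rpow_neg hκ.le, show π*k*(n*x-j) = κ*(x-a) by rw [hκd, ha]; field_simp]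
          have := rpow_pos_of_pos hκ q
          field_simp
  · intro z hz
    have h1 : x ≤ z := by by_contra h'; exact hz.2 ⟨hz.1.1, not_le.1 h'⟩
    simp only [T1]
    rw [an_bl n j hn x hx, ← ha, ← hq, inc, max_eq_right li, max_eq_right (show a-z ≤ 0 by linarith [hz.1.1])]; simp
end
section
variable {H : ℝ → ℝ} {Hm HM ε r Ch Cc : ℝ}
def bt (Hm ε r a0 : ℝ) (n M : ℕ) : ℝ := (1/n:ℝ)^r*(1/n:ℝ)^(Hm-3*ε) + (1/n:ℝ)/a0 + ((1/n:ℝ)^r)^M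
lemma fs_on (n j k j' k' : ℕ) (hn : 1 ≤ n) (hj : j < n) (hk : 1 ≤ k) (hk' : 1 ≤ k') : ∫ x, bl n j' (fs n k') x * bl n j (fs n k) x ∂nu = if j' = j ∧ k' = k then 1 else 0 := by
  by_cases h : j' = j
  · subst h; rw [bl_int n j' hn hj, fs_orth n k' k hn hk' hk]; simp
  · rw [bl_off n j' j h]; simp [h]
lemma dual (X : Ctx H Hm HM ε r Ch Cc) (M : ℕ) : ∃ C > 0, ∀ n : ℕ, 1 ≤ n → Ch * (1/n:ℝ)^r ≤ ε/2 → ∀ a0 > 0, ∀ j k : ℕ, j < n → a0 ≤ ca j/n → 1 ≤ k →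
    ∃ W : ℝ → ℝ, MemLp W 2 nu ∧ ∫ x, W x^2 ∂nu ≤ (C*bt Hm ε r a0 n M)^2*(1/n)*‖toE (ud H n j k)‖^2 ∧
    ∀ j' k' : ℕ, j' ≤ j → 1 ≤ k' → inner ℝ (toE (KO (KK H) (bl n j' (fs n k')))) (toE (ud H n j k)) = (if j' = j ∧ k' = k then 1 else 0) + ∫ x, W x * bl n j' (fs n k') x ∂nu := by
  obtain ⟨C, c0, hC⟩ := T3_bd X M
  have e0 := X.par.e0
  refine ⟨C*√(3/ε), po, fun n hn hη a0 ha0 j k hj haj hk => ?_⟩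
  obtain ⟨uM, -⟩ := ud_sq X n j k hn hj hk
  set u := ud H n j k with hu
  have um : Measurable u := ud_meas H n j k
  have kT1 := T1_ker X n hn
  have kT2 := T2_ker X n M hn
  have kT3 := T3_ker X n M hn
  have han : ∀ x, ⌊ca n*x⌋₊ = j → an n x = ca j/n := fun x hx => by unfold an; rw [hx]
  set B := C*bt Hm ε r a0 n M with hB
  set Q := B^2*(3/ε)*‖toE u‖^2 with hQ
  have Q0 : 0 ≤ Q := po
  set V : ℝ → ℝ := fun x => ∫ z, T3 H n M x z * u z ∂nu with hV
  have Vm : Measurable V := by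
    have : StronglyMeasurable (fun p : ℝ × ℝ => T3 H n M p.1 p.2 * u p.2) := (kT3.meas.mul (um.comp measurable_snd)).stronglyMeasurable
    exact (this.integral_prod_right' (ν := nu)).measurable
  have Vb : ∀ x ∈ uI, ⌊ca n*x⌋₊ = j → V x^2 ≤ Q := by
    intro x hx hf
    have h1 := (T3_sec X n M hn x hx B fun z hz hne => by rw [hB, bt]; exact (hC n hn hη x hx z hz hne).2 a0 ha0 (by rw [han x hf]; exact haj)).2
    rw [hV]; simp only
    rw [← toE_inner (kT3.secz hx) uM, ← sq_abs]
    calc _ ≤ (‖toE (T3 H n M x)‖*‖toE u‖)^2 := pow_le_pow_left₀ (abs_nonneg _) (abs_real_inner_le_norm _ _) 2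
      _ = (∫ z, T3 H n M x z^2 ∂nu)*‖toE u‖^2 := by rw [mul_pow, toE_norm (kT3.secz hx)]
      _ ≤ _ := by rw [hQ]; gcongr
  set W : ℝ → ℝ := fun x => if ⌊ca n*x⌋₊ = j then V x else 0 with hW
  have Wm : Measurable W := Measurable.ite (measurableSet_eq_fun fp measurable_const) Vm measurable_const
  have WM : MemLp W 2 nu := MemLp.of_bound Wm.aestronglyMeasurable (√Q) (ae_nu fun x hx => by
    simp only [hW]
    split_ifs with h
    · exact abs_le_sqrt (Vb x hx h)
    · simp)
  refine ⟨W, WM, ?_, fun j' k' hj' hk' => ?_⟩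
  · have e1 : ∀ x, W x^2 = if ⌊ca n*x⌋₊ = j then V x^2 else 0 := fun x => by simp only [hW]; split_ifs <;> simp
    calc ∫ x, W x^2 ∂nu ≤ ∫ x, (if ⌊ca n*x⌋₊ = j then Q else 0) ∂nu := by
          refine integral_mono_of_nonneg (ae_of_all _ fun _ => sq_nonneg _) ?_ (ae_nu fun x hx => ?_)
          · exact (MemLp.of_bound (p := 1) ((Measurable.ite (measurableSet_eq_fun fp measurable_const) measurable_const measurable_const)).aestronglyMeasurable Q (ae_of_all _ fun x => by
              split_ifs <;> simp [abs_of_nonneg Q0, Q0])).integrable le_rfl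
          · simp only [e1]; split_ifs with h
            exacts [Vb x hx h, le_rfl]
      _ = _ := by
          rw [bl_set n j hn hj, setIntegral_const, volume_real_Ioo_of_le (by gcongr; linarith), hQ, hB, mul_right_comm C, mul_pow _ (√(3/ε)), sq_sqrt po, smul_eq_mul]; field_simp; ring
  have i1 : Integrable (fun x => bl n j' (fs n k') x * bl n j (fs n k) x) nu := (fs_bm n j' k').mem.integrable_mul (fs_bm n j k).mem
  have i2 : Integrable (fun x => W x * bl n j' (fs n k') x) nu := WM.integrable_mul (fs_bm n j' k').mem
  rw [KO_dual (KK_ker X) (fs_bm n j' k') um uM, ← fs_on n j k j' k' hn hj hk hk', ← integral_add i1 i2]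
  have hne : ∀ᵐ x ∂nu, x ≠ ca j/n := ae_restrict_of_ae (by simp [ae_iff])
  refine integral_congr_ae ?_
  filter_upwards [hne, ae_nu (fun x hx => hx)] with x hx1 hx
  by_cases hf' : ⌊ca n*x⌋₊ = j'
  swap
  · simp [bl, hf']
  have uz : ∀ z ∈ uI, u z ≠ 0 → ca j/n ≤ z := by
    intro z hz h
    have : ⌊ca n*z⌋₊ = j := by by_contra h'; exact h (by rw [hu, ud, bl, if_neg h'])
    exact ((fl_iff n j hn z hz.1.le).1 this).1
  rcases hj'.eq_or_lt with rfl | hlt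
  · have hxI := (fl_iff n j' hn x hx.1.le).1 hf'
    have t1 := T1_dual X n j' k hn hj hk x ⟨lt_of_le_of_ne hxI.1 (Ne.symm hx1), hxI.2⟩
    have t2 : ∫ z, T2 H n M x z * u z ∂nu = 0 := by
      rw [← integral_zero ℝ ℝ (μ := nu)]
      refine integral_congr_ae (ae_nu fun z hz => ?_)
      by_cases h : u z = 0
      · simp [h]
      · have := uz z hz h
        simp only [T2, Am, han x hf', Ioo_eq_empty (not_lt.2 this)]; simp
    have key : ∫ z, KK H x z * u z ∂nu = fs n k (n*x-j') + V x := by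
      rw [KK_split H n M]
      simp_rw [add_mul]
      rw [integral_add, integral_add, t1, t2, add_zero]
      · exact (kT1.secz hx).integrable_mul uM
      · exact (kT2.secz hx).integrable_mul uM
      · exact ((kT1.secz hx).integrable_mul uM).add ((kT2.secz hx).integrable_mul uM)
      · exact (kT3.secz hx).integrable_mul uM
    simp only [key, hW, bl, if_pos hf']; ring
  · have hxI := (fl_iff n j' hn x hx.1.le).1 hf'
    have key : ∫ z, KK H x z * u z ∂nu = 0 := by
      rw [← integral_zero ℝ ℝ (μ := nu)]
      refine integral_congr_ae (ae_nu fun z hz => ?_)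
      by_cases h : u z = 0
      · simp [h]
      · have h1 := uz z hz h
        have h2 : (ca j'+1)/n ≤ j/n := by gcongr; exact_mod_cast hlt
        simp only [KK, Kker, if_neg (show ¬ (0 < z ∧ z < x) from fun h' => by linarith [h'.2, hxI.2]), zero_mul]
    have : ¬ ⌊ca n*x⌋₊ = j := by omega
    simp [key, hW, bl, this]
end
section
variable {H : ℝ → ℝ} {Hm HM ε r Ch Cc : ℝ}
lemma c_rng (f : ℝ → ℝ) (hf : ContinuousOn f (Ioo (1/2) 1)) (h0 : ∀ h, 1/2 < h → h < 1 → 0 < f h) (a b : ℝ) (ha : 1/2 < a) (hab : a ≤ b) (hb : b < 1) : ∃ L > 0, ∃ U > 0, ∀ x ∈ Icc a b, L ≤ f x ∧ f x ≤ U := by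
  have hc : ContinuousOn f (Icc a b) := hf.mono fun x hx => ⟨ha.trans_le hx.1, hx.2.trans_lt hb⟩
  obtain ⟨x, hx, h1⟩ := isCompact_Icc.exists_isMinOn (nonempty_Icc.2 hab) hc
  obtain ⟨y, hy, h2⟩ := isCompact_Icc.exists_isMaxOn (nonempty_Icc.2 hab) hc
  exact ⟨_, h0 x (ha.trans_le hx.1) (hx.2.trans_lt hb), _, h0 y (ha.trans_le hy.1) (hy.2.trans_lt hb), fun z hz => ⟨h1 hz, h2 hz⟩⟩
lemma lo1 (X : Ctx H Hm HM ε r Ch Cc) {H' : ℝ → ℝ} [MeasurableSpace EE] [BorelSpace EE] {μ : Measure EE} (Z : GM H H' μ)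
    (M : ℕ) (δ : ℝ) (hδ : 0 < δ) : ∃ k0 : ℕ, 1 ≤ k0 ∧ ∃ C > 0, ∀ n : ℕ, 1 ≤ n → Ch * (1/n:ℝ)^r ≤ ε/2 → ∀ a0 > 0, ∀ γ ≥ 1, ∀ e' ≥ 0, 2*e' < 1 → ∀ T : Finset (ℕ × ℕ),
    (∀ t ∈ T, t.1 < n ∧ a0 ≤ (t.1:ℝ)/n ∧ k0 ≤ t.2 ∧ C*(π*t.2*n)^(2*H ((t.1:ℝ)/n)+1)*bt Hm ε r a0 n M^2*(1/n) ≤ e'^2 ∧ C*γ*t.2*(π*t.2*n)^(-(2*H ((t.1:ℝ)/n)+1))*e' ≤ 1) →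
    ∑ t ∈ T, (log (1+((t.2:ℝ)/cc (γ*Ah (H ((t.1:ℝ)/n))/(1+2*δ)) (2*H ((t.1:ℝ)/n)+1) n)^(-(2*H ((t.1:ℝ)/n)+1))) + log (1-2*e')) ≤ Flog μ γ := by
  have p1 := X.par.h1; have p2 := X.par.h2; have p3 := X.par.h3; have p0 := X.par.e0
  obtain ⟨k0, k1, hU⟩ := U_up (Hm-1/2) (HM-1/2) δ li li li hδ
  obtain ⟨C1, hC1, hd⟩ := dual X M
  obtain ⟨A0, hA0, A1, hA1, hA⟩ := c_rng Ah Ah_cont Ah_pos Hm HM p1 p2 li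
  obtain ⟨G0, hG0, _, _, hGm⟩ := gam_rng (1+(Hm-1/2)) (1+(HM-1/2)) li li
  set D1 := C1^2*(1+2*δ)/A0 with hD1
  set D2 := 2*π*A1/G0^2 with hD2
  have d1 : 0 < D1 := po
  have d2 : 0 < D2 := po
  refine ⟨k0, k1, D1+D2, po, fun n hn hη a0 ha0 γ hγ e' he0 he1 T hT => ?_⟩
  have hγ0 : 0 < γ := li
  set b := bt Hm ε r a0 n M
  have nb : ∀ t ∈ T, ‖toE (ud H n t.1 t.2)‖^2 ≤ (1+2*δ)*(π*t.2*n)^(2*H ((t.1:ℝ)/n)+1)/Ah (H ((t.1:ℝ)/n)) ∧ (π*t.2*n)^(2*H ((t.1:ℝ)/n)+1)/(D2*t.2) ≤ ‖toE (ud H n t.1 t.2)‖^2 := by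
    rintro ⟨j, k⟩ ht
    obtain ⟨hj, -, hk, -, -⟩ := hT _ ht
    have hk0 : ca 0 < k := by exact_mod_cast k1.trans hk
    have hr := qrange X dv j n
    simp only at hj hk ⊢
    set h := H dv j n
    rw [(ud_sq X n j k hn hj (k1.trans hk)).2]
    have hAh := hA h ⟨li, li⟩
    have hAp : 0 < Ah h := hA0.trans_le hAh.1
    have u1 := hU k hk (h-1/2) ⟨hr.1, hr.2⟩
    have u2 := ud_lo (h-1/2) k li li (k1.trans hk)
    have g1 := (hGm (1+(h-1/2)) ⟨li, li⟩).1
    constructor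
    · calc _ ≤ (π*k*n)^(2*h+1)/Ah h*((2/(π*k))*((1+2*δ)*(π*k/2))) := by gcongr
        _ = _ := by field_simp
    · calc _ = (π*k*n)^(2*h+1)/A1*((2/(π*k))*(G0^2/4)) := by rw [hD2]; field_simp; ring
        _ ≤ (π*k*n)^(2*h+1)/Ah h*((2/(π*k))*(Gamma (1+(h-1/2))^2/4)) := by gcongr; exact hAh.2
        _ ≤ _ := by gcongr
  set T' := T.map (toLex (α := ℕ × ℕ)).toEmbedding with hT'
  set o := T'.orderEmbOfFin rfl with ho
  have oT : ∀ i, ofLex (o i) ∈ T := fun i => by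
    obtain ⟨t, ht, h⟩ := Finset.mem_map.1 (Finset.orderEmbOfFin_mem T' rfl i)
    rw [ho, ← h]; exact ht
  have sumE : ∀ f : ℕ × ℕ → ℝ, ∑ i, f (ofLex (o i)) = ∑ t ∈ T, f t := fun f => by
    have h1 := Finset.sum_map (Finset.univ) o.toEmbedding (fun x => f (ofLex x))
    rw [ho, Finset.map_orderEmbOfFin_univ, hT', Finset.sum_map] at h1
    exact h1.symm
  set J := fun i => (ofLex (o i)).1
  set K := fun i => (ofLex (o i)).2
  have hT2 : ∀ i, J i < n ∧ a0 ≤ (J i:ℝ)/n ∧ k0 ≤ K i ∧ _ ∧ _ := fun i => hT _ (oT i)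
  have Jm : ∀ i i', i ≤ i' → J i ≤ J i' := fun i i' h => by
    have := o.monotone h
    rw [Prod.Lex.le_iff] at this
    rcases this with h | h
    exacts [h.le, h.1.le]
  have inj : ∀ i i', (J i = J i' ∧ K i = K i') ↔ i = i' := fun i i' =>
    ⟨fun h => o.injective (ofLex.injective (Prod.ext h.1 h.2)), fun h => by simp [h]⟩
  have k1' : ∀ i, 1 ≤ K i := fun i => k1.trans (hT2 i).2.2.1
  set e := fun i => bl n (J i) (fs n (K i)) with he
  have eBM : ∀ i, BM (e i) := fun i => fs_bm _ _ _
  have eon : Orthonormal ℝ (fun i => toE (e i)) := by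
    rw [orthonormal_iff_ite]
    intro i i'
    rw [toE_inner (eBM i).mem (eBM i').mem, fs_on n _ _ _ _ hn (hT2 i').1 (k1' i') (k1' i)]
    simp only [inj]
  set g := fun i => toE (KO (KK H) (e i)) with hg
  set u := fun i => toE (ud H n (J i) (K i)) with hu
  have kn : ∀ i, ca 0 < K i := fun i => by exact_mod_cast k1' i
  have un : ∀ i, 0 < ‖u i‖^2 := fun i => lt_of_lt_of_le (by have := kn i; positivity) (nb _ (oT i)).2
  have key := la_lower g u γ e' hγ0 he0 (fun i h => by have := un i; simp [h] at this) (fun i => ?_) he1 (fun i v vi vj => ?_)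
  · have hdet := la_one_le _ (gram_psd g γ hγ0.le)
    haveI := Z.p; refine le_trans ?_ (F_lower μ Z.g (fun i => toE (e i)) eon (Matrix.gram ℝ g) (fun i k => cov_eq X H' Z.e μ Z.c (eBM i) (eBM k)) γ hγ0.le hdet)
    have pp : ∀ i, 0 < (1 + γ / ‖u i‖ ^ 2) * (1 - 2 * e') := fun i => mul_pos po li
    refine le_trans ?_ (log_le_log (Finset.prod_pos fun i _ => pp i) key)
    rw [log_prod (fun i _ => (pp i).ne'), ← sumE]
    refine Finset.sum_le_sum fun i _ => ?_
    have hr := qrange X ((J i:ℝ)/n)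
    have hAp := Ah_pos (H ((J i:ℝ)/n)) li li
    have kp : 0 < (π*K i*n)^(2*H ((J i:ℝ)/n)+1) := by have := kn i; positivity
    rw [log_mul po li, cc_pow _ _ n (K i) po li hn, rpow_neg (by have := kn i; positivity)]
    gcongr
    rw [le_div_iff₀ (un i)]
    calc _ ≤ γ*Ah (H ((J i:ℝ)/n))/(1+2*δ)*((π*K i*n)^(2*H ((J i:ℝ)/n)+1))⁻¹*((1+2*δ)*(π*K i*n)^(2*H ((J i:ℝ)/n)+1)/Ah (H ((J i:ℝ)/n))) := by gcongr; exact (nb _ (oT i)).1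
      _ = γ := by generalize (π*K i*n)^(2*H ((J i:ℝ)/n)+1) = z at kp; field_simp
  · obtain ⟨-, -, -, -, h5⟩ := hT2 i
    have h2 := (nb _ (oT i)).2
    refine le_trans ?_ h5
    have := kn i
    gcongr
    rw [div_le_iff₀ (un i), rpow_neg po]
    calc γ = D2*γ*K i*((π*K i*n)^(2*H ((J i:ℝ)/n)+1))⁻¹*((π*K i*n)^(2*H ((J i:ℝ)/n)+1)/(D2*K i)) := by field_simp
      _ ≤ _ := by gcongr; linarith
  · obtain ⟨hj, ha, hk, h4, -⟩ := hT2 i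
    obtain ⟨W, WM, hW, hW2⟩ := hd n hn hη a0 ha0 (J i) (K i) hj ha (k1' i)
    have hr := qrange X ((J i:ℝ)/n)
    have hAh := hA (H ((J i:ℝ)/n)) ⟨li, li⟩
    have := kn i
    have w1 : ∫ x, W x^2 ∂nu ≤ e'^2 := by
      refine hW.trans (le_trans ?_ h4)
      calc _ ≤ (C1*b)^2*(1/n)*((1+2*δ)*(π*K i*n)^(2*H ((J i:ℝ)/n)+1)/A0) := by
            gcongr; refine (nb _ (oT i)).1.trans ?_
            gcongr; exact hAh.1
        _ = D1*(π*K i*n)^(2*H ((J i:ℝ)/n)+1)*b^2*(1/n) := by rw [hD1]; field_simp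
        _ ≤ _ := by gcongr; linarith
    have e1 : inner ℝ (∑ k, v k • g k) (u i) - 1 = ∑ k, v k * ∫ x, W x * e k x ∂nu := by
      rw [sum_inner]
      have : ∀ k ∈ Finset.univ, inner ℝ (v k • g k) (u i) = (if k = i then v k else 0) + v k * ∫ x, W x * e k x ∂nu := by
        intro k _
        rw [real_inner_smul_left]
        rcases le_or_gt k i with h | h
        · rw [hg, hu]; simp only
          rw [hW2 (J k) (K k) (Jm k i h) (k1' k)]
          simp only [inj, mul_add, mul_ite, mul_one, mul_zero, he]
        · simp [vj k h]
      rw [sc rfl this, Finset.sum_add_distrib]; simp [vi]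
    rw [e1]
    have cs := Finset.sum_mul_sq_le_sq_mul_sq Finset.univ v (fun k => ∫ x, W x * e k x ∂nu)
    have bs := bessel Finset.univ e (fun i => (eBM i).mem) eon WM
    refine (abs_le_sqrt (cs.trans (ll (bs.trans w1) (Finset.sum_nonneg fun _ _ => sq_nonneg _)))).trans ?_
    rw [sqrt_mul (Finset.sum_nonneg fun _ _ => sq_nonneg _), sqrt_sq he0, mul_comm]
end
section
variable {H : ℝ → ℝ} {Hm HM θ r Ch Cc : ℝ}
lemma pwn (Y θ : ℝ) (hY : 1 ≤ Y) (hθ : θ ≤ 1) : 1 ≤ ⌈Y^(1-θ)⌉₊ ∧ (1/(⌈Y^(1-θ)⌉₊:ℝ)) ≤ Y^(-(1-θ)) ∧ (⌈Y^(1-θ)⌉₊:ℝ) ≤ 2*Y^(1-θ) := by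
  have h1 : 1 ≤ Y^(1-θ) := one_le_rpow hY li
  have h2 := Nat.le_ceil (Y^(1-θ))
  have h3 := Nat.ceil_lt_add_one (show 0 ≤ Y^(1-θ) by linarith)
  refine ⟨Nat.one_le_ceil_iff.2 li, ?_, li⟩
  rw [rpow_neg li, one_div]
  exact inv_anti₀ li h2
lemma pws (Y x t s u : ℝ) (hY : 1 ≤ Y) (hx : 0 ≤ x) (h : x ≤ Y^(-t)) (hs : 0 ≤ s) (hu : u ≤ t*s) : x^s ≤ Y^(-u) := by
  calc x^s ≤ (Y^(-t))^s := rpow_le_rpow hx h hs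
    _ = Y^(-t*s) := (rpow_mul li _ _).symm
    _ ≤ _ := rl hY li
lemma pw (Y : ℝ) (n M : ℕ) (hY : 1 ≤ Y) (hn : 1 ≤ n) (hx : (1/n:ℝ) ≤ Y^(-(1-θ))) (h1 : 1/2 < Hm) (h0 : 0 < θ) (h2 : 14*θ ≤ 1-Hm) (h3 : 7*θ ≤ r) (h4 : r ≤ 1) (hM : 4 ≤ r*M) :
    bt Hm θ r (Y^(-(10*θ))) n M ≤ 3*Y^(-(Hm+2*θ)) ∧ T3E Hm θ r (Y^(-(10*θ))) n M ≤ 17*Y^(-(2*Hm+2*θ)) := by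
  have Y0 : 0 < Y := li
  set x := (1/n:ℝ)
  have x0 : 0 < x := by have : ca 0 < n := by exact_mod_cast hn
                        positivity
  have a1 : x^r*x^(Hm-3*θ) ≤ Y^(-(Hm+2*θ)) := by
    rw [← rpow_add x0]
    refine pws Y x _ _ _ hY x0.le hx li nl
  have a2 : x/Y^(-(10*θ)) ≤ Y^(-(Hm+2*θ)) := by
    rw [div_le_iff₀ po, ← rpow_add Y0]
    exact hx.trans (rl hY li)
  have a3 : (x^r)^M ≤ Y^(-(Hm+2*θ)) := by
    rw [← rpow_natCast, ← rpow_mul x0.le]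
    exact pws Y x _ _ _ hY x0.le hx li nl
  have b1 : bt Hm θ r (Y^(-(10*θ))) n M ≤ 3*Y^(-(Hm+2*θ)) := by unfold bt; linarith
  have b0 : 0 ≤ bt Hm θ r (Y^(-(10*θ))) n M := by unfold bt; positivity
  refine ⟨b1, ?_⟩
  have c1 : x^(Hm-3*θ) ≤ Y^(-(Hm-4*θ)) := pws Y x _ _ _ hY x0.le hx li nl
  have c2 : (x^r)^M ≤ Y^(-(Hm-4*θ)) := a3.trans (rl hY li)
  have c3 : x ≤ Y^(-(10*θ)) := hx.trans (rl hY li)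
  have sq : ∀ s : ℝ, (Y^s)^2 = Y^(s+s) := fun s => by rw [rpow_add Y0, sq]
  calc T3E Hm θ r (Y^(-(10*θ))) n M = bt Hm θ r (Y^(-(10*θ))) n M^2 + (Y^(-(10*θ))+x)*(x^(Hm-3*θ)+(x^r)^M)^2 := rfl
    _ ≤ (3*Y^(-(Hm+2*θ)))^2 + (Y^(-(10*θ))+Y^(-(10*θ)))*(Y^(-(Hm-4*θ))+Y^(-(Hm-4*θ)))^2 := by gcongr
    _ = 9*Y^(-(2*Hm+4*θ)) + 8*Y^(-(2*Hm+2*θ)) := by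
        rw [show ∀ a b c : ℝ, (3*a)^2 + (b+b)*(c+c)^2 = 9*a^2+8*(b*c^2) from fun a b c => by ring, sq, sq, ← rpow_add Y0]
        ring_nf
    _ ≤ _ := by
        have : Y^(-(2*Hm+4*θ)) ≤ Y^(-(2*Hm+2*θ)) := rl hY li
        linarith
def Ex (H : ℝ → ℝ) (γ x : ℝ) : ℝ := γ^(1/(2*H x+1))
def JJ (H : ℝ → ℝ) (γ : ℝ) : ℝ := ∫ x in Icc ca 0 1, Ex H γ x
lemma Ex_cont (X : Ctx H Hm HM θ r Ch Cc) (γ : ℝ) (hγ : 1 ≤ γ) : Continuous (Ex H γ) := by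
  have p1 := X.par.h1
  have : ∀ x, 2*H x+1 ≠ 0 := fun x => by linarith [X.lo x]
  have := X.cont
  unfold Ex
  refine Continuous.rpow continuous_const (by fun_prop (disch := assumption)) fun x => Or.inl li
lemma Ex_cmp (X : Ctx H Hm HM θ r Ch Cc) (γ : ℝ) (hγ : 1 ≤ γ) (x y e : ℝ) (h : |H x - H y| ≤ e) : Ex H γ x ≤ γ^e * Ex H γ y := by
  have p1 := X.par.h1
  have lx := X.lo x; have ly := X.lo y
  unfold Ex
  rw [← rpow_add li]
  refine rl hγ ?_
  have h1 : 1/(2*H x+1) - 1/(2*H y+1) = 2*(H y - H x)/((2*H x+1)*(2*H y+1)) := by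
    have : 2*H x+1 ≠ 0 := li
    have : 2*H y+1 ≠ 0 := li
    field_simp; ring
  have h2 : 2*(H y - H x)/((2*H x+1)*(2*H y+1)) ≤ e := by
    rw [div_le_iff₀ nl]
    have := abs_le.1 h
    have e0 : 0 ≤ e := (abs_nonneg _).trans h
    nlinarith [mul_nonneg e0 (show 0 ≤ (2*H x+1)*(2*H y+1) - 2 by nlinarith)]
  linarith
lemma JJ_cmp (X : Ctx H Hm HM θ r Ch Cc) (γ : ℝ) (hγ : 1 ≤ γ) (n : ℕ) (hn : 1 ≤ n) :
    ∑ j ∈ rg n, 1/n*Ex H γ dv j n ≤ γ^(Ch*(1/n:ℝ)^r)*JJ H γ ∧ JJ H γ ≤ γ^(Ch*(1/n:ℝ)^r)*∑ j ∈ rg n, 1/n*Ex H γ dv j n := by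
  have hn0 := c0p hn
  have ec := Ex_cont X γ hγ
  have e : JJ H γ = ∑ j ∈ rg n, ∫ x in ca j/n..((j+1:ℕ):ℝ)/n, Ex H γ x := by
    rw [JJ, integral_Icc_eq_integral_Ioc, ← io zero_le_one, intervalIntegral.sum_integral_adjacent_intervals (a := fun j : ℕ => ca j/n) fun k _ => ec.intervalIntegrable _ _]
    simp [hn0.ne']
  have le : ∀ j : ℕ, ca j/n ≤ ((j+1:ℕ):ℝ)/n := fun j => by gcongr; simp
  have ln : ∀ j : ℕ, ((j+1:ℕ):ℝ)/n - ca j/n = 1/n := fun j => by push_cast; field_simp; ring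
  have hd : ∀ j : ℕ, ∀ x ∈ Icc dv j n (((j+1:ℕ):ℝ)/n), |H x - H dv j n| ≤ Ch*(1/n:ℝ)^r := fun j x hx => by
    refine (X.hol _ _).trans ?_
    have := X.Ch0; have := X.r0
    gcongr
    rw [abs_of_nonneg (by linarith [hx.1])]; linarith [hx.2, ln j]
  rw [e, ms, ms]
  constructor <;> refine Finset.sum_le_sum fun j _ => ?_
  · rw [← intervalIntegral.integral_const_mul]
    have := intervalIntegral.integral_mono_on (μ := volume) (le j) (continuous_const.intervalIntegrable _ _) ((continuous_const.mul ec).intervalIntegrable _ _) fun x hx => Ex_cmp X γ hγ dv j n x _ (by rw [abs_sub_comm]; exact hd j x hx)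
    rwa [intervalIntegral.integral_const, ln, smul_eq_mul] at this
  · have := intervalIntegral.integral_mono_on (μ := volume) (le j) (ec.intervalIntegrable _ _) (continuous_const.intervalIntegrable _ _) fun x hx => Ex_cmp X γ hγ x dv j n _ (hd j x hx)
    rw [intervalIntegral.integral_const, ln, smul_eq_mul] at this
    linarith
lemma ev (p s t C : ℝ) (hp : 0 < p) (hst : s < t) : ∀ᶠ γ : ℝ in atTop, C*(γ^(1/p))^s ≤ (γ^(1/p))^t ∧ C*log γ*(γ^(1/p))^s ≤ (γ^(1/p))^t := by
  have h0 : ca 0 < (t-s)/p := div_pos li hp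
  have h1 := (tendsto_rpow_atTop h0).eventually_ge_atTop C
  have h2 := ((isLittleO_log_rpow_atTop h0).bound (show 0 < 1/(|C|+1) by positivity))
  filter_upwards [h1, h2, eventually_ge_atTop 1] with γ a b c
  have e : (γ^(1/p))^t = γ^((t-s)/p)*(γ^(1/p))^s := by
    rw [← rpow_mul li, ← rpow_mul li, ← rpow_add li]; congr 1; field_simp; ring
  rw [e]
  have : 0 ≤ γ^((t-s)/p) := po
  have l0 := log_nonneg c
  rw [norm_of_nonneg l0, norm_of_nonneg this, one_div, inv_mul_eq_div, le_div_iff₀ po] at b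
  constructor
  · gcongr
  · have : C*log γ ≤ γ^((t-s)/p) := by nlinarith [lr (le_abs_self C) l0]
    gcongr
lemma ev_eta (X : Ctx H Hm HM θ r Ch Cc) (p a : ℝ) (hp : 0 < p) (hθ : θ < 1) (ha : 0 < a) : ∀ᶠ γ : ℝ in atTop, Ch*(1/(⌈(γ^(1/p))^(1-θ)⌉₊:ℝ))^r ≤ a ∧ γ^(Ch*(1/(⌈(γ^(1/p))^(1-θ)⌉₊:ℝ))^r) ≤ 1+a := by
  have hr := X.r0; have hC := X.Ch0
  have hs : 0 < (1-θ)*r := mul_pos li hr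
  have hl : 0 < log (1+a) := log_pos li
  filter_upwards [ev p (-((1-θ)*r)) 0 (Ch/a) hp li, ev p (-((1-θ)*r)) 0 (Ch/log (1+a)) hp li, eventually_ge_atTop 1] with γ h1 h2 hγ
  have hY : 1 ≤ γ^(1/p) := one_le_rpow hγ po
  obtain ⟨n1, n2, -⟩ := pwn (γ^(1/p)) θ hY hθ.le
  have h3 := pws _ _ _ r _ hY po n2 hr.le le_rfl
  set z := (1/(⌈(γ^(1/p))^(1-θ)⌉₊:ℝ))^r
  have h1 := h1.1; have h2 := h2.2
  rw [rpow_zero] at h1 h2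
  constructor
  · rw [div_mul_eq_mul_div, div_le_one ha] at h1
    exact le_trans (by gcongr) h1
  · rw [div_mul_eq_mul_div, div_mul_eq_mul_div, div_le_one hl] at h2
    rw [rpow_def_of_pos li, ← exp_log (show 0 < 1+a by linarith), exp_le_exp]
    have : 0 ≤ log γ := log_nonneg hγ
    refine le_trans ?_ h2
    rw [← mul_assoc, mul_comm Ch]; gcongr
end
section
variable {H : ℝ → ℝ} {Hm HM θ r Ch Cc : ℝ}
lemma Gh_near (f : ℝ → ℝ) (hf : ContinuousOn f (Ioo (1/2) 1)) (a δ : ℝ) (h1 : 1/2 < a) (h2 : a < 1) (hδ : 0 < δ) : ∃ d > 0, ∀ h, a ≤ h → h ≤ a+d → |f h - f a| ≤ δ := by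
  obtain ⟨d, d0, hd⟩ := Metric.continuousAt_iff.1 (hf.continuousAt (Ioo_mem_nhds h1 h2)) δ hδ
  refine ⟨d/2, po, fun h ha hb => ?_⟩
  have := hd (x := h) (by rw [dist_eq, abs_of_nonneg li]; linarith)
  rw [dist_eq] at this; exact this.le
lemma Ex_far (X : Ctx H Hm HM θ r Ch Cc) (p d γ x : ℝ) (hp : p = 2*Hm+1) (hd : 0 < d) (hγ : 1 ≤ γ) (h : Hm+d ≤ H x) : Ex H γ x ≤ (γ^(1/p))^(p/(p+2*d)) := by
  have p1 := X.par.h1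
  have p0 : p ≠ 0 := li
  rw [← rpow_mul li, show 1/p*(p/(p+2*d)) = 1/(p+2*d) by field_simp]
  refine rl hγ (one_div_le_one_div_of_le li li)
lemma Ex_top (X : Ctx H Hm HM θ r Ch Cc) (p γ x : ℝ) (hp : p = 2*Hm+1) (hγ : 1 ≤ γ) : Ex H γ x ≤ γ^(1/p) := by
  have p1 := X.par.h1
  exact rl hγ (one_div_le_one_div_of_le li (by linarith [X.lo x]))
lemma Ex_pos (H : ℝ → ℝ) (γ x : ℝ) (hγ : 1 ≤ γ) : 0 ≤ Ex H γ x := rpow_nonneg li _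
set_option maxHeartbeats 1000000 in
lemma upA (X : Ctx H Hm HM θ r Ch Cc) {H' : ℝ → ℝ} [MeasurableSpace EE] [BorelSpace EE] {μ : Measure EE} (Z : GM H H' μ)
    (h2 : 14*θ ≤ 1-Hm) (h3 : 7*θ ≤ r) (h4 : r ≤ 1) (p : ℝ) (hp : p = 2*Hm+1) (η : ℝ) (hη : 0 < η) :
    ∃ s : ℝ, s < 1 ∧ ∃ C : ℝ, 0 < C ∧ ∀ᶠ γ : ℝ in atTop, Flog μ γ ≤ (Gh Hm+η)*JJ H γ + C*(γ^(1/p))^s := by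
  have p1 := X.par.h1; have p2 := X.par.h2; have p3 := X.par.h3; have t0 := X.par.e0; have r0 := X.r0
  have p0 : 0 < p := li
  set g := Gh Hm
  have g0 : 0 < g := Gh_pos Hm p1 li
  set δ := min 1 (η/(11*g+12))
  have d0 : 0 < δ := po
  have d1 : δ ≤ 1 := min_le_left _ _
  have d2 : δ*(11*g+12) ≤ η := by rw [← le_div_iff₀ po]; exact min_le_right _ _
  have dd : (1+δ)*(1+2*δ)*((g+δ)*(1+δ)) ≤ g+η := by
    have : (1+δ)*(1+2*δ)*(1+δ) ≤ 1+11*δ := by nlinarith [mul_nonneg d0.le (sub_nonneg.2 d1), mul_nonneg (mul_nonneg d0.le d0.le) (sub_nonneg.2 d1)]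
    nlinarith [ll this (show 0 ≤ g+δ by positivity)]
  obtain ⟨d, dpos, hd⟩ := Gh_near Gh Gh_cont Hm δ p1 li d0
  obtain ⟨_, _, G1, hG1, hGb⟩ := c_rng Gh Gh_cont Gh_pos Hm HM p1 p2 li
  obtain ⟨M, hM⟩ := exists_nat_ge (4/r)
  rw [div_le_iff₀ r0, mul_comm] at hM
  obtain ⟨k0, C, hC, hu⟩ := up1 X Z M δ d0 d1
  set s1 := p/(p+2*d) with hs1
  have s11 : s1 < 1 := by rw [hs1, div_lt_one po]; linarith
  set s := max s1 (1-θ/2)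
  refine ⟨s, max_lt s11 li, 6*G1+1+17*C, po, ?_⟩
  filter_upwards [ev_eta X p δ p0 li d0, ev_eta X p (θ/2) p0 li po, eventually_ge_atTop (1+2*C), eventually_ge_atTop 1, ev p (1-θ) (1-θ/2) (6*(k0+M)) p0 li] with γ e1 e2 hγ2 hγ e3
  have hY : 1 ≤ γ^(1/p) := one_le_rpow hγ po
  obtain ⟨n1, n2, n3⟩ := pwn (γ^(1/p)) θ hY li
  have hYp : (γ^(1/p))^p = γ := by rw [← rpow_mul li, one_div_mul_cancel p0.ne', rpow_one]
  set Y := γ^(1/p)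
  set n := ⌈Y^(1-θ)⌉₊
  have Y0 : 0 < Y := li
  refine (hu n n1 e2.1 (Y^(-(10*θ))) po γ hγ).trans ?_
  have Ys : ∀ t ≤ s, Y^t ≤ Y^s := fun t ht => rl hY ht
  have a1 : ∑ j ∈ rg n, 1/n*Gh (H dv j n)*γ^(1/(2*H dv j n+1)) ≤ (g+δ)*((1+δ)*JJ H γ) + G1*Y^s := by
    calc _ ≤ ∑ j ∈ rg n, ((g+δ)*(1/n*Ex H γ dv j n) + 1/n*(G1*Y^s1)) := by
          refine Finset.sum_le_sum fun j _ => ?_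
          change 1/n*Gh (H dv j n)*Ex H γ dv j n ≤ _
          have E0 := Ex_pos H γ dv j n hγ
          have hlo := X.lo dv j n
          have hb := hGb _ ⟨hlo, X.hi dv j n⟩
          rcases le_total (H dv j n) (Hm+d) with hc | hc
          · have := abs_le.1 (hd _ hlo hc)
            calc _ ≤ 1/n*(g+δ)*Ex H γ dv j n := by gcongr; linarith
              _ ≤ _ := by have : 0 ≤ 1/n*(G1*Y^s1) := po
                          linarith
          · have := Ex_far X p d γ _ hp dpos hγ hc
            calc _ ≤ 1/n*G1*Y^s1 := by gcongr; exact hb.2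
              _ ≤ _ := by have : 0 ≤ (g+δ)*(1/n*Ex H γ dv j n) := po
                          linarith
      _ = (g+δ)*∑ j ∈ rg n, 1/n*Ex H γ dv j n + G1*Y^s1 := by
          rw [Finset.sum_add_distrib, ← ms, Finset.sum_const, Finset.card_range, nsmul_eq_mul]; field_simp
      _ ≤ _ := by
          have J0 : 0 ≤ JJ H γ := integral_nonneg fun x => Ex_pos H γ x hγ
          refine add_le_add (ll (((JJ_cmp X γ hγ n n1).1).trans (lr e1.2 J0)) po) (ll (Ys s1 (le_max_left _ _)) hG1.le)
  have a2 : n*(k0+M)*log (1+C*γ*n) ≤ Y^s := by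
    have b1 : ca n ≤ 2*γ := n3.trans (by
      have : Y^(1-θ) ≤ Y^p := rl hY li
      linarith)
    have b2 : 1+C*γ*n ≤ γ^3 := by
      calc 1+C*γ*n ≤ γ^2*1+C*γ*(2*γ) := by gcongr; nlinarith
        _ = (1+2*C)*γ^2 := by ring
        _ ≤ γ*γ^2 := by gcongr
        _ = _ := by ring
    have b3 : log (1+C*γ*n) ≤ 3*log γ := by
      refine (log_le_log po b2).trans (le_of_eq ?_)
      rw [log_pow]; norm_num
    calc _ ≤ (2*Y^(1-θ))*(k0+M)*(3*log γ) := mul_le_mul (lr n3 po) b3 (log_nonneg (by linarith [show 0 ≤ C*γ*n by positivity])) po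
      _ = 6*(k0+M)*log γ*Y^(1-θ) := by ring
      _ ≤ Y^(1-θ/2) := e3.2
      _ ≤ _ := Ys _ (le_max_right _ _)
  have a3 : C*γ*T3E Hm θ r (Y^(-(10*θ))) n M ≤ 17*C*Y^s := by
    calc _ ≤ C*γ*(17*Y^(-(2*Hm+2*θ))) := by gcongr; exact (pw Y n M hY n1 n2 p1 t0 h2 h3 h4 hM).2
      _ = 17*C*Y^(1-2*θ) := by
          conv_lhs => rw [← hYp]
          rw [show C*Y^p*(17*Y^(-(2*Hm+2*θ))) = 17*C*(Y^p*Y^(-(2*Hm+2*θ))) by ring, ← rpow_add Y0, hp]; ring_nf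
      _ ≤ _ := ll (Ys _ ((by linarith : 1-2*θ ≤ 1-θ/2).trans (le_max_right _ _))) po
  have J0 : 0 ≤ JJ H γ := integral_nonneg fun x => Ex_pos H γ x hγ
  have Yp : 0 < Y^s := po
  have d6 : (1+δ)*(1+2*δ) ≤ 6 := by nlinarith
  calc _ ≤ (1+δ)*(1+2*δ)*((g+δ)*((1+δ)*JJ H γ) + G1*Y^s) + Y^s + 17*C*Y^s := add_le_add (add_le_add (ll a1 po) a2) a3
    _ = (1+δ)*(1+2*δ)*((g+δ)*(1+δ))*JJ H γ + ((1+δ)*(1+2*δ)*G1+1+17*C)*Y^s := by ring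
    _ ≤ _ := add_le_add (lr dd J0) (lr (by linarith [lr d6 hG1.le]) Yp.le)
end
section
variable {H : ℝ → ℝ} {Hm HM θ r Ch Cc : ℝ}
def Idl (p δ : ℝ) : ℝ := ∫ x in Ioc (2*δ) (1/(2*δ)), log (1+x^(-p))
lemma lg_nn (p x : ℝ) (hx : 0 ≤ x) : 0 ≤ log (1+x^(-p)) := log_nonneg (by linarith [rpow_nonneg hx (-p)])
lemma Idl_nn (p δ : ℝ) (h : 0 < δ) : 0 ≤ Idl p δ := setIntegral_nonneg measurableSet_Ioc fun x hx => lg_nn p x (by linarith [hx.1])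
lemma dsel (p B η : ℝ) (hp : 1 < p) (hB : 0 < B) (hη : 0 < η) : ∃ δ : ℝ, 0 < δ ∧ δ < 1/4 ∧ δ < B ∧ B/sin (π/p) - η ≤ (1-δ)/(1+2*δ)*(Idl p δ/π)*(B-δ)/(1+δ) := by
  obtain ⟨hi, he⟩ := logint p hp
  set dn : ℕ → ℝ := fun n => 1/(n+1:ℝ)/2
  have t1 : Tendsto dn atTop (nhds 0) := by
    have := (tendsto_one_div_add_atTop_nhds_zero_nat (𝕜 := ℝ)).div_const 2
    rwa [zero_div] at this
  have hU : ⋃ n : ℕ, Ioc (2*dn n) (1/(2*dn n)) = Ioi 0 := by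
    ext x; simp only [mem_iUnion, mem_Ioc, mem_Ioi, dn]
    constructor
    · rintro ⟨n, h, -⟩; exact lt_trans po h
    · intro hx
      obtain ⟨n, hn⟩ := exists_nat_gt (max x (1/x))
      refine ⟨n, ?_, ?_⟩
      · rw [mul_div_cancel₀ _ (two_ne_zero), div_lt_comm₀ po hx]; linarith [le_max_right x (1/x)]
      · rw [mul_div_cancel₀ _ (two_ne_zero), one_div_one_div]; linarith [le_max_left x (1/x)]
  have hmono : Monotone fun n : ℕ => Ioc (2*dn n) (1/(2*dn n)) := by
    intro a b hab
    simp only [dn]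
    have : 1/(b+1:ℝ) ≤ 1/(a+1:ℝ) := by gcongr
    refine Ioc_subset_Ioc li (one_div_le_one_div_of_le po li)
  have t2 : Tendsto (fun n => Idl p (dn n)) atTop (nhds (π/sin (π/p))) := by
    have := tendsto_setIntegral_of_monotone (μ := volume) (f := fun x : ℝ => log (1+x^(-p))) (fun n : ℕ => (measurableSet_Ioc : MeasurableSet (Ioc (2*dn n) (1/(2*dn n))))) hmono (by rw [hU]; exact hi)
    rwa [hU, he] at this
  have t3 : Tendsto (fun n => (1-dn n)/(1+2*dn n)*(Idl p (dn n)/π)*(B-dn n)/(1+dn n)) atTop (nhds ((1-0)/(1+2*0)*((π/sin (π/p))/π)*(B-0)/(1+0))) :=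
    ((((tendsto_const_nhds.sub t1).div (tendsto_const_nhds.add (t1.const_mul 2)) nn).mul (t2.div_const _)).mul (tendsto_const_nhds.sub t1)).div (tendsto_const_nhds.add t1) nn
  have e : (1-0)/(1+2*0)*((π/sin (π/p))/π)*(B-0)/(1+0) = B/sin (π/p) := by
    have := pi_ne_zero
    field_simp; ring
  rw [e] at t3
  obtain ⟨n, h1, h2, h3⟩ := ((t3.eventually_const_le (show B/sin (π/p) - η < _ by linarith)).and ((t1.eventually_lt_const (show ca 0 < 1/4 by norm_num)).and (t1.eventually_lt_const hB))).exists
  exact ⟨dn n, by simp only [dn]; positivity, h2, h3, h1⟩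
lemma per (p δ d p' c : ℝ) (hp : 1 < p) (hδ : 0 < δ) (h4 : δ < 1/4) (hd : 1-δ ≤ (2*δ)^(2*d)) (h1 : p ≤ p') (h2 : p' ≤ p+2*d) (hc : 2 ≤ δ*c) :
    c*((1-δ)*Idl p δ) ≤ ∑ k ∈ Finset.Ico ⌈δ*c⌉₊ ⌊c/δ⌋₊, log (1+dv k c^(-p')) := by
  have c0 : 0 < c := by by_contra! h; nlinarith
  have a1 : (⌈δ*c⌉₊:ℝ) ≤ 2*(δ*c) := by linarith [Nat.ceil_lt_add_one (show 0 ≤ δ*c by linarith)]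
  have cd : 2 ≤ c/δ := by rw [le_div_iff₀ hδ]; nlinarith
  have b1 : c/δ/2 ≤ (⌊c/δ⌋₊:ℝ) := by linarith [Nat.lt_floor_add_one (c/δ)]
  refine le_trans ?_ (sum_lo p' c li c0 _ _ (Nat.one_le_ceil_iff.2 li))
  gcongr
  have hi' := (logint p' li).1
  have hi := (logint p hp).1
  have a2 : (⌈δ*c⌉₊:ℝ)/c ≤ 2*δ := by rw [div_le_iff₀ c0]; linarith
  have b2 : 1/(2*δ) ≤ (⌊c/δ⌋₊:ℝ)/c := by
    rw [le_div_iff₀ c0]; refine le_trans (le_of_eq ?_) b1; field_simp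
  calc (1-δ)*Idl p δ = ∫ x in Ioc (2*δ) (1/(2*δ)), (1-δ)*log (1+x^(-p)) := (im _ _).symm
    _ ≤ ∫ x in Ioc (2*δ) (1/(2*δ)), log (1+x^(-p')) := by
        refine setIntegral_mono_on ((hi.mono_set fun x hx => lt_trans po hx.1).const_mul _) (hi'.mono_set fun x hx => lt_trans po hx.1) measurableSet_Ioc fun x hx => ?_
        have x0 : 0 < x := lt_trans po hx.1
        have e1 : (1-δ)*x^(-p) ≤ x^(-p') := by
          rw [show -p' = -(p'-p) + -p by ring, rpow_add x0]
          gcongr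
          calc 1-δ ≤ (2*δ)^(2*d) := hd
            _ ≤ (2*δ)^(p'-p) := rpow_le_rpow_of_exponent_ge li li li
            _ = (1/(2*δ))^(-(p'-p)) := by rw [one_div, inv_rpow li, rpow_neg li, inv_inv]
            _ ≤ _ := rp x0 hx.2 li
        have z0 := rpow_pos_of_pos x0 (-p)
        have e2 := rpow_one_add_le_one_add_mul_self (show -1 ≤ x^(-p) by linarith) (show 0 ≤ 1-δ by linarith) li
        rw [← log_rpow li]
        exact log_le_log po li
    _ ≤ _ := by
        refine setIntegral_mono_set (hi'.mono_set fun x hx => lt_of_le_of_lt po hx.1) ?_ (Ioc_subset_Ioc a2 b2).eventuallyLE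
        exact (ae_restrict_mem measurableSet_Ioc).mono fun x hx => lg_nn p' x (le_trans po hx.1.le)
def Bh (h : ℝ) : ℝ := Ah h^(1/(2*h+1))
lemma Bh_cont : ContinuousOn Bh (Ioo (1/2) 1) := by
  refine ContinuousOn.rpow Ah_cont (continuousOn_const.div fp fun x hx => by linarith [hx.1]) fun x hx => Or.inl (Ah_pos x hx.1 hx.2).ne'
lemma blk (h γ δ : ℝ) (n : ℕ) (h0 : 1/2 < h) (h1 : h < 1) (hγ : 1 ≤ γ) (hδ : 0 < δ) (h4 : δ < 1/4) (hn : 1 ≤ n) :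
    cc (γ*Ah h/(1+2*δ)) (2*h+1) n ≤ Bh h*γ^(1/(2*h+1))/n ∧ Bh h*γ^(1/(2*h+1))/((1+2*δ)*π*n) ≤ cc (γ*Ah h/(1+2*δ)) (2*h+1) n ∧
    ∀ k : ℕ, δ*cc (γ*Ah h/(1+2*δ)) (2*h+1) n ≤ k → k ≤ cc (γ*Ah h/(1+2*δ)) (2*h+1) n/δ → (π*k*n)^(2*h+1) ≤ γ*Ah h*δ^(-3:ℝ) ∧ γ*(π*k*n)^(-(2*h+1)) ≤ 2/Ah h*δ^(-3:ℝ) := by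
  have A0 := Ah_pos h h0 h1
  have n0 := c0p hn
  have hpi := pi_gt_three
  have B0 : 0 < γ*Ah h/(1+2*δ) := po
  have c0 := cc_pos (γ*Ah h/(1+2*δ)) (2*h+1) n B0 hn
  have e : (γ*Ah h/(1+2*δ))^(1/(2*h+1)) = Bh h*γ^(1/(2*h+1))/(1+2*δ)^(1/(2*h+1)) := by
    rw [div_rpow po po, mul_rpow po A0.le, Bh]; ring
  have Bp : 0 < Bh h := rpow_pos_of_pos A0 _
  have q1 : 1 ≤ (1+2*δ)^(1/(2*h+1)) := one_le_rpow li po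
  have q2 : (1+2*δ)^(1/(2*h+1)) ≤ 1+2*δ := by
    conv_rhs => rw [← rpow_one (1+2*δ)]
    refine rl li ?_
    rw [div_le_one li]; linarith
  refine ⟨?_, ?_, fun k k1 k2 => ?_⟩
  · rw [cc, e, div_div]
    gcongr
    nlinarith [lr q1 (show 0 ≤ π*n by positivity), lr hpi.le n0.le]
  · rw [cc, e, div_div, mul_assoc (1+2*δ)]
    gcongr
  · have k0 : ca 0 < k := lt_of_lt_of_le po k1
    have e1 := cc_pow (γ*Ah h/(1+2*δ)) (2*h+1) n k B0 li hn
    set c := cc (γ*Ah h/(1+2*δ)) (2*h+1) n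
    have y1 : δ ≤ k/c := by rwa [le_div_iff₀ c0]
    have y2 : k/c ≤ δ⁻¹ := by rw [div_le_iff₀ c0, inv_mul_eq_div]; exact k2
    have D : δ^(-(2*h+1)) ≤ δ^(-3:ℝ) := rpow_le_rpow_of_exponent_ge hδ li li
    have K0 : 0 < (π*k*n)^(2*h+1) := po
    have u1 : dv k c^(-(2*h+1)) ≤ δ^(-3:ℝ) := (rp hδ y1 li).trans D
    have u2 : dv k c^(2*h+1) ≤ δ^(-3:ℝ) := (rpow_le_rpow po y2 li).trans (by rwa [inv_rpow hδ.le, ← rpow_neg hδ.le])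
    have v : dv k c^(-(2*h+1)) = (dv k c^(2*h+1))⁻¹ := rpow_neg po _
    have w : (π*k*n)^(-(2*h+1)) = ((π*k*n)^(2*h+1))⁻¹ := rpow_neg po _
    have z0 : 0 < dv k c^(2*h+1) := po
    constructor
    · have : (π*k*n)^(2*h+1) = γ*Ah h/(1+2*δ)*dv k c^(2*h+1) := by
        rw [v, w] at e1; field_simp at e1 ⊢; linarith
      rw [this]; gcongr
      exact div_le_self po li
    · have : γ*(π*k*n)^(-(2*h+1)) = (1+2*δ)/Ah h*dv k c^(-(2*h+1)) := by rw [e1]; field_simp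
      rw [this]; gcongr; linarith
end
section
variable {H : ℝ → ℝ} {Hm HM θ r Ch Cc : ℝ}
lemma card_a0 (a0 : ℝ) (n : ℕ) (hn : 1 ≤ n) (h : 0 < a0) (y : ℝ) (hy : 0 ≤ y) : ∑ j ∈ rg n, (if a0 ≤ ca j/n then 0 else y/n) ≤ (a0+1/n)*y := by
  have n0 := c0p hn
  rw [sc rfl fun (j : ℕ) _ => (ite_not (a0 ≤ ca j/n) (y/n) 0).symm, ← Finset.sum_filter, Finset.sum_const, nsmul_eq_mul]
  have : (Finset.filter (fun j : ℕ => ¬ a0 ≤ ca j/n) (rg n)).card ≤ ⌈a0*n⌉₊ := by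
    rw [← Finset.card_range ⌈a0*n⌉₊]
    refine Finset.card_le_card fun j hj => ?_
    rw [Finset.mem_filter, not_le, div_lt_iff₀ n0] at hj
    exact Finset.mem_range.2 (Nat.lt_ceil.2 hj.2)
  have h2 := Nat.ceil_lt_add_one (show 0 ≤ a0*n by positivity)
  have h3 : ((Finset.filter (fun j : ℕ => ¬ a0 ≤ ca j/n) (rg n)).card:ℝ) ≤ a0*n+1 := by
    have : ((Finset.filter (fun j : ℕ => ¬ a0 ≤ ca j/n) (rg n)).card:ℝ) ≤ ⌈a0*n⌉₊ := by exact_mod_cast this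
    linarith
  calc _ ≤ (a0*n+1)*(y/n) := by gcongr
    _ = _ := by field_simp
lemma dpick (δ : ℝ) (hδ : 0 < δ) (h4 : δ < 1/4) : ∃ d0 : ℝ, 0 < d0 ∧ ∀ d, 0 ≤ d → d ≤ d0 → 1-δ ≤ (2*δ)^(2*d) := by
  have l1 : log (1-δ) < 0 := log_neg li li
  have l2 : log (2*δ) < 0 := log_neg li li
  refine ⟨log (1-δ)/log (2*δ)/2, by have := div_pos_of_neg_of_neg l1 l2; positivity, fun d h0 h => ?_⟩
  rw [le_div_iff₀ two_pos, le_div_iff_of_neg l2] at h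
  rw [rpow_def_of_pos po, ← log_le_iff_le_exp li]
  linarith
set_option maxHeartbeats 2000000 in
lemma loA (X : Ctx H Hm HM θ r Ch Cc) {H' : ℝ → ℝ} [MeasurableSpace EE] [BorelSpace EE] {μ : Measure EE} (Z : GM H H' μ)
    (h2 : 14*θ ≤ 1-Hm) (h3 : 7*θ ≤ r) (h4 : r ≤ 1) (p : ℝ) (hp : p = 2*Hm+1) (η : ℝ) (hη : 0 < η) :
    ∃ s : ℝ, s < 1 ∧ ∃ C : ℝ, 0 < C ∧ ∀ᶠ γ : ℝ in atTop, (Gh Hm-η)*JJ H γ - C*(γ^(1/p))^s ≤ Flog μ γ := by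
  have p1 := X.par.h1; have p2 := X.par.h2; have p3 := X.par.h3; have t0 := X.par.e0; have r0 := X.r0; have t8 := X.par.e2
  have p0 : 0 < p := li
  have B0 : 0 < Bh Hm := rpow_pos_of_pos (Ah_pos Hm p1 li) _
  obtain ⟨δ, δ0, δ1, δB, hδ⟩ := dsel p (Bh Hm) η li B0 hη
  obtain ⟨d1, d10, hd1⟩ := Gh_near Bh Bh_cont Hm δ p1 li δ0
  obtain ⟨d2, d20, hd2⟩ := dpick δ δ0 δ1
  set d := min (min d1 d2) (p*θ/4) with hdd
  have d0 : 0 < d := po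
  have dd1 : d ≤ d1 := (min_le_left _ _).trans (min_le_left _ _)
  have dd2 := hd2 d d0.le ((min_le_left _ _).trans (min_le_right _ _))
  have dd3 : d ≤ p*θ/4 := min_le_right _ _
  clear_value d
  clear hdd
  obtain ⟨A0, hA0, A1, hA1, hA⟩ := c_rng Ah Ah_cont Ah_pos Hm HM p1 p2 li
  obtain ⟨M, hM⟩ := exists_nat_ge (4/r)
  rw [div_le_iff₀ r0, mul_comm] at hM
  obtain ⟨k0, k01, C, hC, hl⟩ := lo1 X Z M δ δ0
  set s1 := p/(p+2*d) with hs1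
  have s11 : s1 < 1 := by rw [hs1, div_lt_one po]; linarith
  have s12 : 1-θ/2 ≤ s1 := by rw [hs1, le_div_iff₀ po]; nlinarith only [dd3, mul_pos t0 d0]
  obtain ⟨s, hs⟩ : ∃ s, s = max s1 (1-θ) := ⟨_, rfl⟩
  have ss1 : s1 ≤ s := hs ▸ le_max_left _ _
  have ss2 : 1-θ ≤ s := hs ▸ le_max_right _ _
  set b := Bh Hm - δ with hb
  set B := Bh Hm + δ with hBd
  have b0 : 0 < b := li
  have hB0 : 0 < B := li
  clear_value s1 B
  set I := Idl p δ
  have I0 : 0 ≤ I := Idl_nn p δ δ0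
  have hpi := pi_gt_three
  set K := (1-δ)/(1+2*δ)*(I/π)*b with hK
  have K0 : 0 ≤ K := by have : 0 ≤ 1-δ := li
                        positivity
  set D := δ^(-3:ℝ) with hD
  have D0 : 0 < D := po
  have hδ' : Gh Hm - η ≤ K/(1+δ) := by
    refine le_trans (le_of_eq ?_) hδ
    rw [Gh, Bh, hp]
  clear hδ
  have I1 : I = Idl p δ := rfl
  clear_value D K I b
  refine ⟨s, hs ▸ max_lt s11 li, 3*K+4*B/δ, po, ?_⟩
  filter_upwards [ev_eta X p δ p0 li δ0, ev_eta X p (θ/2) p0 li po, eventually_ge_atTop 1,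
    ev p 0 (θ/2) ((k0+2)/δ*((1+2*δ)*π*2/b)) p0 li, ev p (-(3*θ)) (-(5*θ/2)) (9*(C*A1*D)) p0 li,
    ev p (-(θ/4)) 0 (C*(2/A0*D)*(B/δ)) p0 li, ev p (-(5*θ/4)) 0 4 p0 li] with γ e1 e2 hγ e3 e4 e5 e6
  replace e3 := e3.1; replace e4 := e4.1; replace e5 := e5.1; replace e6 := e6.1
  rw [rpow_zero] at e5 e6 e3
  have hY : 1 ≤ γ^(1/p) := one_le_rpow hγ po
  obtain ⟨n1, n2, n3⟩ := pwn (γ^(1/p)) θ hY li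
  have hYp : (γ^(1/p))^p = γ := by rw [← rpow_mul li, one_div_mul_cancel p0.ne', rpow_one]
  have EH := fun j : ℕ => fun hj : H (ca j/(⌈(γ^(1/p))^(1-θ)⌉₊:ℝ)) ≤ Hm+d => show (γ^(1/p))^(1-θ/2) ≤ Ex H γ (ca j/(⌈(γ^(1/p))^(1-θ)⌉₊:ℝ)) by
    refine (rl hY s12).trans ?_
    rw [← rpow_mul li, hs1, show 1/p*(p/(p+2*d)) = 1/(p+2*d) by field_simp]
    refine rl hγ (one_div_le_one_div_of_le (by linarith [X.lo (ca j/(⌈(γ^(1/p))^(1-θ)⌉₊:ℝ))]) li)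
  have ET := fun j : ℕ => Ex_top X p γ (ca j/(⌈(γ^(1/p))^(1-θ)⌉₊:ℝ)) hp hγ
  have EF := fun (j : ℕ) hj => Ex_far X p d γ (ca j/(⌈(γ^(1/p))^(1-θ)⌉₊:ℝ)) hp d0 hγ hj
  set Y := γ^(1/p) with hYd
  set n := ⌈Y^(1-θ)⌉₊
  clear_value n Y
  have Y0 : 0 < Y := li
  have Ys : ∀ t ≤ s, Y^t ≤ Y^s := fun t ht => rl hY ht
  have Ya : ∀ a b : ℝ, Y^a*Y^b = Y^(a+b) := fun a b => (rpow_add Y0 a b).symm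
  set e := Y^(-(5*θ/4)) with he
  have e0 : 0 < e := po
  have ee : e^2 = Y^(-(5*θ/2)) := by rw [sq, he, Ya]; ring_nf
  clear_value e
  have e64 : e ≤ 1/4 := by linarith only [e6]
  have hlog : -(4*e) ≤ log (1-2*e) := by
    have := one_sub_inv_le_log_of_pos (show 0 < 1-2*e by linarith only [e64])
    have q : (1-2*e)⁻¹ ≤ 1+4*e := by rw [inv_le_iff_one_le_mul₀ (by linarith only [e64])]; nlinarith only [e0, e64]
    linarith only [this, q]
  set c : ℕ → ℝ := fun j => cc (γ*Ah (H dv j n)/(1+2*δ)) (2*H dv j n+1) n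
  set g := (rg n).filter fun j : ℕ => Y^(-(10*θ)) ≤ ca j/n ∧ H dv j n ≤ Hm+d
  have blkj := fun j : ℕ => blk (H dv j n) γ δ n (by linarith [X.lo dv j n]) (by linarith [X.hi dv j n]) hγ δ0 δ1 n1
  have cu : ∀ j ∈ g, c j ≤ B*Y/n := fun j hj => by
    have hj := (Finset.mem_filter.1 hj).2.2
    have := abs_le.1 (hd1 _ (X.lo dv j n) li)
    refine (blkj j).1.trans ?_
    have := Ex_pos H γ dv j n hγ
    gcongr
    · linarith
    · exact ET j
  have cl : ∀ j ∈ g, b*Ex H γ dv j n/((1+2*δ)*π*n) ≤ c j := fun j hj => by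
    have hj := (Finset.mem_filter.1 hj).2.2
    have := abs_le.1 (hd1 _ (X.lo dv j n) li)
    refine le_trans ?_ (blkj j).2.1
    have := Ex_pos H γ dv j n hγ
    change _ ≤ Bh (H dv j n)*Ex H γ dv j n/((1+2*δ)*π*n)
    gcongr
    linarith
  have ck : ∀ j ∈ g, k0+2 ≤ δ*c j := fun j hj => by
    refine le_trans ?_ (ll (cl j hj) δ0.le)
    have q1 : b*Y^(θ/2)/((1+2*δ)*π*2) ≤ b*Ex H γ dv j n/((1+2*δ)*π*n) := by
      rw [div_le_div_iff₀ po po]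
      have q := EH j (Finset.mem_filter.1 hj).2.2
      calc _ = b*((1+2*δ)*π)*(Y^(θ/2)*n) := by ring
        _ ≤ b*((1+2*δ)*π)*(Y^(θ/2)*(2*Y^(1-θ))) := by gcongr
        _ = b*((1+2*δ)*π)*2*Y^(1-θ/2) := by rw [show b*((1+2*δ)*π)*(Y^(θ/2)*(2*Y^(1-θ))) = b*((1+2*δ)*π)*2*(Y^(θ/2)*Y^(1-θ)) by ring, Ya]; ring_nf
        _ ≤ b*((1+2*δ)*π)*2*Ex H γ dv j n := by gcongr
        _ = _ := by ring
    refine le_trans ?_ (ll q1 δ0.le)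
    calc (k0+2:ℝ) = δ*(b*((k0+2)/δ*((1+2*δ)*π*2/b)*1)/((1+2*δ)*π*2)) := by field_simp
      _ ≤ _ := by gcongr
  have c0 : ∀ j ∈ g, 0 < c j := fun j hj => by
    by_contra! h
    linarith only [ck j hj, Nat.cast_nonneg (α := ℝ) k0, mul_nonpos_of_nonneg_of_nonpos δ0.le h]
  let emb : (Σ _ : ℕ, ℕ) ↪ ℕ × ℕ := ⟨fun x => (x.1, x.2), fun ⟨a, b⟩ ⟨c, d⟩ h => by obtain ⟨rfl, rfl⟩ := Prod.mk.inj h; rfl⟩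
  have main := hl n n1 e2.1 (Y^(-(10*θ))) po γ hγ e e0.le (by linarith only [e64]) ((g.sigma fun j => Finset.Ico ⌈δ*c j⌉₊ ⌊c j/δ⌋₊).map emb) (by
    intro t ht
    obtain ⟨⟨j, k⟩, hjk, rfl⟩ := Finset.mem_map.1 ht
    obtain ⟨hj, hk⟩ := Finset.mem_sigma.1 hjk
    have hj2 := Finset.mem_filter.1 hj
    obtain ⟨ka, kb⟩ := Finset.mem_Ico.1 hk
    have ka := Nat.ceil_le.1 ka
    have kb : ca k ≤ c j/δ := (Nat.le_floor_iff (div_nonneg (c0 j hj).le δ0.le)).1 kb.le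
    obtain ⟨u1, u2⟩ := (blkj j).2.2 k ka kb
    rw [← hD] at u1 u2
    have hAj := hA (H dv j n) ⟨X.lo _, X.hi _⟩
    refine ⟨Finset.mem_range.1 hj2.1, hj2.2.1, ?_, ?_, ?_⟩
    · have := ck j hj
      exact_mod_cast (by linarith : ca k0 ≤ k)
    · change C*(π*k*n)^(2*H dv j n+1)*bt Hm θ r (Y^(-(10*θ))) n M^2*(1/n) ≤ e^2
      have bb := (pw Y n M hY n1 n2 p1 t0 h2 h3 h4 hM).1
      have bn : 0 ≤ bt Hm θ r (Y^(-(10*θ))) n M := by unfold bt; positivity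
      calc _ ≤ C*(γ*A1*D)*(3*Y^(-(Hm+2*θ)))^2*Y^(-(1-θ)) := by
            have : (π*k*n)^(2*H dv j n+1) ≤ γ*A1*D := u1.trans (by gcongr; exact hAj.2)
            gcongr
        _ = 9*(C*A1*D)*(Y^p*(Y^(-(Hm+2*θ))*Y^(-(Hm+2*θ))*Y^(-(1-θ)))) := by rw [hYp]; ring
        _ = 9*(C*A1*D)*Y^(-(3*θ)) := by rw [Ya, Ya, Ya, hp]; ring_nf
        _ ≤ _ := by rw [ee]; exact e4
    · change C*γ*k*(π*k*n)^(-(2*H dv j n+1))*e ≤ 1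
      have kB : ca k ≤ B/δ*Y^θ := by
        refine kb.trans ?_
        rw [div_mul_eq_mul_div]
        refine div_le_div_of_nonneg_right ((cu j hj).trans ?_) δ0.le
        calc B*Y/n = B*(Y^ca 1*(1/n)) := by rw [rpow_one]; ring
          _ ≤ B*(Y^ca 1*Y^(-(1-θ))) := by gcongr
          _ = _ := by rw [Ya]; ring_nf
      calc _ = C*(γ*(π*k*n)^(-(2*H dv j n+1)))*k*e := by ring
        _ ≤ C*(2/A0*D)*(B/δ*Y^θ)*e := by
            have : γ*(π*k*n)^(-(2*H dv j n+1)) ≤ 2/A0*D := u2.trans (by gcongr; exact hAj.1)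
            gcongr
        _ = C*(2/A0*D)*(B/δ)*(Y^θ*Y^(-(5*θ/4))) := by rw [he]; ring
        _ = C*(2/A0*D)*(B/δ)*Y^(-(θ/4)) := by rw [Ya]; ring_nf
        _ ≤ 1 := e5)
  rw [Finset.sum_map, Finset.sum_sigma] at main
  refine le_trans ?_ main
  have perj : ∀ j ∈ g, K*(1/n*Ex H γ dv j n) - 4*e*(B*Y/n/δ) ≤ ∑ k ∈ Finset.Ico ⌈δ*c j⌉₊ ⌊c j/δ⌋₊, (log (1+(ca k/c j)^(-(2*H dv j n+1))) + log (1-2*e)) := fun j hj => by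
    have hj2 := (Finset.mem_filter.1 hj).2.2
    rw [Finset.sum_add_distrib, Finset.sum_const, nsmul_eq_mul]
    have q1 := I1 ▸ per p δ d (2*H dv j n+1) (c j) li δ0 δ1 dd2 (by linarith [X.lo dv j n]) li (by linarith only [ck j hj, Nat.cast_nonneg (α := ℝ) k0])
    have q2 : K*(1/n*Ex H γ dv j n) ≤ c j*((1-δ)*I) := by
      calc _ = b*Ex H γ dv j n/((1+2*δ)*π*n)*((1-δ)*I) := by rw [hK]; field_simp
        _ ≤ _ := lr (cl j hj) (mul_nonneg li I0)
    have q3 : ((Finset.Ico ⌈δ*c j⌉₊ ⌊c j/δ⌋₊).card:ℝ) ≤ B*Y/n/δ := by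
      rw [Nat.card_Ico]
      calc ((⌊c j/δ⌋₊-⌈δ*c j⌉₊:ℕ):ℝ) ≤ (⌊c j/δ⌋₊:ℝ) := by exact_mod_cast Nat.sub_le _ _
        _ ≤ c j/δ := Nat.floor_le (div_nonneg (c0 j hj).le δ0.le)
        _ ≤ _ := div_le_div_of_nonneg_right (cu j hj) δ0.le
    have q4 : -(4*e*(B*Y/n/δ)) ≤ ((Finset.Ico ⌈δ*c j⌉₊ ⌊c j/δ⌋₊).card:ℝ)*log (1-2*e) := by
      have := ll hlog (Nat.cast_nonneg (α := ℝ) (Finset.Ico ⌈δ*c j⌉₊ ⌊c j/δ⌋₊).card)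
      nlinarith only [this, lr q3 (show 0 ≤ 4*e by positivity)]
    linarith only [q1, q2, q4]
  refine le_trans ?_ (Finset.sum_le_sum perj)
  have Q0 : 0 ≤ 4*e*(B*Y/n/δ) := po
  have s2 : ∑ j ∈ g, 4*e*(B*Y/n/δ) ≤ 4*B/δ*Y^s := by
    calc _ ≤ ∑ j ∈ rg n, 4*e*(B*Y/n/δ) := Finset.sum_le_sum_of_subset_of_nonneg (Finset.filter_subset _ _) fun _ _ _ => Q0
      _ = 4*B/δ*(Y^ca 1*e) := by rw [Finset.sum_const, Finset.card_range, nsmul_eq_mul, rpow_one]; field_simp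
      _ = 4*B/δ*Y^(1+(-(5*θ/4))) := by rw [he, Ya]
      _ ≤ _ := ll (Ys _ li) po
  have J0 : 0 ≤ JJ H γ := integral_nonneg fun x => Ex_pos H γ x hγ
  have s3 : ∑ j ∈ rg n, 1/n*Ex H γ dv j n ≤ ∑ j ∈ g, 1/n*Ex H γ dv j n + 3*Y^s := by
    calc _ ≤ ∑ j ∈ rg n, ((if Y^(-(10*θ)) ≤ ca j/n ∧ H dv j n ≤ Hm+d then 1/n*Ex H γ dv j n else 0) + (if Y^(-(10*θ)) ≤ ca j/n then 0 else Y/n) + 1/n*Y^s1) := by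
          refine Finset.sum_le_sum fun j _ => ?_
          have z : 0 ≤ 1/n*Y^s1 := po
          by_cases ha : Y^(-(10*θ)) ≤ ca j/n
          · by_cases hb : H dv j n ≤ Hm+d
            · rw [if_pos ⟨ha, hb⟩, if_pos ha]; linarith
            · rw [if_neg (fun h => hb h.2), if_pos ha, zero_add, zero_add]
              exact ll ((EF j (not_le.1 hb).le).trans (by rw [hs1])) po
          · rw [if_neg (fun h => ha h.1), if_neg ha]
            have : 1/n*Ex H γ dv j n ≤ 1/n*Y := ll (ET j) po
            linarith [show 1/n*Y = Y/n by ring]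
      _ ≤ ∑ j ∈ g, 1/n*Ex H γ dv j n + (Y^(-(10*θ))+1/n)*Y + Y^s1 := by
          rw [Finset.sum_add_distrib, Finset.sum_add_distrib, Finset.sum_const, Finset.card_range, nsmul_eq_mul, ← Finset.sum_filter]
          have := card_a0 (Y^(-(10*θ))) n n1 po Y Y0.le
          have z : ca n*(1/n*Y^s1) = Y^s1 := by field_simp
          rw [z]; linarith
      _ ≤ _ := by
          have z1 : Y^(-(10*θ))*Y ≤ Y^s := by
            conv_lhs => rw [← rpow_one Y, ← rpow_mul Y0.le, one_mul, Ya]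
            exact Ys _ li
          have z2 : 1/n*Y ≤ Y^s := by
            calc 1/n*Y ≤ Y^(-(1-θ))*Y^ca 1 := by rw [rpow_one]; gcongr
              _ = Y^(-(1-θ)+1) := Ya _ _
              _ ≤ _ := Ys _ li
          have z3 := Ys s1 ss1
          linarith
  have s4 : JJ H γ ≤ (1+δ)*∑ j ∈ rg n, 1/n*Ex H γ dv j n := (JJ_cmp X γ hγ n n1).2.trans (lr e1.2 (Finset.sum_nonneg fun j _ => mul_nonneg po (Ex_pos H γ _ hγ)))
  have s5 : JJ H γ/(1+δ) ≤ ∑ j ∈ g, 1/n*Ex H γ dv j n + 3*Y^s := by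
    refine le_trans ?_ s3
    rw [div_le_iff₀ po]; linarith
  rw [Finset.sum_sub_distrib, ← ms]
  have s6 := ll s5 K0
  have s7 := lr hδ' J0
  have s8 : K/(1+δ)*JJ H γ = K*(JJ H γ/(1+δ)) := by ring
  linarith only [s2, s6, s7, s8]
end
section
variable {H : ℝ → ℝ} {Hm HM θ r Ch Cc : ℝ}
lemma q_zero (w : ℝ → ℝ) (σ L0 p s : ℝ) (W : WRV w σ L0) (hp : 0 < p) (hs : s < 1) : Tendsto (fun γ : ℝ => (γ^(1/p))^s/(γ^(1/p)*w (log γ))) atTop (nhds 0) := by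
  set a := (1-s)/(2*p) with ha
  have a0 : 0 < a := div_pos li po
  have h1 := (W.log_div.comp tendsto_log_atTop).eventually_const_le (show -a < 0 by linarith)
  have h2 := tendsto_log_atTop.eventually_ge_atTop (max L0 1)
  refine squeeze_zero' ?_ ?_ (tendsto_rpow_neg_atTop a0)
  · filter_upwards [h2, eventually_gt_atTop 0] with γ g2 g0
    have := W.pos _ ((le_max_left _ _).trans g2)
    positivity
  · filter_upwards [h1, h2, eventually_gt_atTop 0] with γ g1 g2 g0
    have wp := W.pos _ ((le_max_left _ _).trans g2)
    have l1 : 1 ≤ log γ := (le_max_right _ _).trans g2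
    simp only [Function.comp] at g1
    rw [le_div_iff₀ li, ← log_rpow g0, log_le_log_iff po wp] at g1
    rw [div_le_iff₀ po]
    calc (γ^(1/p))^s = γ^(-a)*(γ^(1/p)*γ^(-a)) := by
          rw [← rpow_mul g0.le, ← rpow_add g0, ← rpow_add g0, ha]; congr 1; field_simp; ring
      _ ≤ _ := by gcongr
lemma conc (X : Ctx H Hm HM θ r Ch Cc) {H' : ℝ → ℝ} [MeasurableSpace EE] [BorelSpace EE] {μ : Measure EE} (Z : GM H H' μ)
    (h2 : 14*θ ≤ 1-Hm) (h3 : 7*θ ≤ r) (h4 : r ≤ 1) (p : ℝ) (hp : p = 2*Hm+1) (w : ℝ → ℝ) (σ L0 : ℝ) (W : WRV w σ L0)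
    (hm : ∀ L, L0 ≤ L → volume.real ({x | H x - Hm < 1/L} ∩ Icc 0 1) = w L) :
    Tendsto (fun γ => Flog μ γ/(γ^(1/p)*w (log γ))) atTop (nhds (Gh Hm*(Gamma (σ+1) * (p^2/2)^σ))) := by
  have p1 := X.par.h1
  have p0 : 0 < p := li
  have R : Tendsto (fun γ => JJ H γ/(γ^(1/p)*w (log γ))) atTop _ := Jasym H X.cont.measurable Hm li X.lo w σ L0 p W hp hm
  have J0 : 0 < Gamma (σ+1) * (p^2/2)^σ := mul_pos (gp (by linarith [W.hs])) po
  set J := Gamma (σ+1) * (p^2/2)^σ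
  have ps : ∀ᶠ γ : ℝ in atTop, 0 < γ^(1/p)*w (log γ) := by
    filter_upwards [tendsto_log_atTop.eventually_ge_atTop L0, eventually_gt_atTop 0] with γ g2 g0
    have := W.pos _ g2
    positivity
  refine tendsto_order.2 ⟨fun a ha => ?_, fun a ha => ?_⟩
  · obtain ⟨s, s1, C, C0, hl⟩ := loA X Z h2 h3 h4 p hp ((Gh Hm*J-a)/(2*J)) (div_pos li po)
    have T := (R.const_mul (Gh Hm-(Gh Hm*J-a)/(2*J))).sub ((q_zero w σ L0 p s W p0 s1).const_mul C)
    have e : (Gh Hm-(Gh Hm*J-a)/(2*J))*J-C*0 = (Gh Hm*J+a)/2 := by field_simp; ring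
    rw [e] at T
    filter_upwards [T.eventually_const_lt (show a < _ by linarith), hl, ps] with γ g1 g2 g3
    refine g1.trans_le ?_
    rw [← mul_div_assoc, ← mul_div_assoc, ← sub_div]
    exact div_le_div_of_nonneg_right g2 g3.le
  · obtain ⟨s, s1, C, C0, hl⟩ := upA X Z h2 h3 h4 p hp ((a-Gh Hm*J)/(2*J)) (div_pos li po)
    have T := (R.const_mul (Gh Hm+(a-Gh Hm*J)/(2*J))).add ((q_zero w σ L0 p s W p0 s1).const_mul C)
    have e : (Gh Hm+(a-Gh Hm*J)/(2*J))*J+C*0 = (Gh Hm*J+a)/2 := by field_simp; ring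
    rw [e] at T
    filter_upwards [T.eventually_lt_const (show _ < a by linarith), hl, ps] with γ g1 g2 g3
    refine lt_of_le_of_lt ?_ g1
    rw [← mul_div_assoc, ← mul_div_assoc, ← add_div]
    exact div_le_div_of_nonneg_right g2 g3.le
def Pj (x : ℝ) : ℝ := max 0 (min 1 x)
lemma Pj_mem (x : ℝ) : Pj x ∈ Icc ca 0 1 := ⟨le_max_left _ _, max_le zero_le_one (min_le_left _ _)⟩
lemma Pj_eq (x : ℝ) (h : x ∈ Icc ca 0 1) : Pj x = x := by rw [Pj, min_eq_right h.2, max_eq_right h.1]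
lemma Pj_lip (x y : ℝ) : |Pj x - Pj y| ≤ |x-y| := by
  unfold Pj
  rcases abs_cases (x-y) with ⟨h, _⟩ | ⟨h, _⟩ <;> rw [h, abs_le] <;> grind
lemma mkCtx (H : ℝ → ℝ) (r : ℝ) (hr : 0 < r) (hHol : HolderOn H r (Icc 0 1)) (hrange : ∀ x ∈ Icc ca 0 1, 1/2 < H x ∧ H x < 1)
    (Hm : ℝ) (hH : IsLeast (H '' Icc 0 1) Hm) : ∃ HM θ r' Ch Cc : ℝ, Ctx (fun x => H (Pj x)) Hm HM θ r' Ch Cc ∧ 14*θ ≤ 1-Hm ∧ 7*θ ≤ r' ∧ r' ≤ 1 := by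
  obtain ⟨C, hC⟩ := hHol
  have r'0 : 0 < min r 1 := lt_min hr one_pos
  have hol : ∀ x y, |H (Pj x) - H (Pj y)| ≤ (|C|+1)*|x-y|^(min r 1) := fun x y => by
    have l1 : |Pj x - Pj y| ≤ 1 := by rw [abs_le]; constructor <;> linarith [(Pj_mem x).1, (Pj_mem x).2, (Pj_mem y).1, (Pj_mem y).2]
    calc _ ≤ C*|Pj x - Pj y|^r := hC _ (Pj_mem x) _ (Pj_mem y)
      _ ≤ (|C|+1)*|Pj x - Pj y|^r := by gcongr; linarith [le_abs_self C]
      _ ≤ (|C|+1)*|Pj x - Pj y|^(min r 1) := by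
          gcongr ?_ * ?_
          exact rpow_le_rpow_of_exponent_ge' (abs_nonneg _) l1 r'0.le (min_le_left _ _)
      _ ≤ _ := ll (rpow_le_rpow (abs_nonneg _) (Pj_lip x y) r'0.le) po
  have cont : Continuous fun x => H (Pj x) := by
    refine continuous_iff_continuousAt.2 fun x => tendsto_iff_dist_tendsto_zero.2 (squeeze_zero (fun _ => dist_nonneg) (fun y => hol y x) ?_)
    have : Continuous fun y : ℝ => (|C|+1)*|y-x|^(min r 1) := continuous_const.mul ((continuous_id.sub continuous_const).abs.rpow_const fun _ => Or.inr r'0.le)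
    have := this.tendsto x
    simpa [zero_rpow r'0.ne'] using this
  obtain ⟨z, hz, hzm⟩ := (isCompact_Icc (a := ca 0) (b := 1)).exists_isMaxOn ⟨0, by simp⟩ cont.continuousOn
  have hi : ∀ x, H (Pj x) ≤ H z := fun x => by
    have := hzm (Pj_mem x)
    simpa [Pj_eq _ (Pj_mem x), Pj_eq _ hz] using this
  have lo : ∀ x, Hm ≤ H (Pj x) := fun x => hH.2 ⟨_, Pj_mem x, rfl⟩
  have hz1 := (hrange z hz).2
  obtain ⟨y, hy, hyH⟩ := hH.1
  have hm1 : 1/2 < Hm := hyH ▸ (hrange y hy).1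
  have hmM : Hm ≤ H z := (lo z).trans (hi z)
  obtain ⟨Cc, Cc0, c1, c2⟩ := cstar_lip Hm (H z) hm1 hz1
  obtain ⟨θ, t0, t⟩ : ∃ θ : ℝ, 0 < θ ∧ θ ≤ (Hm-1/2)/16 ∧ θ ≤ (1-H z)/16 ∧ θ ≤ min r 1/16 :=
    ⟨min ((Hm-1/2)/16) (min ((1-H z)/16) (min r 1/16)), lt_min li (lt_min li li), min_le_left _ _, (min_le_right _ _).trans (min_le_left _ _), (min_le_right _ _).trans (min_le_right _ _)⟩
  obtain ⟨ta, tb, tc⟩ := t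
  refine ⟨H z, θ, min r 1, |C|+1, Cc, ⟨⟨hm1, hmM, li, t0, li, li⟩, cont, lo, hi, r'0, po, hol, Cc0, fun x y => c1 _ ⟨lo x, hi x⟩ _ ⟨lo y, hi y⟩, fun x => c2 _ ⟨lo x, hi x⟩⟩, li, li, min_le_right _ _⟩
lemma mkW (H : ℝ → ℝ) (Hm : ℝ) (hH : ∀ x ∈ Icc ca 0 1, Hm ≤ H x) (hD : volume {x | x ∈ Icc ca 0 1 ∧ H x = Hm} = 0)
    (σ s₀ : ℝ) (φ : ℝ → ℝ) (hσ : 0 < σ) (hs₀ : 0 < s₀) (hφpos : ∀ u : ℝ, 0 < u → 0 < φ u)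
    (hφslow : ∀ c : ℝ, 0 < c → Tendsto (fun u => φ (c * u) / φ u) atTop (nhds 1))
    (hmeas : ∀ s : ℝ, 0 < s → s < s₀ → (volume {x | x ∈ Icc ca 0 1 ∧ 0 < H x - Hm ∧ H x - Hm < s}).toReal = s ^ σ * φ (1 / s)) :
    ∃ L0, WRV (fun L => L^(-σ)*φ L) σ L0 ∧ ∀ L, L0 ≤ L → volume.real ({x | H (Pj x) - Hm < 1/L} ∩ Icc 0 1) = L^(-σ)*φ L := by
  have key : ∀ L, max 1 (2/s₀) ≤ L → volume.real {x | x ∈ Icc ca 0 1 ∧ 0 < H x - Hm ∧ H x - Hm < 1/L} = L^(-σ)*φ L := fun L hL => by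
    have l1 : 1 ≤ L := (le_max_left _ _).trans hL
    have l2 : 2/s₀ ≤ L := (le_max_right _ _).trans hL
    rw [div_le_iff₀ hs₀] at l2
    have := hmeas (1/L) po (by rw [div_lt_iff₀ li]; linarith)
    rw [Measure.real, this, one_div_one_div, one_div, inv_rpow li, rpow_neg li]
  refine ⟨max 1 (2/s₀), ⟨le_max_left _ _, hσ, fun L hL => ?_, fun L hL L' hL' hh => ?_, fun c hc => ?_⟩, fun L hL => ?_⟩
  · have l1 : 1 ≤ L := (le_max_left _ _).trans hL
    have := hφpos L li
    positivity
  · have l1 : 1 ≤ L := (le_max_left _ _).trans hL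
    change L'^(-σ)*φ L' ≤ L^(-σ)*φ L
    rw [← key L hL, ← key L' hL']
    refine measureReal_mono (fun x hx => ⟨hx.1, hx.2.1, hx.2.2.trans_le (by gcongr)⟩) (measure_ne_top_of_subset (fun x hx => hx.1) (by simp : volume (Icc ca 0 1) ≠ ⊤))
  · have := (hφslow c hc).const_mul (c^(-σ))
    rw [mul_one] at this
    refine this.congr' ?_
    filter_upwards [eventually_gt_atTop 0] with L hL
    have := hφpos L hL
    rw [mul_rpow hc.le hL.le]
    have : L^(-σ) ≠ 0 := po
    field_simp
  · rw [← key L hL]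
    refine measureReal_congr (ae_eq_set.2 ⟨measure_mono_null ?_ hD, ?_⟩)
    · rintro x ⟨⟨hx1, hx2⟩, hx3⟩
      refine ⟨hx2, ?_⟩
      simp only [mem_setOf_eq, Pj_eq x hx2] at hx1 hx3
      by_contra hne
      exact hx3 ⟨hx2, sub_pos.2 (lt_of_le_of_ne (hH x hx2) (Ne.symm hne)), hx1⟩
    · convert measure_empty (μ := volume)
      rw [diff_eq_empty]
      intro x hx
      exact ⟨by simp only [mem_setOf_eq, Pj_eq x hx.1]; exact hx.2.2, hx.1⟩
lemma fin (H : ℝ → ℝ) (r : ℝ) (hr : 0 < r) (hHol : HolderOn H r (Icc 0 1))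
    (hrange : ∀ x ∈ Icc ca 0 1, 1/2 < H x ∧ H x < 1)
    (Hm : ℝ) (hH : IsLeast (H '' Icc 0 1) Hm) (hD : volume {x | x ∈ Icc ca 0 1 ∧ H x = Hm} = 0)
    (σ s₀ : ℝ) (φ : ℝ → ℝ) (hσ : 0 < σ) (hs₀ : 0 < s₀) (hφpos : ∀ u : ℝ, 0 < u → 0 < φ u)
    (hφslow : ∀ c : ℝ, 0 < c → Tendsto (fun u => φ (c * u) / φ u) atTop (nhds 1))
    (hmeas : ∀ s : ℝ, 0 < s → s < s₀ → (volume {x | x ∈ Icc ca 0 1 ∧ 0 < H x - Hm ∧ H x - Hm < s}).toReal = s ^ σ * φ (1 / s))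
    [MeasurableSpace EE] [BorelSpace EE]
    (μ : Measure EE) [IsProbabilityMeasure μ] (hG : ∀ L : EE →L[ℝ] ℝ, ∃ v : ℝ≥0, μ.map L = gR 0 v)
    (hCov : ∀ u v : EE, ∫ f, (inner ℝ u f) * (inner ℝ v f) ∂μ = ∫ x in uI, ∫ y in uI, GmfBM H x y * u x * v y) :
    Tendsto (fun ε : ℝ => ε ^ (1 / Hm) * ((log (1/ε)) ^ σ / φ (log (1/ε))) ^ ((2 * Hm + 1) / (2 * Hm)) * log (μ {f | ‖f‖ ≤ ε}).toReal)
      (nhdsWithin 0 (Ioi 0))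
      (nhds (-(Hm * ((Gamma (2 * Hm + 1) * sin (π * Hm)) ^ (1 / (2 * Hm + 1)) * Gamma (σ + 1) * (Hm * (Hm + 1/2)) ^ σ /
          ((2 * Hm + 1) * sin (π / (2 * Hm + 1)))) ^ ((2 * Hm + 1) / (2 * Hm))))) := by
  obtain ⟨HM, θ, r', Ch, Cc, X, t1, t2, t3⟩ := mkCtx H r hr hHol hrange Hm hH
  obtain ⟨L0, W, hm⟩ := mkW H Hm (fun x hx => hH.2 ⟨x, hx, rfl⟩) hD σ s₀ φ hσ hs₀ hφpos hφslow hmeas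
  have p1 := X.par.h1
  have p2 : Hm < 1 := by linarith [X.par.h2, X.par.h3, X.par.e0]
  have hF := conc X ⟨fun x hx => by rw [Pj_eq x hx], ‹_›, hG, hCov⟩ t1 t2 t3 (2*Hm+1) rfl _ σ L0 W hm
  exact final_red μ Hm (2*Hm+1) (Ah Hm) (sin (π/(2*Hm+1))) σ (Gamma (σ+1)) _ L0 φ hφpos li rfl (Ah_pos Hm p1 p2) (sinp_pos Hm p1) (gp li) (by rw [Gh]; ring) W hF
end
end
/-- Small ball asymptotics for the multifractal Brownian motion, case `Leb(D) = 0`. -/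
theorem mfBM_small_ball_zeroD
    (H : ℝ → ℝ) (r : ℝ) (hr : 0 < r) (hHol : HolderOn H r (Icc 0 1))
    (hrange : ∀ x ∈ Icc (0:ℝ) 1, 1/2 < H x ∧ H x < 1)
    (Hmin : ℝ) (hHmin : IsLeast (H '' Icc 0 1) Hmin)
    (D : Set ℝ) (hD : D = {x | x ∈ Icc (0:ℝ) 1 ∧ H x = Hmin})
    -- Assumption 1
    (d : ℝ → ℝ) (c₁ c₂ C₀ κ : ℝ) (hc₁ : 0 < c₁) (hc₂ : 0 < c₂) (hC₀ : 0 < C₀) (hκ : 0 < κ)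
    (hd₁ : ∀ x ∈ Icc (0:ℝ) 1, c₁ * infDist x D ≤ d x ∧ d x ≤ c₂ * infDist x D)
    (hd₂ : ContDiffOn ℝ (⊤ : ℕ∞) d (Icc 0 1 \ D))
    (hd₃ : ∀ n : ℕ, 1 ≤ n → ∃ Cn : ℝ, ∀ x ∈ Icc (0:ℝ) 1 \ D,
      |iteratedDerivWithin n d (Icc 0 1 \ D) x| ≤ Cn * d x ^ ((1:ℝ) - n))
    (hhd : ∀ x ∈ Icc (0:ℝ) 1, H x - Hmin ≤ C₀ * d x ^ κ)
    -- Assumption 2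
    (h₀ h₁ : ℝ → ℝ) (β : ℝ) (hβ : 0 < β)
    (hsplit : ∀ x ∈ Icc (0:ℝ) 1, H x - Hmin = h₀ x + h₁ x)
    (hh₀Hol : HolderOn h₀ β (Icc 0 1)) (hh₁Hol : HolderOn h₁ β (Icc 0 1))
    (hh₀sm : ContDiffOn ℝ (⊤ : ℕ∞) h₀ (Icc 0 1 \ D))
    (hh₀der : ∀ n : ℕ, 1 ≤ n → ∃ Cn : ℝ, ∀ x ∈ Icc (0:ℝ) 1 \ D,
      |iteratedDerivWithin n h₀ (Icc 0 1 \ D) x| ≤ Cn * h₀ x * d x ^ (-(n:ℝ)))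
    (τ δ₀ C' : ℝ) (hτ : 0 < τ) (hδ₀ : 0 < δ₀) (hC' : 0 < C')
    (hh₁sm : ∀ x ∈ Icc (0:ℝ) 1, h₀ x < δ₀ → |h₁ x| ≤ C' * h₀ x ^ (1 + τ))
    -- Assumption 3
    (σ s₀ : ℝ) (φ : ℝ → ℝ) (hσ : 0 < σ) (hs₀ : 0 < s₀)
    (hφm : Measurable φ) (hφpos : ∀ u : ℝ, 0 < u → 0 < φ u)
    (hφslow : ∀ c : ℝ, 0 < c → Tendsto (fun u => φ (c * u) / φ u) atTop (nhds 1))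
    (hmeas : ∀ s : ℝ, 0 < s → s < s₀ →
      (volume {x | x ∈ Icc (0:ℝ) 1 ∧ 0 < H x - Hmin ∧ H x - Hmin < s}).toReal = s ^ σ * φ (1 / s))
    -- τ-condition: Leb(D) = 0
    (hDzero : volume D = 0)
    (hτD : σ * (Hmin + 1/2) + (1 - σ) / 2 < τ)
    -- the Gaussian measure
    [MeasurableSpace (Lp ℝ 2 (volume.restrict (Ioo (0:ℝ) 1)))]
    [BorelSpace (Lp ℝ 2 (volume.restrict (Ioo (0:ℝ) 1)))]
    (μ : Measure (Lp ℝ 2 (volume.restrict (Ioo (0:ℝ) 1)))) [IsProbabilityMeasure μ]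
    (hGauss : ∀ L : Lp ℝ 2 (volume.restrict (Ioo (0:ℝ) 1)) →L[ℝ] ℝ,
      ∃ v : ℝ≥0, μ.map L = ProbabilityTheory.gaussianReal 0 v)
    (hCov : ∀ u v : Lp ℝ 2 (volume.restrict (Ioo (0:ℝ) 1)),
      ∫ f, (@inner ℝ _ _ u f) * (@inner ℝ _ _ v f) ∂μ =
        ∫ x in Ioo (0:ℝ) 1, ∫ y in Ioo (0:ℝ) 1, GmfBM H x y * u x * v y) :
    Tendsto (fun ε : ℝ =>
        ε ^ (1 / Hmin) *
          ((Real.log (1/ε)) ^ σ / φ (Real.log (1/ε))) ^ ((2 * Hmin + 1) / (2 * Hmin)) *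
          Real.log (μ {f | ‖f‖ ≤ ε}).toReal)
      (nhdsWithin 0 (Ioi 0))
      (nhds (-(Hmin *
        ((Real.Gamma (2 * Hmin + 1) * Real.sin (Real.pi * Hmin)) ^ (1 / (2 * Hmin + 1)) *
            Real.Gamma (σ + 1) * (Hmin * (Hmin + 1/2)) ^ σ /
          ((2 * Hmin + 1) * Real.sin (Real.pi / (2 * Hmin + 1)))) ^
            ((2 * Hmin + 1) / (2 * Hmin))))) := by
  subst hD
  exact fin H r hr hHol hrange Hmin hHmin hDzero σ s₀ φ hσ hs₀ hφpos hφslow hmeas μ hGauss hCov
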